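/- arXiv:2511.09897 — 2 statements merged into one kernel-verified Lean document; each statement's English description precedes it below -/
import Mathlib

section
/- Let π ∝ exp(−V) on ℝ^d (d ≥ 2) with V C² satisfying the growth condition, as well as assumptions (P1) ((∇²V)_{−1} ⪰ ℓ_V I_{d−1} with ℓ_V > 0) and (RD) (∂₁₁V − ‖∑_{j=2}^d (∂_{1j}V)²‖_{L∞}/ℓ_V ≥ ℓ′_V > 0). Then there exists a unique star-structured minimizer of KL(· ‖ π) over C_star. -/
open MeasureTheory ProbabilityTheory
open scoped ENNReal ProbabilityTheory

open Classical in
/-- Kullback–Leibler divergence: `∫ log (dμ/dπ) dμ` if `μ ≪ π` (and the integral is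
well-defined), and `+∞` otherwise. -/
noncomputable def KL {E : Type*} [MeasurableSpace E] (μ π : Measure E) : ℝ≥0∞ :=
  if μ ≪ π ∧ Integrable (fun z => Real.log (μ.rnDeriv π z).toReal) μ then
    ENNReal.ofReal (∫ z, Real.log (μ.rnDeriv π z).toReal ∂μ)
  else ⊤

/-- The star-structured measure on `ℝ × ℝ^k` with root marginal `μ₁` and leaf
conditional kernels `κ j`, i.e. `μ₁(dz₁) ∏_j κ_j(dz_j ∣ z₁)`. -/
noncomputable def starMeasure {k : ℕ} (μ₁ : Measure ℝ) (κ : Fin k → Kernel ℝ ℝ) :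
    Measure (ℝ × (Fin k → ℝ)) :=
  μ₁.bind fun z₁ => (Measure.dirac z₁).prod (Measure.pi fun j => κ j z₁)

/-- `μ ∈ C_star`: the leaf coordinates are conditionally independent given the root. -/
def IsStar {k : ℕ} (μ : Measure (ℝ × (Fin k → ℝ))) : Prop :=
  IsProbabilityMeasure μ ∧
    ∃ (μ₁ : Measure ℝ) (κ : Fin k → Kernel ℝ ℝ),
      IsProbabilityMeasure μ₁ ∧ (∀ j, IsMarkovKernel (κ j)) ∧ μ = starMeasure μ₁ κ

/-- The probability measure with density proportional to `exp (-V)` (w.r.t. Lebesgue). -/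
noncomputable def gibbs {E : Type*} [MeasureSpace E] (V : E → ℝ) : Measure E :=
  ((volume.withDensity fun z => ENNReal.ofReal (Real.exp (-V z))) Set.univ)⁻¹ •
    (volume.withDensity fun z => ENNReal.ofReal (Real.exp (-V z)))

/-- The squared Euclidean norm on `ℝ × ℝ^k`. -/
def sqNorm {k : ℕ} (v : ℝ × (Fin k → ℝ)) : ℝ := v.1 ^ 2 + ∑ i, v.2 i ^ 2

/-- Growth condition: for every `c₂ > 0` there is `c₁ > 0` with
`|V z| ≤ c₁ exp (c₂ ‖z‖²)`. -/
def GrowthCond {k : ℕ} (V : ℝ × (Fin k → ℝ) → ℝ) : Prop :=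
  ∀ c₂ : ℝ, 0 < c₂ → ∃ c₁ : ℝ, 0 < c₁ ∧ ∀ z, |V z| ≤ c₁ * Real.exp (c₂ * sqNorm z)

/-- Second derivative (Hessian bilinear form) of `V` at `z` in directions `u, v`. -/
noncomputable def hess {k : ℕ} (V : ℝ × (Fin k → ℝ) → ℝ)
    (z u v : ℝ × (Fin k → ℝ)) : ℝ :=
  fderiv ℝ (fun w => fderiv ℝ V w u) z v

/-- The root coordinate direction `e₁`. -/
def e0 {k : ℕ} : ℝ × (Fin k → ℝ) := (1, 0)

/-- The `i`-th leaf coordinate direction. -/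
def eL {k : ℕ} (i : Fin k) : ℝ × (Fin k → ℝ) := (0, Pi.single i 1)

section

open Set Filter Topology

/-- The uniform probability measure on `(0, 1)`. -/
noncomputable def unif : Measure ℝ := volume.restrict (Ioo 0 1)

instance : IsProbabilityMeasure unif := ⟨by simp [unif]⟩

instance : NullSingletonClass unif := by unfold unif; infer_instance

lemma ae_unif_iff {p : ℝ → Prop} : (∀ᵐ u ∂unif, p u) ↔ ∀ᵐ u, u ∈ Ioo (0 : ℝ) 1 → p u := by
  rw [unif, ae_restrict_iff' measurableSet_Ioo]

lemma ae_unif_mem : ∀ᵐ u ∂unif, u ∈ Ioo (0 : ℝ) 1 := by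
  rw [ae_unif_iff]; exact ae_of_all _ fun _ h => h

open Classical in
/-- The quantile function of `ν`, extended by `0` outside `(0, 1)`. -/
noncomputable def quant (ν : Measure ℝ) (u : ℝ) : ℝ :=
  if u ∈ Ioo (0 : ℝ) 1 then sInf {x | u ≤ cdf ν x} else 0

lemma quant_le_iff (ν : Measure ℝ) {u x : ℝ} (hu : u ∈ Ioo (0 : ℝ) 1) :
    quant ν u ≤ x ↔ u ≤ cdf ν x := by
  have hne : {x | u ≤ cdf ν x}.Nonempty :=
    (((tendsto_cdf_atTop ν).eventually (lt_mem_nhds hu.2)).exists).imp fun x hx => hx.le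
  have hbdd : BddBelow {x | u ≤ cdf ν x} := by
    obtain ⟨y, hy⟩ := ((tendsto_cdf_atBot ν).eventually (gt_mem_nhds hu.1)).exists
    refine ⟨y, fun x hx => ?_⟩
    by_contra! hxy
    exact absurd (hx.trans (monotone_cdf ν hxy.le)) hy.not_ge
  rw [quant, if_pos hu]
  refine ⟨fun h => ?_, fun h => csInf_le hbdd h⟩
  have key : ∀ y, x < y → u ≤ cdf ν y := fun y hy => by
    obtain ⟨z, hz, hzy⟩ := (csInf_lt_iff hbdd hne).1 (h.trans_lt hy)
    exact hz.trans (monotone_cdf ν hzy.le)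
  have hr : Tendsto (cdf ν) (𝓝[>] x) (𝓝 (cdf ν x)) :=
    ((cdf ν).right_continuous x).mono_left (nhdsWithin_mono _ Ioi_subset_Ici_self)
  exact ge_of_tendsto hr (by filter_upwards [self_mem_nhdsWithin] with y hy using key y hy)

lemma monotoneOn_quant (ν : Measure ℝ) : MonotoneOn (quant ν) (Ioo 0 1) := fun u hu v hv huv => by
  rw [quant_le_iff ν hu]
  exact huv.trans ((quant_le_iff ν hv).1 le_rfl)

lemma measurable_quant_kernel {X : Type*} [MeasurableSpace X] (κ : Kernel X ℝ) [IsMarkovKernel κ]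
    {f : X → ℝ} (hf : Measurable f) : Measurable fun x => quant (κ x) (f x) := by
  refine measurable_of_Iic fun y => ?_
  have : (fun x => quant (κ x) (f x)) ⁻¹' Iic y =
      ({x | f x ∈ Ioo (0 : ℝ) 1} ∩ {x | f x ≤ (κ x).real (Iic y)}) ∪
        ({x | f x ∉ Ioo (0 : ℝ) 1} ∩ {_x | (0 : ℝ) ≤ y}) := by
    ext x
    by_cases hx : f x ∈ Ioo (0 : ℝ) 1
    · have := quant_le_iff (κ x) (x := y) hx
      rw [cdf_eq_real] at this
      simp only [mem_preimage, mem_Iic, this, mem_union, mem_inter_iff, mem_ofPred_eq, hx, not_true,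
        true_and, false_and, or_false]
    · simp only [mem_preimage, mem_Iic, quant, mem_union, mem_inter_iff, mem_ofPred_eq, hx,
        not_false_eq_true, true_and, false_and, false_or, if_false]
  rw [this]
  have h1 : MeasurableSet {x | f x ∈ Ioo (0 : ℝ) 1} := hf measurableSet_Ioo
  have h2 : Measurable fun x => (κ x).real (Iic y) :=
    (κ.measurable_coe measurableSet_Iic).ennreal_toReal
  exact (h1.inter (measurableSet_le hf h2)).union (h1.compl.inter (MeasurableSet.const _))

lemma measurable_quant (ν : Measure ℝ) [IsProbabilityMeasure ν] : Measurable (quant ν) :=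
  measurable_quant_kernel (Kernel.const ℝ ν) measurable_id

lemma map_quant (ν : Measure ℝ) [IsProbabilityMeasure ν] : unif.map (quant ν) = ν := by
  have := Measure.isProbabilityMeasure_map (μ := unif) (measurable_quant ν).aemeasurable
  refine Measure.ext_of_Iic _ _ fun x => ?_
  rw [Measure.map_apply (measurable_quant ν) measurableSet_Iic, unif,
    Measure.restrict_apply (measurable_quant ν measurableSet_Iic), ← ofReal_cdf]
  have : quant ν ⁻¹' Iic x ∩ Ioo 0 1 = Ioo 0 1 ∩ Iic (cdf ν x) := by
    ext u
    constructor
    · rintro ⟨h, hu⟩; exact ⟨hu, (quant_le_iff ν hu).1 h⟩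
    · rintro ⟨hu, h⟩; exact ⟨(quant_le_iff ν hu).2 h, hu⟩
  rw [this]
  refine le_antisymm ?_ ?_
  · calc volume (Ioo 0 1 ∩ Iic (cdf ν x)) ≤ volume (Ioc 0 (cdf ν x)) :=
        measure_mono fun u hu => ⟨hu.1.1, hu.2⟩
      _ = _ := by simp
  · calc ENNReal.ofReal (cdf ν x) = volume (Ioo 0 (cdf ν x)) := by simp
      _ ≤ _ := by
        refine measure_mono ?_
        rintro u ⟨h0, h1⟩
        exact ⟨⟨h0, h1.trans_le (cdf_le_one ν x)⟩, h1.le⟩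

lemma cdf_quant (ν : Measure ℝ) [IsProbabilityMeasure ν] [NullSingletonClass ν] {u : ℝ}
    (hu : u ∈ Ioo (0 : ℝ) 1) : cdf ν (quant ν u) = u := by
  refine le_antisymm ?_ ((quant_le_iff ν hu).1 le_rfl)
  have hcont : ContinuousAt (cdf ν) (quant ν u) := by
    have h0 : (cdf ν).measure {quant ν u} = 0 := by rw [measure_cdf]; simp
    rw [StieltjesFunction.measure_singleton, ENNReal.ofReal_eq_zero] at h0
    rw [(cdf ν).mono.continuousAt_iff_leftLim_eq_rightLim, StieltjesFunction.rightLim_eq]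
    exact le_antisymm ((cdf ν).mono.leftLim_le le_rfl) (by linarith)
  have hl : Tendsto (cdf ν) (𝓝[<] (quant ν u)) (𝓝 (cdf ν (quant ν u))) :=
    hcont.tendsto.mono_left nhdsWithin_le_nhds
  refine le_of_tendsto hl ?_
  filter_upwards [self_mem_nhdsWithin] with y hy
  by_contra! h
  exact absurd ((quant_le_iff ν hu).2 h.le) (not_le.2 hy)

lemma strictMonoOn_quant (ν : Measure ℝ) [IsProbabilityMeasure ν] [NullSingletonClass ν] :
    StrictMonoOn (quant ν) (Ioo 0 1) := fun u hu v hv huv => by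
  refine lt_of_le_of_ne (monotoneOn_quant ν hu hv huv.le) fun h => huv.ne ?_
  rw [← cdf_quant ν hu, ← cdf_quant ν hv, h]

/-- The quantile function of a measure with density `p` is almost everywhere differentiable, with
derivative `1 / p`. -/
lemma ae_hasDerivAt_quant (ν : Measure ℝ) [IsProbabilityMeasure ν] {p : ℝ → ℝ≥0∞}
    (hp : Measurable p) (hν : ν = volume.withDensity p) :
    ∀ᵐ u ∂unif, HasDerivAt (quant ν) (p (quant ν u)).toReal⁻¹ u ∧
      0 < (p (quant ν u)).toReal := by
  have hac : ν ≪ volume := hν ▸ withDensity_absolutelyContinuous _ _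
  have : NullSingletonClass ν := ⟨fun x => hac (by simp)⟩
  have h1 : ∀ᵐ x, HasDerivAt (cdf ν) (p x).toReal x := by
    have h := (cdf ν).ae_hasDerivAt
    have hr : ν.rnDeriv volume =ᵐ[volume] p := by
      rw [hν]; exact Measure.rnDeriv_withDensity _ hp
    rw [measure_cdf] at h
    filter_upwards [h, hr] with x hx hx'
    rwa [← hx']
  have h2 : ∀ᵐ u ∂unif, HasDerivAt (cdf ν) (p (quant ν u)).toReal (quant ν u) := by
    have : ∀ᵐ x ∂(unif.map (quant ν)), HasDerivAt (cdf ν) (p x).toReal x := by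
      rw [map_quant]; exact hac.ae_le h1
    exact ae_of_ae_map (measurable_quant ν).aemeasurable this
  have h3 : ∀ᵐ u ∂unif, DifferentiableAt ℝ (quant ν) u := by
    have := (monotoneOn_quant ν).ae_differentiableWithinAt measurableSet_Ioo
    filter_upwards [this, ae_unif_mem] with u hu hu'
    exact hu.differentiableAt (Ioo_mem_nhds hu'.1 hu'.2)
  filter_upwards [h2, h3, ae_unif_mem] with u hu hq hu'
  have hc := hu.comp u hq.hasDerivAt
  have hid : HasDerivAt (cdf ν ∘ quant ν) 1 u := by
    refine (hasDerivAt_id u).congr_of_eventuallyEq ?_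
    filter_upwards [Ioo_mem_nhds hu'.1 hu'.2] with v hv
    simp [cdf_quant ν hv]
  have h := hc.unique hid
  have hne : (p (quant ν u)).toReal ≠ 0 := fun h0 => by simp [h0] at h
  refine ⟨?_, lt_of_le_of_ne ENNReal.toReal_nonneg hne.symm⟩
  rw [← eq_inv_of_mul_eq_one_right h]
  exact hq.hasDerivAt

/-- One-dimensional area inequality for monotone functions. -/
lemma map_withDensity_deriv_le {f f' : ℝ → ℝ} (hf : Measurable f)
    (hmono : MonotoneOn f (Ioo 0 1)) (hd : ∀ᵐ u ∂unif, HasDerivAt f (f' u) u) :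
    (unif.withDensity fun u => ENNReal.ofReal (f' u)).map f ≤ volume := by
  obtain ⟨s, hs, hsm, hs0⟩ : ∃ s ⊆ {u | HasDerivAt f (f' u) u} ∩ Ioo 0 1, MeasurableSet s ∧
      unif sᶜ = 0 := by
    have : {u | HasDerivAt f (f' u) u} ∩ Ioo 0 1 ∈ ae unif := inter_mem hd ae_unif_mem
    obtain ⟨t, ht, htm, ht0⟩ := exists_measurable_superset_of_null (mem_ae_iff.1 this)
    exact ⟨tᶜ, compl_subset_comm.1 ht, htm.compl, by simpa using ht0⟩
  refine Measure.le_iff.2 fun A hA => ?_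
  rw [Measure.map_apply hf hA, withDensity_apply _ (hf hA)]
  have hu : unif = volume.restrict s := by
    have h1 : unif.restrict s = unif := Measure.restrict_eq_self_of_ae_mem (mem_ae_iff.2 hs0)
    rw [← h1, unif, Measure.restrict_restrict hsm, inter_eq_left.2 fun u hu => (hs hu).2]
  calc ∫⁻ u in f ⁻¹' A, ENNReal.ofReal (f' u) ∂unif
      = ∫⁻ u in s, ENNReal.ofReal (f' u) * A.indicator 1 (f u) := by
        rw [← lintegral_indicator (hf hA), hu]
        refine lintegral_congr fun u => ?_
        by_cases h : f u ∈ A <;> simp [h]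
    _ = ∫⁻ x in f '' s, A.indicator 1 x :=
        (lintegral_image_eq_lintegral_deriv_mul_of_monotoneOn hsm
          (fun x hx => (hs hx).1.hasDerivWithinAt) (hmono.mono fun x hx => (hs hx).2) _).symm
    _ ≤ ∫⁻ x, A.indicator 1 x := lintegral_mono' Measure.restrict_le_self le_rfl
    _ = volume A := by rw [lintegral_indicator_one hA]

section KLdivergence

variable {Ω E : Type*} [MeasurableSpace Ω] [MeasurableSpace E]

lemma KL_ne_top_iff {μ π : Measure E} : KL μ π ≠ ⊤ ↔ μ ≪ π ∧ Integrable (llr μ π) μ := by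
  by_cases h : μ ≪ π ∧ Integrable (llr μ π) μ
  · have h' : μ ≪ π ∧ Integrable (fun z => Real.log (μ.rnDeriv π z).toReal) μ := h
    simp only [KL, if_pos h', h, true_and, iff_true]
    exact ENNReal.ofReal_ne_top
  · have h' : ¬ (μ ≪ π ∧ Integrable (fun z => Real.log (μ.rnDeriv π z).toReal) μ) := h
    simp only [KL, if_neg h', h, ne_eq, not_true]

lemma KL_eq_ofReal {μ π : Measure E} (h1 : μ ≪ π) (h2 : Integrable (llr μ π) μ) :
    KL μ π = ENNReal.ofReal (∫ z, llr μ π z ∂μ) := if_pos ⟨h1, h2⟩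

lemma integral_llr_nonneg {μ π : Measure E} [IsProbabilityMeasure μ] [IsProbabilityMeasure π]
    (h1 : μ ≪ π) (h2 : Integrable (llr μ π) μ) : 0 ≤ ∫ z, llr μ π z ∂μ := by
  simpa using InformationTheory.integral_llr_add_sub_measure_univ_nonneg h1 h2

lemma lintegral_mul_inv_rnDeriv_le {μ π : Measure E} [IsFiniteMeasure μ] [IsFiniteMeasure π]
    (h1 : μ ≪ π) {g : E → ℝ≥0∞} (hg : Measurable g) :
    ∫⁻ z, g z * (μ.rnDeriv π z)⁻¹ ∂μ ≤ ∫⁻ z, g z ∂π := by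
  conv_lhs => rw [← Measure.withDensity_rnDeriv_eq _ _ h1]
  rw [lintegral_withDensity_eq_lintegral_mul _ (Measure.measurable_rnDeriv _ _) (by fun_prop)]
  refine lintegral_mono_ae ?_
  filter_upwards [Measure.rnDeriv_withDensity π (Measure.measurable_rnDeriv μ π)] with z hz
  rw [Measure.withDensity_rnDeriv_eq _ _ h1] at *
  calc μ.rnDeriv π z * (g z * (μ.rnDeriv π z)⁻¹)
      = g z * (μ.rnDeriv π z * (μ.rnDeriv π z)⁻¹) := by ring
    _ ≤ g z * 1 := by gcongr; exact ENNReal.mul_inv_le_one _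
    _ = g z := mul_one _

lemma integrable_mul_inv_rnDeriv {μ π : Measure E} [IsFiniteMeasure μ] [IsFiniteMeasure π]
    (h1 : μ ≪ π) {g : E → ℝ} (hg : Measurable g) (hg0 : ∀ z, 0 ≤ g z) (hgi : Integrable g π) :
    Integrable (fun z => g z * (μ.rnDeriv π z).toReal⁻¹) μ ∧
      ∫ z, g z * (μ.rnDeriv π z).toReal⁻¹ ∂μ ≤ ∫ z, g z ∂π := by
  have hle := lintegral_mul_inv_rnDeriv_le h1 hg.ennreal_ofReal
  have hfin : ∫⁻ z, ENNReal.ofReal (g z) ∂π ≠ ⊤ := by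
    rw [← ofReal_integral_eq_lintegral_ofReal hgi (ae_of_all _ hg0)]; exact ENNReal.ofReal_ne_top
  have hm : Measurable fun z => ENNReal.ofReal (g z) * (μ.rnDeriv π z)⁻¹ := by fun_prop
  have heq : ∀ z, (ENNReal.ofReal (g z) * (μ.rnDeriv π z)⁻¹).toReal =
      g z * (μ.rnDeriv π z).toReal⁻¹ := fun z => by
    rw [ENNReal.toReal_mul, ENNReal.toReal_inv, ENNReal.toReal_ofReal (hg0 z)]
  have hfin' := ne_top_of_le_ne_top hfin hle
  constructor
  · simpa only [heq] using! integrable_toReal_of_lintegral_ne_top hm.aemeasurable hfin'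
  · simp_rw [← heq]
    rw [integral_toReal hm.aemeasurable (ae_lt_top hm hfin'),
      integral_eq_lintegral_of_nonneg_ae (ae_of_all _ hg0) hg.aestronglyMeasurable]
    exact ENNReal.toReal_mono hfin hle

lemma ae_rnDeriv_toReal_pos {μ π : Measure E} [IsFiniteMeasure μ] [IsFiniteMeasure π]
    (h1 : μ ≪ π) : ∀ᵐ z ∂μ, 0 < (μ.rnDeriv π z).toReal := by
  filter_upwards [Measure.rnDeriv_pos h1, h1.ae_le (Measure.rnDeriv_lt_top μ π)] with z hz hz'
  exact ENNReal.toReal_pos hz.ne' hz'.ne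

lemma one_sub_inv_le_llr {μ π : Measure E} [IsFiniteMeasure μ] [IsFiniteMeasure π] (h1 : μ ≪ π) :
    ∀ᵐ z ∂μ, 1 - (μ.rnDeriv π z).toReal⁻¹ ≤ llr μ π z := by
  filter_upwards [ae_rnDeriv_toReal_pos h1] with z hz
  have := Real.log_le_sub_one_of_pos (inv_pos.2 hz)
  rw [Real.log_inv] at this
  rw [llr_def]; dsimp only; linarith

lemma integrable_inv_rnDeriv {μ π : Measure E} [IsFiniteMeasure μ] [IsFiniteMeasure π]
    (h1 : μ ≪ π) : Integrable (fun z => (μ.rnDeriv π z).toReal⁻¹) μ := by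
  simpa using (integrable_mul_inv_rnDeriv h1 (g := fun _ => 1) measurable_const
    (fun _ => zero_le_one) (integrable_const _)).1

/-- If `π` dominates the image under `T` of the measure with density `exp (-h)`, then `∫ h` bounds
the divergence of the image of `ρ` from `π`. -/
lemma KL_map_le {ρ : Measure Ω} {π : Measure E} [IsProbabilityMeasure ρ] [IsProbabilityMeasure π]
    {T : Ω → E} (hT : Measurable T) {h : Ω → ℝ} (hh : Measurable h) (hhi : Integrable h ρ)
    (hle : (ρ.withDensity fun u => ENNReal.ofReal (Real.exp (-h u))).map T ≤ π) :
    KL (ρ.map T) π ≤ ENNReal.ofReal (∫ u, h u ∂ρ) := by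
  have := Measure.isProbabilityMeasure_map (μ := ρ) hT.aemeasurable
  set μ := ρ.map T with hμ
  have hac : μ ≪ π := by
    refine Measure.AbsolutelyContinuous.mk fun A hA hA0 => ?_
    have h0 := le_antisymm ((hle A).trans hA0.le) zero_le
    rw [Measure.map_apply hT hA, withDensity_apply _ (hT hA),
      lintegral_eq_zero_iff (by fun_prop)] at h0
    rw [hμ, Measure.map_apply hT hA]
    by_contra hne
    have : (ae (ρ.restrict (T ⁻¹' A))).NeBot := by
      rw [ae_neBot, Ne, Measure.restrict_eq_zero]; exact hne
    obtain ⟨u, hu⟩ := h0.exists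
    simp at hu
    exact absurd hu (not_le.2 (Real.exp_pos _))
  set f := μ.rnDeriv π with hf
  have hfm : Measurable f := Measure.measurable_rnDeriv _ _
  have hF1 : ∫⁻ u, f (T u) * ENNReal.ofReal (Real.exp (-h u)) ∂ρ ≤ 1 := by
    calc ∫⁻ u, f (T u) * ENNReal.ofReal (Real.exp (-h u)) ∂ρ
        = ∫⁻ z, f z ∂((ρ.withDensity fun u => ENNReal.ofReal (Real.exp (-h u))).map T) := by
          rw [lintegral_map hfm hT, lintegral_withDensity_eq_lintegral_mul _ (by fun_prop)
            (g := fun u => f (T u)) (hfm.comp hT)]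
          refine lintegral_congr fun u => ?_
          simp [mul_comm]
      _ ≤ ∫⁻ z, f z ∂π := lintegral_mono' hle le_rfl
      _ ≤ μ univ := Measure.lintegral_rnDeriv_le
      _ = 1 := measure_univ
  have hFm : Measurable fun u => f (T u) * ENNReal.ofReal (Real.exp (-h u)) := by fun_prop
  set F : Ω → ℝ := fun u => (f (T u) * ENNReal.ofReal (Real.exp (-h u))).toReal with hFdef
  have hFi : Integrable F ρ :=
    integrable_toReal_of_lintegral_ne_top hFm.aemeasurable (ne_top_of_le_ne_top (by simp) hF1)
  have hFint : ∫ u, F u ∂ρ ≤ 1 := by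
    rw [integral_toReal hFm.aemeasurable (ae_lt_top hFm (ne_top_of_le_ne_top (by simp) hF1))]
    exact ENNReal.toReal_le_of_le_ofReal zero_le_one (by simpa using hF1)
  have hpos : ∀ᵐ u ∂ρ, 0 < (f (T u)).toReal :=
    ae_of_ae_map hT.aemeasurable (ae_rnDeriv_toReal_pos hac)
  have hub : ∀ᵐ u ∂ρ, llr μ π (T u) ≤ h u + F u - 1 := by
    filter_upwards [hpos] with u hu
    have hFe : F u = (f (T u)).toReal * Real.exp (-h u) := by
      rw [hFdef]; dsimp only
      rw [ENNReal.toReal_mul, ENNReal.toReal_ofReal (Real.exp_pos _).le]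
    have := Real.log_le_sub_one_of_pos (x := F u) (hFe ▸ mul_pos hu (Real.exp_pos _))
    rw [hFe, Real.log_mul hu.ne' (Real.exp_pos _).ne', Real.log_exp, ← hFe] at this
    rw [llr_def]; dsimp only; linarith
  have hlb : ∀ᵐ u ∂ρ, 1 - (f (T u)).toReal⁻¹ ≤ llr μ π (T u) :=
    ae_of_ae_map hT.aemeasurable (one_sub_inv_le_llr hac)
  have hlbi : Integrable (fun u => 1 - (f (T u)).toReal⁻¹) ρ :=
    (integrable_const _).sub ((integrable_inv_rnDeriv hac).comp_measurable hT)
  have hlm : Measurable (llr μ π) := measurable_llr _ _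
  have hli : Integrable (fun u => llr μ π (T u)) ρ :=
    integrable_of_le_of_le (hlm.comp hT).aestronglyMeasurable hlb hub hlbi
      ((hhi.add hFi).sub (integrable_const _))
  have hli' : Integrable (llr μ π) μ :=
    (integrable_map_measure hlm.aestronglyMeasurable hT.aemeasurable).2 hli
  rw [KL_eq_ofReal hac hli']
  refine ENNReal.ofReal_le_ofReal ?_
  rw [integral_map hT.aemeasurable hlm.aestronglyMeasurable]
  have h3 := integral_mono_ae hli ((hhi.add hFi).sub (integrable_const 1)) hub
  have h4 : ∫ u, (h u + F u - 1) ∂ρ = ∫ u, h u ∂ρ + ∫ u, F u ∂ρ - 1 := by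
    have ha : Integrable (fun u => h u + F u) ρ := hhi.add hFi
    rw [integral_sub ha (integrable_const _), integral_add hhi hFi]; simp
  have h5 : ∫ u, llr μ π (T u) ∂ρ ≤ ∫ u, (h u + F u - 1) ∂ρ := h3
  linarith

/-- The easy half of the variational formula for the divergence. -/
lemma integral_le_KL_add {μ π : Measure E} [IsProbabilityMeasure μ] [IsProbabilityMeasure π]
    {c : ℝ} (hc : 0 ≤ c) (hKL : KL μ π ≤ ENNReal.ofReal c) {g : E → ℝ} (hg : Measurable g)
    {N : ℝ} (hN : ∀ z, |g z| ≤ N) :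
    ∫ z, g z ∂μ ≤ c + ∫ z, Real.exp (g z - 1) ∂π := by
  obtain ⟨hac, hli⟩ := KL_ne_top_iff.1 (ne_top_of_le_ne_top ENNReal.ofReal_ne_top hKL)
  rw [KL_eq_ofReal hac hli, ENNReal.ofReal_le_ofReal_iff hc] at hKL
  have hgi : Integrable g μ := Integrable.of_bound hg.aestronglyMeasurable N (ae_of_all _ hN)
  have hei : Integrable (fun z => Real.exp (g z - 1)) π := by
    refine Integrable.of_bound (by fun_prop) (Real.exp (N - 1)) (ae_of_all _ fun z => ?_)
    rw [Real.norm_eq_abs, abs_of_pos (Real.exp_pos _)]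
    exact Real.exp_le_exp.2 (by linarith [le_abs_self (g z), hN z])
  obtain ⟨h1, h2⟩ := integrable_mul_inv_rnDeriv hac (g := fun z => Real.exp (g z - 1))
    (by fun_prop) (fun z => (Real.exp_pos _).le) hei
  have h3 : ∀ᵐ z ∂μ, g z ≤ llr μ π z + Real.exp (g z - 1) * (μ.rnDeriv π z).toReal⁻¹ := by
    filter_upwards [ae_rnDeriv_toReal_pos hac] with z hz
    have := Real.log_le_sub_one_of_pos (mul_pos (Real.exp_pos (g z - 1)) (inv_pos.2 hz))
    rw [Real.log_mul (Real.exp_pos _).ne' (inv_pos.2 hz).ne', Real.log_exp, Real.log_inv] at this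
    rw [llr_def]; dsimp only; linarith
  have h4 := integral_mono_ae hgi (hli.add h1) h3
  have h5 : ∫ z, (llr μ π z + Real.exp (g z - 1) * (μ.rnDeriv π z).toReal⁻¹) ∂μ = _ :=
    integral_add hli h1
  have h6 : ∫ z, g z ∂μ ≤
    ∫ z, (llr μ π z + Real.exp (g z - 1) * (μ.rnDeriv π z).toReal⁻¹) ∂μ := h4
  linarith

end KLdivergence

/-- Clamping to `[-N, N]`. -/
noncomputable def clamp (N x : ℝ) : ℝ := max (-N) (min N x)

lemma abs_clamp_le {N : ℝ} (hN : 0 ≤ N) (x : ℝ) : |clamp N x| ≤ N := by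
  rw [clamp, abs_le]; exact ⟨le_max_left _ _, max_le (by linarith) (min_le_left _ _)⟩

lemma abs_clamp_sub_le (N x y : ℝ) : |clamp N x - clamp N y| ≤ |x - y| := by
  unfold clamp
  refine (abs_max_sub_max_le_max _ _ _ _).trans ?_
  simp only [sub_self, abs_zero]
  refine max_le (abs_nonneg _) ((abs_min_sub_min_le_max _ _ _ _).trans ?_)
  simp

lemma clamp_of_abs_le {N x : ℝ} (h : |x| ≤ N) : clamp N x = x := by
  rw [abs_le] at h; rw [clamp, min_eq_right h.2, max_eq_right h.1]

@[fun_prop] lemma continuous_clamp (N : ℝ) : Continuous (clamp N) := by unfold clamp; fun_prop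

lemma abs_exp_sub_exp_le {x y N : ℝ} (hx : x ≤ N) (hy : y ≤ N) :
    |Real.exp x - Real.exp y| ≤ Real.exp N * |x - y| := by
  wlog h : y ≤ x generalizing x y
  · rw [abs_sub_comm, abs_sub_comm x]; exact this hy hx (le_of_not_ge h)
  rw [abs_of_nonneg (sub_nonneg.2 (Real.exp_le_exp.2 h)), abs_of_nonneg (sub_nonneg.2 h)]
  have h1 : Real.exp y = Real.exp x * Real.exp (y - x) := by rw [← Real.exp_add]; ring_nf
  have h2 := Real.add_one_le_exp (y - x)
  have h3 := Real.exp_le_exp.2 hx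
  have h4 := Real.exp_pos x
  calc Real.exp x - Real.exp y = Real.exp x * (1 - Real.exp (y - x)) := by rw [h1]; ring
    _ ≤ Real.exp x * (x - y) := mul_le_mul_of_nonneg_left (by linarith) h4.le
    _ ≤ _ := mul_le_mul_of_nonneg_right h3 (by linarith)

section lowerSemicontinuity

variable {E : Type*} [MeasurableSpace E]

/-- A variational bound over bounded continuous functions extends to bounded measurable ones. -/
lemma integral_le_of_boundedContinuous [MetricSpace E] [BorelSpace E] {μ π : Measure E}
    [IsProbabilityMeasure μ] [IsProbabilityMeasure π] {m : ℝ}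
    (H : ∀ (g : E → ℝ) (N : ℝ), Continuous g → (∀ z, |g z| ≤ N) →
      ∫ z, g z ∂μ ≤ m + ∫ z, Real.exp (g z - 1) ∂π)
    {g : E → ℝ} (hg : Measurable g) {N : ℝ} (hN : ∀ z, |g z| ≤ N) :
    ∫ z, g z ∂μ ≤ m + ∫ z, Real.exp (g z - 1) ∂π := by
  obtain ⟨z₀⟩ : Nonempty E := by
    by_contra hne
    rw [not_nonempty_iff] at hne
    exact IsProbabilityMeasure.ne_zero μ (Measure.eq_zero_of_isEmpty μ)
  have hN0 : 0 ≤ N := (abs_nonneg _).trans (hN z₀)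
  refine le_of_forall_pos_le_add fun δ hδ => ?_
  set C := 1 + Real.exp (N - 1)
  have hC : 0 < C := by positivity
  have hgi : Integrable g (μ + π) := Integrable.of_bound hg.aestronglyMeasurable N (ae_of_all _ hN)
  obtain ⟨q, hq, hqi⟩ := hgi.exists_boundedContinuous_integral_sub_le (div_pos hδ hC)
  set r : E → ℝ := fun z => clamp N (q z)
  have hrc : Continuous r := by fun_prop
  have hrN : ∀ z, |r z| ≤ N := fun z => abs_clamp_le hN0 _
  have hgr : ∀ z, |g z - r z| ≤ ‖g z - q z‖ := fun z => by
    have := abs_clamp_sub_le N (g z) (q z)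
    rwa [clamp_of_abs_le (hN z)] at this
  have hdi : Integrable (fun z => ‖g z - q z‖) (μ + π) := (hgi.sub hqi).norm
  have hdμ : Integrable (fun z => ‖g z - q z‖) μ := hdi.left_of_add_measure
  have hdπ : Integrable (fun z => ‖g z - q z‖) π := hdi.right_of_add_measure
  rw [integral_add_measure hdμ hdπ] at hq
  have hposμ : 0 ≤ ∫ z, ‖g z - q z‖ ∂μ := integral_nonneg fun _ => norm_nonneg _
  have hposπ : 0 ≤ ∫ z, ‖g z - q z‖ ∂π := integral_nonneg fun _ => norm_nonneg _
  have hri : Integrable r μ := Integrable.of_bound hrc.measurable.aestronglyMeasurable N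
    (ae_of_all _ hrN)
  have hexp : ∀ s : E → ℝ, Measurable s → (∀ z, |s z| ≤ N) →
      Integrable (fun z => Real.exp (s z - 1)) π := fun s hs hsN => by
    refine Integrable.of_bound (by fun_prop) (Real.exp (N - 1)) (ae_of_all _ fun z => ?_)
    rw [Real.norm_eq_abs, abs_of_pos (Real.exp_pos _)]
    exact Real.exp_le_exp.2 (by linarith [le_abs_self (s z), hsN z])
  have h1 : ∫ z, g z ∂μ ≤ ∫ z, r z ∂μ + ∫ z, ‖g z - q z‖ ∂μ := by
    rw [← integral_add hri hdμ]
    refine integral_mono hgi.left_of_add_measure (hri.add hdμ) fun z => ?_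
    have := (le_abs_self _).trans (hgr z)
    linarith
  have h2 : ∫ z, Real.exp (r z - 1) ∂π ≤
      ∫ z, Real.exp (g z - 1) ∂π + Real.exp (N - 1) * ∫ z, ‖g z - q z‖ ∂π := by
    rw [← integral_const_mul, ← integral_add (hexp g hg hN) (hdπ.const_mul _)]
    refine integral_mono (hexp r hrc.measurable hrN) ((hexp g hg hN).add (hdπ.const_mul _))
      fun z => ?_
    have h := abs_exp_sub_exp_le (x := r z - 1) (y := g z - 1) (N := N - 1)
      (by linarith [le_abs_self (r z), hrN z]) (by linarith [le_abs_self (g z), hN z])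
    have h' : |r z - 1 - (g z - 1)| ≤ ‖g z - q z‖ := by
      rw [show r z - 1 - (g z - 1) = -(g z - r z) by ring, abs_neg]; exact hgr z
    have h'' := mul_le_mul_of_nonneg_left h' (Real.exp_pos (N - 1)).le
    linarith [le_abs_self (Real.exp (r z - 1) - Real.exp (g z - 1))]
  have h3 := H r N hrc hrN
  have hb : ∫ z, ‖g z - q z‖ ∂μ + Real.exp (N - 1) * ∫ z, ‖g z - q z‖ ∂π ≤ δ := by
    have e1 : 0 < Real.exp (N - 1) := Real.exp_pos _
    calc _ ≤ C * (∫ z, ‖g z - q z‖ ∂μ + ∫ z, ‖g z - q z‖ ∂π) := by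
          simp only [C]; nlinarith
      _ ≤ C * (δ / C) := by gcongr
      _ = δ := by field_simp
  linarith

/-- The hard half of the variational formula for the divergence. -/
lemma KL_le_of_integral_le {μ π : Measure E} [IsProbabilityMeasure μ] [IsProbabilityMeasure π]
    {m : ℝ} (H : ∀ (g : E → ℝ) (N : ℝ), Measurable g → (∀ z, |g z| ≤ N) →
      ∫ z, g z ∂μ ≤ m + ∫ z, Real.exp (g z - 1) ∂π) :
    KL μ π ≤ ENNReal.ofReal m := by
  have hac : μ ≪ π := by
    refine Measure.AbsolutelyContinuous.mk fun A hA hA0 => ?_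
    by_contra hne
    have hpos : 0 < μ.real A := ENNReal.toReal_pos hne (measure_ne_top _ _)
    obtain ⟨n, hn⟩ := exists_nat_gt ((m + Real.exp (-1)) / μ.real A)
    have h := H (A.indicator fun _ => (n : ℝ)) n (measurable_const.indicator hA) fun z => by
      by_cases hz : z ∈ A <;> simp [hz]
    have h1 : ∫ z, Real.exp (A.indicator (fun _ => (n : ℝ)) z - 1) ∂π = Real.exp (-1) := by
      have : ∀ᵐ z ∂π, Real.exp (A.indicator (fun _ => (n : ℝ)) z - 1) = Real.exp (-1) := by
        filter_upwards [measure_eq_zero_iff_ae_notMem.1 hA0] with z hz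
        simp [hz]
      rw [integral_congr_ae this]; simp
    rw [h1, integral_indicator_const _ hA, smul_eq_mul] at h
    rw [div_lt_iff₀ hpos] at hn
    linarith
  set f := fun z => (μ.rnDeriv π z).toReal with hf
  have hfm : Measurable f := (Measure.measurable_rnDeriv _ _).ennreal_toReal
  have hf0 : ∀ z, 0 ≤ f z := fun z => ENNReal.toReal_nonneg
  have hfi : Integrable f π := Measure.integrable_toReal_rnDeriv
  have hfint : ∫ z, f z ∂π = 1 := by
    rw [hf, Measure.integral_toReal_rnDeriv hac]; simp
  -- truncated logarithm
  set t : ℕ → E → ℝ := fun n z => if f z = 0 then -n else clamp n (Real.log (f z)) with ht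
  have htm : ∀ n, Measurable (t n) := fun n =>
    Measurable.ite (hfm (measurableSet_singleton 0)) measurable_const
      ((continuous_clamp _).measurable.comp hfm.log)
  have htN : ∀ n z, |t n z| ≤ n := fun n z => by
    simp only [ht]; split_ifs
    · simp
    · exact abs_clamp_le n.cast_nonneg _
  have hexp : ∀ n z, Real.exp (t n z) ≤ f z + Real.exp (-n) := fun n z => by
    simp only [ht]; split_ifs with h
    · simp [h]
    · have hz := lt_of_le_of_ne (hf0 z) (Ne.symm h)
      rw [clamp, Real.exp_monotone.map_max]
      refine max_le (by linarith) ?_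
      calc Real.exp (min n (Real.log (f z))) ≤ Real.exp (Real.log (f z)) :=
            Real.exp_le_exp.2 (min_le_right _ _)
        _ = f z := Real.exp_log hz
        _ ≤ _ := by linarith [Real.exp_pos (-(n : ℝ))]
  have hti : ∀ n, Integrable (t n) μ := fun n =>
    Integrable.of_bound (htm n).aestronglyMeasurable n (ae_of_all _ (htN n))
  have hbound : ∀ n, ∫ z, t n z ∂μ ≤ m + Real.exp (-n) := fun n => by
    have h := H (fun z => 1 + t n z) (1 + n) ((htm n).const_add _) fun z =>
      (abs_add_le _ _).trans (by simpa using htN n z)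
    rw [integral_add (integrable_const _) (hti n)] at h
    have h2 : ∫ z, Real.exp (1 + t n z - 1) ∂π ≤ ∫ z, (f z + Real.exp (-n)) ∂π := by
      refine integral_mono_of_nonneg (ae_of_all _ fun z => (Real.exp_pos _).le)
        (hfi.add (integrable_const _)) (ae_of_all _ fun z => ?_)
      simpa using hexp n z
    rw [integral_add hfi (integrable_const _), hfint] at h2
    simp at h h2 ⊢
    linarith
  have hpos : ∀ᵐ z ∂μ, 0 < f z := ae_rnDeriv_toReal_pos hac
  set L : E → ℝ := fun z => (f z)⁻¹ with hL
  have hLm : Measurable L := hfm.inv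
  have hLi : Integrable L μ := integrable_inv_rnDeriv hac
  have hlm : Measurable (llr μ π) := measurable_llr _ _
  have hlb : ∀ᵐ z ∂μ, 0 ≤ llr μ π z + L z := by
    filter_upwards [one_sub_inv_le_llr hac] with z hz
    simp only [hL, hf]; linarith
  have htb : ∀ n, ∀ᵐ z ∂μ, 0 ≤ t n z + L z := fun n => by
    filter_upwards [hpos, hlb] with z hz hz'
    simp only [ht, hz.ne', if_false]
    have h0 : (0 : ℝ) < L z := inv_pos.2 hz
    have hl : llr μ π z = Real.log (f z) := rfl
    rw [hl] at hz'
    have : min (n : ℝ) (Real.log (f z)) ≤ clamp n (Real.log (f z)) := le_max_right _ _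
    have h2 : -L z ≤ min (n : ℝ) (Real.log (f z)) :=
      le_min (by linarith [(Nat.cast_nonneg n : (0 : ℝ) ≤ n)]) (by linarith)
    linarith
  have hlim : ∀ᵐ z ∂μ, Tendsto (fun n => ENNReal.ofReal (t n z + L z)) atTop
      (𝓝 (ENNReal.ofReal (llr μ π z + L z))) := by
    filter_upwards [hpos] with z hz
    refine tendsto_const_nhds.congr' ?_
    filter_upwards [eventually_ge_atTop ⌈|Real.log (f z)|⌉₊] with n hn
    have hn' : |Real.log (f z)| ≤ n := (Nat.le_ceil _).trans (by exact_mod_cast hn)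
    simp only [ht, hz.ne', if_false, clamp_of_abs_le hn']
    rfl
  have hfatou : ∫⁻ z, ENNReal.ofReal (llr μ π z + L z) ∂μ ≤ ENNReal.ofReal (m + ∫ z, L z ∂μ) := by
    calc ∫⁻ z, ENNReal.ofReal (llr μ π z + L z) ∂μ
        = ∫⁻ z, liminf (fun n => ENNReal.ofReal (t n z + L z)) atTop ∂μ :=
          lintegral_congr_ae (hlim.mono fun z hz => hz.liminf_eq.symm)
      _ ≤ liminf (fun n => ∫⁻ z, ENNReal.ofReal (t n z + L z) ∂μ) atTop :=
          lintegral_liminf_le fun n => ((htm n).add hLm).ennreal_ofReal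
      _ ≤ liminf (fun n : ℕ => ENNReal.ofReal (m + Real.exp (-n) + ∫ z, L z ∂μ)) atTop := by
          refine liminf_le_liminf (Eventually.of_forall fun n => ?_)
          have ha : Integrable (fun z => t n z + L z) μ := (hti n).add hLi
          rw [← ofReal_integral_eq_lintegral_ofReal ha (htb n), integral_add (hti n) hLi]
          exact ENNReal.ofReal_le_ofReal (by linarith [hbound n])
      _ = ENNReal.ofReal (m + ∫ z, L z ∂μ) := by
          refine Tendsto.liminf_eq (ENNReal.tendsto_ofReal ?_)
          have : Tendsto (fun n : ℕ => Real.exp (-(n : ℝ))) atTop (𝓝 0) :=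
            Real.tendsto_exp_neg_atTop_nhds_zero.comp tendsto_natCast_atTop_atTop
          simpa using (this.const_add m).add_const (∫ z, L z ∂μ)
  have hsi : Integrable (fun z => llr μ π z + L z) μ :=
    (lintegral_ofReal_ne_top_iff_integrable (hlm.add hLm).aestronglyMeasurable hlb).1
      (ne_top_of_le_ne_top ENNReal.ofReal_ne_top hfatou)
  have hli : Integrable (llr μ π) μ := by
    refine (hsi.sub hLi).congr (ae_of_all _ fun z => ?_)
    simp
  rw [KL_eq_ofReal hac hli]
  rw [← ofReal_integral_eq_lintegral_ofReal hsi hlb] at hfatou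
  have hnn := integral_llr_nonneg hac hli
  have hLpos : 0 < ∫ z, L z ∂μ := by
    rw [integral_pos_iff_support_of_nonneg_ae (hpos.mono fun z hz => (inv_pos.2 hz).le) hLi]
    have : μ (Function.support L) = μ univ :=
      measure_congr (eventuallyEq_univ.2 (hpos.mono fun z hz => (inv_pos.2 hz).ne'))
    rw [this]; simp
  have hadd : ∫ z, (llr μ π z + L z) ∂μ = ∫ z, llr μ π z ∂μ + ∫ z, L z ∂μ := integral_add hli hLi
  rw [hadd] at hfatou
  refine ENNReal.ofReal_le_ofReal ?_
  have hsum : 0 < ∫ z, llr μ π z ∂μ + ∫ z, L z ∂μ := by linarith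
  have hm : 0 < m + ∫ z, L z ∂μ := by
    by_contra! h
    rw [ENNReal.ofReal_of_nonpos h] at hfatou
    exact absurd (ENNReal.ofReal_eq_zero.1 (le_antisymm hfatou zero_le)) (not_le.2 hsum)
  linarith [(ENNReal.ofReal_le_ofReal_iff hm.le).1 hfatou]

/-- Lower semicontinuity of the divergence under almost sure convergence of random variables. -/
lemma KL_map_le_of_tendsto [MetricSpace E] [BorelSpace E] {Ω : Type*} [MeasurableSpace Ω]
    {ρ : Measure Ω} {π : Measure E} [IsProbabilityMeasure ρ] [IsProbabilityMeasure π]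
    {T : ℕ → Ω → E} {S : Ω → E} (hT : ∀ n, Measurable (T n)) (hS : Measurable S)
    (hlim : ∀ᵐ u ∂ρ, Tendsto (fun n => T n u) atTop (𝓝 (S u))) {c : ℕ → ℝ} {m : ℝ}
    (hc0 : ∀ n, 0 ≤ c n) (hc : Tendsto c atTop (𝓝 m))
    (hKL : ∀ n, KL (ρ.map (T n)) π ≤ ENNReal.ofReal (c n)) :
    KL (ρ.map S) π ≤ ENNReal.ofReal m := by
  have hp : ∀ n, IsProbabilityMeasure (ρ.map (T n)) := fun n =>
    Measure.isProbabilityMeasure_map (hT n).aemeasurable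
  have := Measure.isProbabilityMeasure_map (μ := ρ) hS.aemeasurable
  refine KL_le_of_integral_le fun g N hg hN =>
    integral_le_of_boundedContinuous (fun g N hg hN => ?_) hg hN
  have h1 : ∀ n, ∫ u, g (T n u) ∂ρ ≤ c n + ∫ z, Real.exp (g z - 1) ∂π := fun n => by
    have := integral_le_KL_add (hc0 n) (hKL n) hg.measurable hN
    rwa [integral_map (hT n).aemeasurable hg.measurable.aestronglyMeasurable] at this
  rw [integral_map hS.aemeasurable hg.measurable.aestronglyMeasurable]
  have h2 : Tendsto (fun n => ∫ u, g (T n u) ∂ρ) atTop (𝓝 (∫ u, g (S u) ∂ρ)) := by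
    refine tendsto_integral_of_dominated_convergence (fun _ => N)
      (fun n => (hg.measurable.comp (hT n)).aestronglyMeasurable) (integrable_const _)
      (fun n => ae_of_all _ fun u => hN _) ?_
    filter_upwards [hlim] with u hu
    exact (hg.tendsto _).comp hu
  exact le_of_tendsto_of_tendsto' h2 (hc.add_const _) h1

end lowerSemicontinuity

section pi

/-- Tonelli's theorem for a product of functions of one coordinate each. -/
lemma lintegral_pi_prod {k : ℕ} {X : Type*} [MeasurableSpace X] (μ : Fin k → Measure X)
    [∀ i, SigmaFinite (μ i)] {f : Fin k → X → ℝ≥0∞} (hf : ∀ i, Measurable (f i)) :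
    ∫⁻ x, ∏ i, f i (x i) ∂(Measure.pi μ) = ∏ i, ∫⁻ x, f i x ∂(μ i) := by
  induction k with
  | zero => simp
  | succ n ih =>
    rw [← ((measurePreserving_piFinSuccAbove μ 0).symm).lintegral_comp_emb
      (MeasurableEquiv.measurableEmbedding _)]
    simp_rw [MeasurableEquiv.piFinSuccAbove_symm_apply, Fin.insertNthEquiv,
      Fin.prod_univ_succ, Fin.insertNth_zero, Equiv.coe_fn_mk, Fin.cons_succ,
      Fin.zero_succAbove, cast_eq, Fin.cons_zero]
    rw [lintegral_prod_mul (f := f 0) (g := fun y : Fin n → X => ∏ i, f (Fin.succ i) (y i))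
      (hf 0).aemeasurable (Finset.measurable_prod _ fun i _ =>
        (hf _).comp (measurable_pi_apply i)).aemeasurable, ih _ fun i => hf _]

lemma le_pi_of_rect {k : ℕ} {X : Type*} [MeasurableSpace X] {μ : Fin k → Measure X}
    [∀ i, SigmaFinite (μ i)] {ν : Measure (Fin k → X)}
    (h : ∀ s : Fin k → Set X, (∀ i, MeasurableSet (s i)) → ν (univ.pi s) ≤ ∏ i, μ i (s i)) :
    ν ≤ Measure.pi μ := by
  have h' : ν.toOuterMeasure ≤ OuterMeasure.pi fun i => (μ i).toOuterMeasure := by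
    rw [OuterMeasure.le_pi]
    intro s _
    calc ν (univ.pi s) ≤ ν (univ.pi fun i => toMeasurable (μ i) (s i)) :=
          measure_mono (pi_mono fun i _ => subset_toMeasurable _ _)
      _ ≤ ∏ i, μ i (toMeasurable (μ i) (s i)) := h _ fun i => measurableSet_toMeasurable _ _
      _ = _ := Finset.prod_congr rfl fun i _ => measure_toMeasurable _
  refine Measure.le_iff.2 fun s hs => ?_
  rw [Measure.pi_def, toMeasure_apply _ _ hs]
  exact h' s

end pi

section starMap

variable {k : ℕ}

/-- The base space of all transport maps: the uniform measure on the unit cube. -/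
noncomputable def cube (k : ℕ) : Measure (ℝ × (Fin k → ℝ)) :=
  unif.prod (Measure.pi fun _ => unif)

instance : IsProbabilityMeasure (cube k) := by unfold cube; infer_instance

/-- The triangular map with root component `a` and leaf components `b j`. -/
def starMap (a : ℝ → ℝ) (b : Fin k → ℝ → ℝ → ℝ) (p : ℝ × (Fin k → ℝ)) : ℝ × (Fin k → ℝ) :=
  (a p.1, fun j => b j p.1 (p.2 j))

/-- The Jacobian determinant of `starMap` in terms of the partial derivatives. -/
def starJac (a' : ℝ → ℝ) (b' : Fin k → ℝ → ℝ → ℝ) (p : ℝ × (Fin k → ℝ)) : ℝ :=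
  a' p.1 * ∏ j, b' j p.1 (p.2 j)

/-- `a`, `b` are the components of an increasing star-shaped map, with partial derivatives
`a'`, `b'`. -/
structure StarDiff (a a' : ℝ → ℝ) (b b' : Fin k → ℝ → ℝ → ℝ) : Prop where
  meas_root : Measurable a
  meas_root' : Measurable a'
  meas_leaf : ∀ j, Measurable (Function.uncurry (b j))
  meas_leaf' : ∀ j, Measurable (Function.uncurry (b' j))
  strictMono_root : StrictMonoOn a (Ioo 0 1)
  mono_leaf : ∀ j u, MonotoneOn (b j u) (Ioo 0 1)
  deriv_root : ∀ᵐ u ∂unif, HasDerivAt a (a' u) u ∧ 0 < a' u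
  deriv_leaf : ∀ j, ∀ᵐ u ∂unif, ∀ᵐ w ∂unif, HasDerivAt (b j u) (b' j u w) w ∧ 0 < b' j u w

lemma measurable_leaf {f : Fin k → ℝ → ℝ → ℝ} (hf : ∀ j, Measurable (Function.uncurry (f j)))
    (j : Fin k) : Measurable fun p : ℝ × (Fin k → ℝ) => f j p.1 (p.2 j) :=
  (hf j).comp (measurable_fst.prodMk ((measurable_pi_apply j).comp measurable_snd))

lemma measurable_starMap {a : ℝ → ℝ} {b : Fin k → ℝ → ℝ → ℝ} (ha : Measurable a)
    (hb : ∀ j, Measurable (Function.uncurry (b j))) : Measurable (starMap a b) :=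
  (ha.comp measurable_fst).prodMk (measurable_pi_lambda _ fun j => measurable_leaf hb j)

lemma measurable_starJac {a' : ℝ → ℝ} {b' : Fin k → ℝ → ℝ → ℝ} (ha : Measurable a')
    (hb : ∀ j, Measurable (Function.uncurry (b' j))) : Measurable (starJac a' b') :=
  (ha.comp measurable_fst).mul (Finset.measurable_prod _ fun j _ => measurable_leaf hb j)

/-- An almost everywhere property of a fibre holds almost everywhere on the cube. -/
lemma ae_cube_leaf {j : Fin k} {P : ℝ → ℝ → Prop} (h : ∀ᵐ u ∂unif, ∀ᵐ w ∂unif, P u w)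
    (hm : MeasurableSet {p : ℝ × ℝ | P p.1 p.2}) :
    ∀ᵐ p ∂cube k, P p.1 (p.2 j) := by
  have hf : Measurable fun p : ℝ × (Fin k → ℝ) => (p.1, p.2 j) :=
    measurable_fst.prodMk ((measurable_pi_apply j).comp measurable_snd)
  have hm' : MeasurableSet {p : ℝ × (Fin k → ℝ) | P p.1 (p.2 j)} := hf hm
  refine (Measure.ae_prod_iff_ae_ae hm').2 (h.mono fun u hu => ?_)
  exact (Measure.tendsto_eval_ae_ae (μ := fun _ : Fin k => unif) (i := j)).eventually hu

lemma ae_cube_root {P : ℝ → Prop} (h : ∀ᵐ u ∂unif, P u) : ∀ᵐ p ∂cube k, P p.1 :=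
  Measure.quasiMeasurePreserving_fst.ae h

lemma StarDiff.ae_pos {a a' : ℝ → ℝ} {b b' : Fin k → ℝ → ℝ → ℝ} (h : StarDiff a a' b b') :
    ∀ᵐ p ∂cube k, 0 < a' p.1 ∧ ∀ j, 0 < b' j p.1 (p.2 j) := by
  refine (ae_cube_root (h.deriv_root.mono fun u hu => hu.2)).and (ae_all_iff.2 fun j => ?_)
  exact ae_cube_leaf (P := fun u w => 0 < b' j u w)
    ((h.deriv_leaf j).mono fun u hu => hu.mono fun w hw => hw.2)
    (measurableSet_lt measurable_const (h.meas_leaf' j))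

/-- The area formula for triangular maps, as an inequality. -/
lemma StarDiff.map_withDensity_le {a a' : ℝ → ℝ} {b b' : Fin k → ℝ → ℝ → ℝ}
    (h : StarDiff a a' b b') :
    ((cube k).withDensity fun p => ENNReal.ofReal (starJac a' b' p)).map (starMap a b)
      ≤ volume := by
  have hT := measurable_starMap h.meas_root h.meas_leaf
  refine Measure.le_iff.2 fun A hA => ?_
  have hD : ((cube k).withDensity fun p => ENNReal.ofReal (starJac a' b' p)) =
      (cube k).withDensity fun p =>
        ENNReal.ofReal (a' p.1) * ∏ j, ENNReal.ofReal (b' j p.1 (p.2 j)) := by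
    refine withDensity_congr_ae ?_
    filter_upwards [h.ae_pos] with p hp
    rw [starJac, ENNReal.ofReal_mul hp.1.le, ENNReal.ofReal_prod_of_nonneg fun j _ => (hp.2 j).le]
  have hm : Measurable fun p : ℝ × (Fin k → ℝ) =>
      ENNReal.ofReal (a' p.1) * ∏ j, ENNReal.ofReal (b' j p.1 (p.2 j)) :=
    (h.meas_root'.comp measurable_fst).ennreal_ofReal.mul
      (Finset.measurable_prod _ fun j _ => (measurable_leaf h.meas_leaf' j).ennreal_ofReal)
  have hB : ∀ u j, Measurable (b j u) := fun u j => (h.meas_leaf j).comp measurable_prodMk_left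
  have hB' : ∀ u j, Measurable (b' j u) := fun u j => (h.meas_leaf' j).comp measurable_prodMk_left
  have hTA : MeasurableSet (starMap a b ⁻¹' A) := hT hA
  rw [hD, Measure.map_apply hT hA, withDensity_apply _ hTA, ← lintegral_indicator hTA, cube,
    lintegral_prod _ (hm.indicator hTA).aemeasurable]
  have hfib : ∀ᵐ u ∂unif, ∫⁻ w, (starMap a b ⁻¹' A).indicator (fun p =>
        ENNReal.ofReal (a' p.1) * ∏ j, ENNReal.ofReal (b' j p.1 (p.2 j))) (u, w)
          ∂(Measure.pi fun _ => unif) ≤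
      ENNReal.ofReal (a' u) * volume (Prod.mk (a u) ⁻¹' A) := by
    have hall : ∀ᵐ u ∂unif, ∀ j, ∀ᵐ w ∂unif, HasDerivAt (b j u) (b' j u w) w ∧ 0 < b' j u w :=
      ae_all_iff.2 h.deriv_leaf
    filter_upwards [hall] with u hu
    set S : (Fin k → ℝ) → (Fin k → ℝ) := fun w j => b j u (w j)
    have hS : Measurable S := measurable_pi_lambda _ fun j => (hB u j).comp (measurable_pi_apply j)
    set f : (Fin k → ℝ) → ℝ≥0∞ := fun w => ∏ j, ENNReal.ofReal (b' j u (w j))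
    have hf : Measurable f := Finset.measurable_prod _ fun j _ =>
      ((hB' u j).comp (measurable_pi_apply j)).ennreal_ofReal
    have hAu : MeasurableSet (Prod.mk (a u) ⁻¹' A) := measurable_prodMk_left hA
    have hle : ((Measure.pi fun _ => unif).withDensity f).map S ≤ volume := by
      rw [volume_pi]
      refine le_pi_of_rect fun s hs => ?_
      have hps : MeasurableSet (univ.pi s) := MeasurableSet.univ_pi hs
      rw [Measure.map_apply hS hps, withDensity_apply _ (hS hps), ← lintegral_indicator (hS hps)]
      have he : ∀ w, (S ⁻¹' univ.pi s).indicator f w =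
          ∏ j, (b j u ⁻¹' s j).indicator (fun x => ENNReal.ofReal (b' j u x)) (w j) := fun w => by
        by_cases hw : ∀ j, b j u (w j) ∈ s j
        · rw [indicator_of_mem (by simpa [S] using hw)]
          exact Finset.prod_congr rfl fun j _ =>
            (indicator_of_mem (s := b j u ⁻¹' s j) (hw j)
              fun x => ENNReal.ofReal (b' j u x)).symm
        · rw [indicator_of_notMem (by simpa [S] using hw)]
          push Not at hw
          obtain ⟨j, hj⟩ := hw
          exact (Finset.prod_eq_zero (Finset.mem_univ j) 
            (indicator_of_notMem (s := b j u ⁻¹' s j) hj _)).symm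
      simp_rw [he]
      rw [lintegral_pi_prod _ fun j => (hB' u j).ennreal_ofReal.indicator (hB u j (hs j))]
      refine Finset.prod_le_prod' fun j _ => ?_
      rw [lintegral_indicator (hB u j (hs j)), ← withDensity_apply _ (hB u j (hs j)),
        ← Measure.map_apply (hB u j) (hs j)]
      exact map_withDensity_deriv_le (hB u j) (h.mono_leaf j u) ((hu j).mono fun w hw => hw.1) _
    have he : ∀ w, (starMap a b ⁻¹' A).indicator (fun p =>
        ENNReal.ofReal (a' p.1) * ∏ j, ENNReal.ofReal (b' j p.1 (p.2 j))) (u, w) =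
        ENNReal.ofReal (a' u) * (S ⁻¹' (Prod.mk (a u) ⁻¹' A)).indicator f w := fun w => by
      by_cases hw : starMap a b (u, w) ∈ A
      · rw [indicator_of_mem (show (u, w) ∈ starMap a b ⁻¹' A from hw), indicator_of_mem]
        exact hw
      · rw [indicator_of_notMem (show (u, w) ∉ starMap a b ⁻¹' A from hw), indicator_of_notMem,
          mul_zero]
        exact hw
    simp_rw [he]
    rw [lintegral_const_mul _ (hf.indicator (hS hAu)), lintegral_indicator (hS hAu),
      ← withDensity_apply _ (hS hAu), ← Measure.map_apply hS hAu]
    gcongr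
  refine (lintegral_mono_ae hfib).trans ?_
  have hg : Measurable fun z => volume (Prod.mk z ⁻¹' A) := measurable_measure_prodMk_left hA
  calc ∫⁻ u, ENNReal.ofReal (a' u) * volume (Prod.mk (a u) ⁻¹' A) ∂unif
      = ∫⁻ u, volume (Prod.mk (a u) ⁻¹' A) ∂(unif.withDensity fun u => ENNReal.ofReal (a' u)) :=
        (lintegral_withDensity_eq_lintegral_mul _ h.meas_root'.ennreal_ofReal
          (hg.comp h.meas_root)).symm
    _ = ∫⁻ z, volume (Prod.mk z ⁻¹' A)
          ∂((unif.withDensity fun u => ENNReal.ofReal (a' u)).map a) :=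
        (lintegral_map hg h.meas_root).symm
    _ ≤ ∫⁻ z, volume (Prod.mk z ⁻¹' A) := lintegral_mono' (map_withDensity_deriv_le h.meas_root
        h.strictMono_root.monotoneOn (h.deriv_root.mono fun u hu => hu.1)) le_rfl
    _ = volume A := by rw [Measure.volume_eq_prod, Measure.prod_apply hA]

end starMap

section representation

variable {k : ℕ}

lemma pi_eq_map_quant (κ : Fin k → Kernel ℝ ℝ) [∀ j, IsMarkovKernel (κ j)] (z : ℝ) :
    (Measure.pi fun j => κ j z) =
      (Measure.pi fun _ : Fin k => unif).map fun w j => quant (κ j z) (w j) := by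
  rw [Measure.pi_map_pi fun j => (measurable_quant (κ j z)).aemeasurable]
  simp_rw [map_quant]

lemma measurable_quant_comp (κ : Fin k → Kernel ℝ ℝ) [∀ j, IsMarkovKernel (κ j)] {a : ℝ → ℝ}
    (ha : Measurable a) (j : Fin k) :
    Measurable (Function.uncurry fun u w => quant (κ j (a u)) w) := by
  have h := measurable_quant_kernel ((κ j).comap (fun p : ℝ × ℝ => a p.1)
    (ha.comp measurable_fst)) measurable_snd
  simpa [Function.uncurry_def] using h

lemma starMeasure_apply {μ₁ : Measure ℝ} (κ : Fin k → Kernel ℝ ℝ) [∀ j, IsMarkovKernel (κ j)]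
    {A : Set (ℝ × (Fin k → ℝ))} (hA : MeasurableSet A) :
    starMeasure μ₁ κ A = ∫⁻ z, (Measure.pi fun j => κ j z) (Prod.mk z ⁻¹' A) ∂μ₁ := by
  have hF : Measurable (starMap id fun j z w => quant (κ j z) w) :=
    measurable_starMap measurable_id fun j => measurable_quant_comp κ measurable_id j
  have hrw : ∀ z, (Measure.dirac z).prod (Measure.pi fun j => κ j z) =
      (Measure.pi fun _ : Fin k => unif).map
        fun w => starMap id (fun j z w => quant (κ j z) w) (z, w) := fun z => by
    rw [Measure.dirac_prod, pi_eq_map_quant, Measure.map_map measurable_prodMk_left]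
    · rfl
    · exact measurable_pi_lambda _ fun j => (measurable_quant _).comp (measurable_pi_apply j)
  have hm : Measurable fun z => (Measure.dirac z).prod (Measure.pi fun j => κ j z) := by
    refine Measure.measurable_of_measurable_coe _ fun s hs => ?_
    have he : ∀ z, (Measure.dirac z).prod (Measure.pi fun j => κ j z) s =
        (Measure.pi fun _ : Fin k => unif)
          (Prod.mk z ⁻¹' (starMap id (fun j z w => quant (κ j z) w) ⁻¹' s)) := fun z => by
      rw [hrw]
      exact Measure.map_apply (hF.comp measurable_prodMk_left) hs
    simp_rw [he]
    exact measurable_measure_prodMk_left (hF hs)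
  rw [starMeasure, Measure.bind_apply hA hm.aemeasurable]
  refine lintegral_congr fun z => ?_
  rw [Measure.dirac_prod, Measure.map_apply measurable_prodMk_left hA]

/-- A triangular map of the cube has star-structured law as soon as the leaf conditionals can be
read off the value of the root. -/
lemma map_starMap_eq_starMeasure {a : ℝ → ℝ} {b : Fin k → ℝ → ℝ → ℝ} (ha : Measurable a)
    (hb : ∀ j, Measurable (Function.uncurry (b j))) (κ : Fin k → Kernel ℝ ℝ)
    [∀ j, IsMarkovKernel (κ j)] (h : ∀ᵐ u ∂unif, ∀ j, κ j (a u) = unif.map (b j u)) :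
    (cube k).map (starMap a b) = starMeasure (unif.map a) κ := by
  have hT := measurable_starMap ha hb
  ext A hA
  have hm : Measurable fun z => (Measure.pi fun j => κ j z) (Prod.mk z ⁻¹' A) := by
    have hF : Measurable (starMap id fun j z w => quant (κ j z) w) :=
      measurable_starMap measurable_id fun j => measurable_quant_comp κ measurable_id j
    have he : ∀ z, (Measure.pi fun j => κ j z) (Prod.mk z ⁻¹' A) =
        (Measure.pi fun _ : Fin k => unif)
          (Prod.mk z ⁻¹' (starMap id (fun j z w => quant (κ j z) w) ⁻¹' A)) := fun z => by
      rw [pi_eq_map_quant, Measure.map_apply _ (measurable_prodMk_left hA)]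
      · rfl
      · exact measurable_pi_lambda _ fun j => (measurable_quant _).comp (measurable_pi_apply j)
    simp_rw [he]
    exact measurable_measure_prodMk_left (hF hA)
  rw [starMeasure_apply κ hA, lintegral_map hm ha, Measure.map_apply hT hA, cube,
    Measure.prod_apply (hT hA)]
  refine lintegral_congr_ae (h.mono fun u hu => ?_)
  have hB : ∀ j, Measurable (b j u) := fun j => (hb j).comp measurable_prodMk_left
  dsimp only
  simp_rw [hu]
  rw [← Measure.pi_map_pi fun j => (hB j).aemeasurable,
    Measure.map_apply _ (measurable_prodMk_left hA)]
  · rfl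
  · exact measurable_pi_lambda _ fun j => (hB j).comp (measurable_pi_apply j)

lemma starMeasure_eq_map_starMap (μ₁ : Measure ℝ) [IsProbabilityMeasure μ₁]
    (κ : Fin k → Kernel ℝ ℝ) [∀ j, IsMarkovKernel (κ j)] :
    starMeasure μ₁ κ =
      (cube k).map (starMap (quant μ₁) fun j u w => quant (κ j (quant μ₁ u)) w) := by
  rw [map_starMap_eq_starMeasure (measurable_quant μ₁)
    (fun j => measurable_quant_comp κ (measurable_quant μ₁) j) κ
    (ae_of_all _ fun u j => (map_quant _).symm), map_quant]

/-- Image laws of triangular maps with an increasing, atomless root are star-structured. -/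
lemma isStar_map_starMap {a : ℝ → ℝ} {b : Fin k → ℝ → ℝ → ℝ} (ha : Measurable a)
    (hb : ∀ j, Measurable (Function.uncurry (b j))) {s : Set ℝ} (hs : ∀ᵐ u ∂unif, u ∈ s)
    (hmono : MonotoneOn a s) (hatom : NullSingletonClass (unif.map a)) :
    IsStar ((cube k).map (starMap a b)) := by
  have hT := measurable_starMap ha hb
  have hp := Measure.isProbabilityMeasure_map (μ := unif) ha.aemeasurable
  refine ⟨Measure.isProbabilityMeasure_map hT.aemeasurable, unif.map a, fun j =>
    (Kernel.id ×ₖ Kernel.const ℝ unif).map fun p => b j (cdf (unif.map a) p.1) p.2, hp,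
    fun j => ?_, ?_⟩
  · exact Kernel.IsMarkovKernel.map _ ((hb j).comp
      (((monotone_cdf _).measurable.comp measurable_fst).prodMk measurable_snd))
  · have hM : ∀ j, Measurable fun p : ℝ × ℝ => b j (cdf (unif.map a) p.1) p.2 := fun j =>
      (hb j).comp (((monotone_cdf _).measurable.comp measurable_fst).prodMk measurable_snd)
    have : ∀ j, IsMarkovKernel ((Kernel.id ×ₖ Kernel.const ℝ unif).map
      fun p => b j (cdf (unif.map a) p.1) p.2) := fun j => Kernel.IsMarkovKernel.map _ (hM j)
    refine map_starMap_eq_starMeasure ha hb _ ?_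
    have hcdf : ∀ᵐ u ∂unif, cdf (unif.map a) (a u) = u := by
      filter_upwards [hs, ae_unif_mem] with u hu hu'
      rw [cdf_eq_real, map_measureReal_apply ha measurableSet_Iic]
      have h1 : unif (a ⁻¹' Iic (a u)) = ENNReal.ofReal u := by
        have hle : unif (Iic u) = ENNReal.ofReal u := by
          rw [unif, Measure.restrict_apply measurableSet_Iic,
            show Iic u ∩ Ioo (0 : ℝ) 1 = Ioc 0 u by
              ext x; simp only [mem_inter_iff, mem_Iic, mem_Ioo, mem_Ioc]
              exact ⟨fun h => ⟨h.2.1, h.1⟩, fun h => ⟨h.2, h.1, h.2.trans_lt hu'.2⟩⟩]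
          simp
        refine le_antisymm ?_ ?_
        · calc unif (a ⁻¹' Iic (a u)) ≤ unif (Iic u ∪ (a ⁻¹' {a u} ∪ sᶜ)) := by
                refine measure_mono fun x hx => ?_
                by_cases hxs : x ∈ s
                · rcases le_or_gt x u with h | h
                  · exact Or.inl h
                  · exact Or.inr (Or.inl (le_antisymm hx (hmono hu hxs h.le)))
                · exact Or.inr (Or.inr hxs)
            _ ≤ unif (Iic u) + (unif (a ⁻¹' {a u}) + unif sᶜ) :=
                (measure_union_le _ _).trans (by gcongr; exact measure_union_le _ _)
            _ = ENNReal.ofReal u := by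
                rw [hle, ← Measure.map_apply ha (measurableSet_singleton _), measure_singleton,
                  show unif sᶜ = 0 from hs]; simp
        · rw [← hle]
          refine measure_mono_ae (hs.mono fun x hx (hxu : x ≤ u) => ?_)
          exact hmono hx hu hxu
      rw [measureReal_def, h1, ENNReal.toReal_ofReal hu'.1.le]
    filter_upwards [hcdf] with u hu j
    rw [Kernel.map_apply _ (hM j), Kernel.prod_apply, Kernel.id_apply, Kernel.const_apply,
      Measure.dirac_prod, Measure.map_map (hM j) measurable_prodMk_left]
    simp only [Function.comp_def, hu]

/-- Jointly measurable conditional densities. -/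
lemma exists_kernel_density (κ : Kernel ℝ ℝ) [IsMarkovKernel κ] :
    ∃ p : ℝ → ℝ → ℝ≥0∞, Measurable (Function.uncurry p) ∧
      ∀ z, κ z ≪ volume → κ z = volume.withDensity (p z) := by
  set η : Kernel ℝ ℝ := Kernel.const ℝ (gaussianReal 0 1)
  refine ⟨fun z x => gaussianPDF 0 1 x * κ.rnDeriv η z x, ?_, fun z hz => ?_⟩
  · exact ((measurable_gaussianPDF 0 1).comp measurable_snd).mul (Kernel.measurable_rnDeriv κ η)
  · have h : κ z ≪ η z := hz.trans (gaussianReal_absolutelyContinuous' 0 one_ne_zero)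
    have h1 := Kernel.withDensity_rnDeriv_eq h
    rw [Kernel.withDensity_apply _ (Kernel.measurable_rnDeriv κ η), Kernel.const_apply,
      gaussianReal_of_var_ne_zero _ one_ne_zero, ← withDensity_mul _ (measurable_gaussianPDF 0 1)
        (Kernel.measurable_rnDeriv_right κ η z)] at h1
    exact h1.symm

/-- Every star-structured law with a density is the image of the cube under an increasing star-shaped
map, and its density is the inverse of the Jacobian. -/
lemma IsStar.exists_starDiff {μ : Measure (ℝ × (Fin k → ℝ))} (hμ : IsStar μ) (hac : μ ≪ volume) :
    ∃ (a a' : ℝ → ℝ) (b b' : Fin k → ℝ → ℝ → ℝ) (P : ℝ × (Fin k → ℝ) → ℝ≥0∞),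
      StarDiff a a' b b' ∧ μ = (cube k).map (starMap a b) ∧ Measurable P ∧
      μ = volume.withDensity P ∧
      ∀ᵐ p ∂cube k, (P (starMap a b p)).toReal = (starJac a' b' p)⁻¹ := by
  obtain ⟨hμp, μ₁, κ, hμ₁, hκ, hμκ⟩ := hμ
  have hκac : ∀ j, ∀ᵐ z ∂μ₁, κ j z ≪ volume := fun j => by
    have hf : Measurable fun p : ℝ × (Fin k → ℝ) => (p.1, p.2 j) :=
      measurable_fst.prodMk ((measurable_pi_apply j).comp measurable_snd)
    have h1 : μ.map (fun p => (p.1, p.2 j)) = μ₁ ⊗ₘ κ j := by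
      ext s hs
      rw [Measure.map_apply hf hs, hμκ, starMeasure_apply κ (hf hs), Measure.compProd_apply hs]
      refine lintegral_congr fun z => ?_
      exact (measurePreserving_eval (fun j => κ j z) j).measure_preimage
        (measurable_prodMk_left hs).nullMeasurableSet
    have hq : Measure.QuasiMeasurePreserving (fun p : ℝ × (Fin k → ℝ) => (p.1, p.2 j))
        volume volume :=
      MeasureTheory.QuasiMeasurePreserving.prodMap
        (Measure.QuasiMeasurePreserving.id (volume : Measure ℝ))
        (Measure.quasiMeasurePreserving_eval (fun _ : Fin k => (volume : Measure ℝ)) j)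
    have h2 : μ₁ ⊗ₘ κ j ≪ volume ⊗ₘ Kernel.const ℝ (gaussianReal 0 1) := by
      rw [← h1, Measure.compProd_const]
      refine ((hac.map hf).trans hq.absolutelyContinuous).trans ?_
      rw [Measure.volume_eq_prod]
      exact Measure.AbsolutelyContinuous.rfl.prod
        (gaussianReal_absolutelyContinuous' 0 one_ne_zero)
    exact h2.kernel_of_compProd.mono fun z hz =>
      hz.trans (gaussianReal_absolutelyContinuous 0 one_ne_zero)
  have hμ₁ac : μ₁ ≪ volume := by
    have h1 : μ.map Prod.fst = μ₁ := by
      ext s hs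
      rw [Measure.map_apply measurable_fst hs, hμκ, starMeasure_apply κ (measurable_fst hs),
        ← lintegral_indicator_one hs]
      refine lintegral_congr fun z => ?_
      by_cases hz : z ∈ s
      · rw [show Prod.mk z ⁻¹' (Prod.fst ⁻¹' s) = (univ : Set (Fin k → ℝ)) by ext; simp [hz]]
        simp [hz]
      · rw [show Prod.mk z ⁻¹' (Prod.fst ⁻¹' s) = (∅ : Set (Fin k → ℝ)) by ext; simp [hz]]
        simp [hz]
    rw [← h1]
    exact (hac.map measurable_fst).trans Measure.quasiMeasurePreserving_fst.absolutelyContinuous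
  have hns : NullSingletonClass μ₁ := ⟨fun x => hμ₁ac (by simp)⟩
  choose p hpm hp using fun j => exists_kernel_density (κ j)
  set p₁ := μ₁.rnDeriv volume
  have hp₁m : Measurable p₁ := Measure.measurable_rnDeriv _ _
  have hp₁ : μ₁ = volume.withDensity p₁ := (Measure.withDensity_rnDeriv_eq _ _ hμ₁ac).symm
  have hκp : ∀ᵐ z ∂μ₁, ∀ j, κ j z = volume.withDensity (p j z) :=
    ae_all_iff.2 fun j => (hκac j).mono fun z hz => hp j z hz
  set a := quant μ₁
  have ha : Measurable a := measurable_quant μ₁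
  set b : Fin k → ℝ → ℝ → ℝ := fun j u w => quant (κ j (a u)) w
  have hb : ∀ j, Measurable (Function.uncurry (b j)) := fun j => measurable_quant_comp κ ha j
  set a' : ℝ → ℝ := fun u => (p₁ (a u)).toReal⁻¹
  set b' : Fin k → ℝ → ℝ → ℝ := fun j u w => (p j (a u) (b j u w)).toReal⁻¹
  set P : ℝ × (Fin k → ℝ) → ℝ≥0∞ := fun z => p₁ z.1 * ∏ j, p j z.1 (z.2 j)
  have hQm : ∀ j, Measurable fun z : ℝ × (Fin k → ℝ) => p j z.1 (z.2 j) := fun j =>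
    (hpm j).comp (measurable_fst.prodMk ((measurable_pi_apply j).comp measurable_snd))
  have hPm : Measurable P := (hp₁m.comp measurable_fst).mul
    (Finset.measurable_prod _ fun j _ => hQm j)
  refine ⟨a, a', b, b', P, ⟨ha, (hp₁m.comp ha).ennreal_toReal.inv, hb, fun j => ?_,
    strictMonoOn_quant μ₁, fun j u => monotoneOn_quant _, ?_, fun j => ?_⟩, ?_, hPm, ?_, ?_⟩
  · exact ((hpm j).comp ((ha.comp measurable_fst).prodMk (hb j))).ennreal_toReal.inv
  · exact (ae_hasDerivAt_quant μ₁ hp₁m hp₁).mono fun u hu => ⟨hu.1, inv_pos.2 hu.2⟩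
  · have : ∀ᵐ u ∂unif, ∀ j, κ j (a u) = volume.withDensity (p j (a u)) := by
      rw [← map_quant μ₁] at hκp
      exact ae_of_ae_map ha.aemeasurable hκp
    filter_upwards [this] with u hu
    exact (ae_hasDerivAt_quant (κ j (a u)) ((hpm j).comp measurable_prodMk_left) (hu j)).mono
      fun w hw => ⟨hw.1, inv_pos.2 hw.2⟩
  · rw [hμκ, starMeasure_eq_map_starMap]
  · ext A hA
    rw [hμκ, starMeasure_apply κ hA, withDensity_apply _ hA, ← lintegral_indicator hA,
      Measure.volume_eq_prod, lintegral_prod _ (hPm.indicator hA).aemeasurable]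
    have h1 : ∀ᵐ z ∂μ₁, (Measure.pi fun j => κ j z) (Prod.mk z ⁻¹' A) =
        ∫⁻ x, A.indicator (fun z => ∏ j, p j z.1 (z.2 j)) (z, x) := by
      filter_upwards [hκp] with z hz
      have hpz : ∀ j, Measurable (p j z) := fun j => (hpm j).comp measurable_prodMk_left
      have h2 : (Measure.pi fun j => κ j z) = volume.withDensity fun x => ∏ j, p j z (x j) := by
        refine Measure.pi_eq fun s hs => ?_
        rw [withDensity_apply _ (MeasurableSet.univ_pi hs),
          ← lintegral_indicator (MeasurableSet.univ_pi hs), volume_pi]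
        have he : ∀ x : Fin k → ℝ, (univ.pi s).indicator (fun x => ∏ j, p j z (x j)) x =
            ∏ j, (s j).indicator (p j z) (x j) := fun x => by
          by_cases hx : ∀ j, x j ∈ s j
          · rw [indicator_of_mem (by simpa using hx)]
            exact Finset.prod_congr rfl fun j _ => (indicator_of_mem (hx j) _).symm
          · rw [indicator_of_notMem (by simpa using hx)]
            push Not at hx
            obtain ⟨j, hj⟩ := hx
            exact (Finset.prod_eq_zero (Finset.mem_univ j) (indicator_of_notMem hj _)).symm
        simp_rw [he]
        rw [lintegral_pi_prod _ fun j => (hpz j).indicator (hs j)]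
        refine Finset.prod_congr rfl fun j _ => ?_
        rw [hz j, withDensity_apply _ (hs j), lintegral_indicator (hs j)]
      rw [h2, withDensity_apply _ (measurable_prodMk_left hA),
        ← lintegral_indicator (measurable_prodMk_left hA)]
      rfl
    rw [lintegral_congr_ae h1, hp₁]
    have hm : Measurable fun z => ∫⁻ x, A.indicator (fun z => ∏ j, p j z.1 (z.2 j)) (z, x) :=
      Measurable.lintegral_prod_right'
        ((Finset.measurable_prod _ fun j _ => hQm j).indicator hA)
    rw [lintegral_withDensity_eq_lintegral_mul _ hp₁m hm]
    refine lintegral_congr fun z => ?_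
    have hm' : Measurable fun x => A.indicator (fun z => ∏ j, p j z.1 (z.2 j)) (z, x) :=
      ((Finset.measurable_prod _ fun j _ => hQm j).indicator hA).comp measurable_prodMk_left
    rw [Pi.mul_apply, ← lintegral_const_mul _ hm']
    refine lintegral_congr fun x => ?_
    by_cases hx : (z, x) ∈ A <;> simp [hx, P]
  · refine ae_of_all _ fun q => ?_
    simp [P, starMap, starJac, a', b', ENNReal.toReal_mul, ENNReal.toReal_prod, mul_comm]

end representation

section potential

variable {k : ℕ}

lemma sqNorm_nonneg (v : ℝ × (Fin k → ℝ)) : 0 ≤ sqNorm v :=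
  add_nonneg (sq_nonneg _) (Finset.sum_nonneg fun _ _ => sq_nonneg _)

lemma measurable_sqNorm : Measurable (sqNorm (k := k)) := by
  unfold sqNorm
  fun_prop

/-- A normalizable Gibbs measure, with the normalization absorbed into the potential. -/
lemma exists_gibbs_eq_withDensity {E : Type*} [MeasureSpace E] {V : E → ℝ} (hV : Measurable V)
    [IsProbabilityMeasure (gibbs V)] :
    ∃ c : ℝ, gibbs V = volume.withDensity fun z => ENNReal.ofReal (Real.exp (-(V z + c))) := by
  set m : Measure E := volume.withDensity fun z => ENNReal.ofReal (Real.exp (-V z)) with hm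
  have hg : gibbs V = (m univ)⁻¹ • m := rfl
  have h1 : (m univ)⁻¹ * m univ = 1 := by
    have : gibbs V univ = 1 := measure_univ
    rwa [hg] at this
  have h0 : m univ ≠ 0 := fun h => by simp [h] at h1
  have htop : m univ ≠ ⊤ := fun h => by simp [h] at h1
  have hpos : 0 < (m univ).toReal := ENNReal.toReal_pos h0 htop
  refine ⟨Real.log (m univ).toReal, ?_⟩
  rw [hg, hm, ← withDensity_smul _ (by fun_prop)]
  congr 1
  ext z
  rw [← hm, Pi.smul_apply, smul_eq_mul, neg_add, Real.exp_add, mul_comm (Real.exp (-V z)),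
    ENNReal.ofReal_mul (Real.exp_pos _).le, Real.exp_neg (Real.log _), Real.exp_log hpos,
    ENNReal.ofReal_inv_of_pos hpos, ENNReal.ofReal_toReal htop]

lemma hess_eq {V : ℝ × (Fin k → ℝ) → ℝ} (hV : ContDiff ℝ 2 V) (z u v : ℝ × (Fin k → ℝ)) :
    hess V z u v = fderiv ℝ (fderiv ℝ V) z v u := by
  have hd : DifferentiableAt ℝ (fderiv ℝ V) z :=
    ((hV.fderiv_right (m := 1) (by norm_num)).differentiable (by norm_num)) z
  unfold hess
  rw [fderiv_clm_apply hd (differentiableAt_const u)]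
  simp

lemma hess_comm {V : ℝ × (Fin k → ℝ) → ℝ} (hV : ContDiff ℝ 2 V) (z u v : ℝ × (Fin k → ℝ)) :
    hess V z u v = hess V z v u := by
  rw [hess_eq hV, hess_eq hV]
  exact (hV.contDiffAt.isSymmSndFDerivAt (by simp)).eq v u

lemma exists_hess_lower_bound {V : ℝ × (Fin k → ℝ) → ℝ} (hV : ContDiff ℝ 2 V) {ℓ ℓ' M : ℝ}
    (hℓ : 0 < ℓ) (hℓ' : 0 < ℓ')
    (hleaf : ∀ z, ∀ b : Fin k → ℝ, ℓ * ∑ i, b i ^ 2 ≤ hess V z ((0 : ℝ), b) ((0 : ℝ), b))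
    (hM : ∀ z, ∑ j, hess V z e0 (eL j) ^ 2 ≤ M) (hroot : ∀ z, ℓ' ≤ hess V z e0 e0 - M / ℓ) :
    ∃ c : ℝ, 0 < c ∧ ∀ z v, c * sqNorm v ≤ hess V z v v := by
  have hM0 : 0 ≤ M := (Finset.sum_nonneg fun j _ => sq_nonneg _).trans (hM 0)
  set α := M / ℓ + ℓ' / 2 with hα
  have hα0 : 0 < α := by positivity
  refine ⟨min (ℓ' / 2) (ℓ * ℓ' / 2 / α), lt_min (by positivity) (by positivity), fun z v => ?_⟩
  obtain ⟨t, b⟩ := v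
  set B := ∑ i, b i ^ 2 with hB
  have hB0 : 0 ≤ B := Finset.sum_nonneg fun _ _ => sq_nonneg _
  set q := hess V z e0 ((0 : ℝ), b) with hq
  have hb : ((0 : ℝ), b) = ∑ j, b j • (eL j : ℝ × (Fin k → ℝ)) := by
    ext i
    · simp [eL, Prod.fst_sum]
    · simp [eL, Prod.snd_sum, Finset.sum_apply, Pi.single_apply]
  have hqs : q = ∑ j, b j * hess V z e0 (eL j) := by
    rw [hq, hb, hess_eq hV]
    simp only [map_sum, map_smul, hess_eq hV, _root_.sum_apply,
      _root_.smul_apply, smul_eq_mul]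
  have hqM : q ^ 2 ≤ M * B := by
    rw [hqs, mul_comm]
    exact (Finset.sum_mul_sq_le_sq_mul_sq _ _ _).trans (mul_le_mul_of_nonneg_left (hM z) hB0)
  have hv : ((t, b) : ℝ × (Fin k → ℝ)) = t • e0 + ((0 : ℝ), b) := by
    ext i <;> simp [e0]
  have hexp : hess V z (t, b) (t, b) =
      t ^ 2 * hess V z e0 e0 + 2 * t * q + hess V z ((0 : ℝ), b) ((0 : ℝ), b) := by
    have h2 : hess V z ((0 : ℝ), b) e0 = q := hess_comm hV _ _ _
    rw [hess_eq hV] at h2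
    have h3 := hq
    rw [hess_eq hV] at h3
    rw [hv, hess_eq hV, hess_eq hV, hess_eq hV]
    simp only [map_add, map_smul, _root_.add_apply, _root_.smul_apply,
      smul_eq_mul, h2, ← h3]
    ring
  have hsq : 0 ≤ α * t ^ 2 + 2 * t * q + q ^ 2 / α := by
    have : α * t ^ 2 + 2 * t * q + q ^ 2 / α = (α * t + q) ^ 2 / α := by
      field_simp; ring
    rw [this]; positivity
  have h4 : q ^ 2 / α ≤ M * B / α := div_le_div_of_nonneg_right hqM hα0.le
  have h5 : ℓ * B - M * B / α = ℓ * ℓ' / 2 / α * B := by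
    have : ℓ * α = M + ℓ * ℓ' / 2 := by rw [hα]; field_simp
    field_simp
    linear_combination 2 * B * this
  have h6 := mul_le_mul_of_nonneg_right (min_le_left (ℓ' / 2) (ℓ * ℓ' / 2 / α)) (sq_nonneg t)
  have h7 := mul_le_mul_of_nonneg_right (min_le_right (ℓ' / 2) (ℓ * ℓ' / 2 / α)) hB0
  have h8 := mul_le_mul_of_nonneg_left (hroot z) (sq_nonneg t)
  have h9 := hleaf z b
  have hs : sqNorm ((t, b) : ℝ × (Fin k → ℝ)) = t ^ 2 + B := rfl
  rw [hs, hexp]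
  nlinarith [h6, h7, h8, h9, hsq, h4, h5]

lemma midpoint_le_of_hess {V : ℝ × (Fin k → ℝ) → ℝ} (hV : ContDiff ℝ 2 V) {c : ℝ}
    (hc : ∀ z v, c * sqNorm v ≤ hess V z v v) (x y : ℝ × (Fin k → ℝ)) :
    V ((1 / 2 : ℝ) • (x + y)) ≤ (V x + V y) / 2 - c / 8 * sqNorm (x - y) := by
  set C := c * sqNorm (x - y) with hC
  set ℓ : ℝ → ℝ × (Fin k → ℝ) := fun s => y + s • (x - y) with hℓ
  have hℓd : ∀ s, HasDerivAt ℓ (x - y) s := fun s => by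
    have := ((hasDerivAt_id s).smul_const (x - y)).const_add y
    rwa [one_smul] at this
  have hd1 : ∀ s, HasDerivAt (fun s => V (ℓ s) - C / 2 * s ^ 2)
      (fderiv ℝ V (ℓ s) (x - y) - C * s) s := fun s => by
    have h1 := ((hV.differentiable (by norm_num)) (ℓ s)).hasFDerivAt.comp_hasDerivAt s (hℓd s)
    have h2 := ((hasDerivAt_pow 2 s).const_mul (C / 2))
    refine (h1.sub h2).congr_deriv ?_
    norm_num
    ring
  have hd2 : ∀ s, HasDerivAt (fun s => fderiv ℝ V (ℓ s) (x - y) - C * s)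
      (hess V (ℓ s) (x - y) (x - y) - C) s := fun s => by
    have hd : DifferentiableAt ℝ (fun w => fderiv ℝ V w (x - y)) (ℓ s) :=
      ((hV.fderiv_right (m := 1) (by norm_num)).clm_apply contDiff_const).differentiable
        (by norm_num) _
    have h1 := hd.hasFDerivAt.comp_hasDerivAt s (hℓd s)
    have h2 := (hasDerivAt_id s).const_mul C
    refine (h1.sub h2).congr_deriv ?_
    rw [mul_one, hess]
  have hconv : ConvexOn ℝ univ fun s => V (ℓ s) - C / 2 * s ^ 2 := by
    refine convexOn_of_hasDerivWithinAt2_nonneg convex_univ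
      (continuous_iff_continuousAt.2 fun s => (hd1 s).continuousAt).continuousOn
      (fun s _ => (hd1 s).hasDerivWithinAt) (fun s _ => (hd2 s).hasDerivWithinAt)
      fun s _ => sub_nonneg.2 (hc _ _)
  have h := hconv.2 (mem_univ 0) (mem_univ 1) (by norm_num : (0 : ℝ) ≤ 1 / 2)
    (by norm_num : (0 : ℝ) ≤ 1 / 2) (by norm_num)
  have e0 : ℓ 0 = y := by simp [hℓ]
  have e1 : ℓ 1 = x := by simp [hℓ]
  have e2 : ℓ (1 / 2) = (1 / 2 : ℝ) • (x + y) := by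
    ext i <;> simp [hℓ] <;> ring
  simp only [smul_eq_mul, mul_zero, mul_one, zero_add, e0, e1, e2] at h
  linarith

end potential

section convexity

variable {k : ℕ} {W : ℝ × (Fin k → ℝ) → ℝ} {π : Measure (ℝ × (Fin k → ℝ))}

lemma StarDiff.isStar {a a' : ℝ → ℝ} {b b' : Fin k → ℝ → ℝ → ℝ} (h : StarDiff a a' b b') :
    IsStar ((cube k).map (starMap a b)) := by
  refine isStar_map_starMap h.meas_root h.meas_leaf ae_unif_mem h.strictMono_root.monotoneOn
    ⟨fun x => ?_⟩
  rw [Measure.map_apply h.meas_root (measurableSet_singleton x)]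
  have hs : (a ⁻¹' {x} ∩ Ioo 0 1).Subsingleton := fun u hu w hw =>
    h.strictMono_root.injOn hu.2 hw.2 (hu.1.trans hw.1.symm)
  refine measure_mono_null_ae ?_ (hs.measure_zero unif)
  filter_upwards [ae_unif_mem] with u hu h1 using ⟨h1, hu⟩

/-- A star-structured measure of finite divergence is the image of the cube under an increasing
star-shaped map, and its divergence is expressed through this map by the change of variables. -/
lemma IsStar.exists_starDiff_KL (hW : Measurable W)
    (hπ : π = volume.withDensity fun z => ENNReal.ofReal (Real.exp (-W z)))
    [IsProbabilityMeasure π] {μ : Measure (ℝ × (Fin k → ℝ))} (hμ : IsStar μ) (hKL : KL μ π ≠ ⊤) :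
    ∃ (a a' : ℝ → ℝ) (b b' : Fin k → ℝ → ℝ → ℝ), StarDiff a a' b b' ∧
      μ = (cube k).map (starMap a b) ∧
      Integrable (fun p => W (starMap a b p) - Real.log (starJac a' b' p)) (cube k) ∧
      KL μ π = ENNReal.ofReal
        (∫ p, (W (starMap a b p) - Real.log (starJac a' b' p)) ∂cube k) ∧
      0 ≤ ∫ p, (W (starMap a b p) - Real.log (starJac a' b' p)) ∂cube k := by
  obtain ⟨hac, hli⟩ := KL_ne_top_iff.1 hKL
  have hμp := hμ.1
  obtain ⟨a, a', b, b', P, hD, hmap, hP, hμP, hPJ⟩ := hμ.exists_starDiff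
    (hac.trans (hπ ▸ withDensity_absolutelyContinuous _ _))
  have hT := measurable_starMap hD.meas_root hD.meas_leaf
  have hQ : Measurable fun z => P z * ENNReal.ofReal (Real.exp (W z)) := by fun_prop
  have hμπ : μ = π.withDensity fun z => P z * ENNReal.ofReal (Real.exp (W z)) := by
    rw [hπ, ← withDensity_mul _ (by fun_prop) hQ, hμP]
    congr 1
    ext z
    rw [Pi.mul_apply, mul_comm, mul_assoc, ← ENNReal.ofReal_mul (Real.exp_pos _).le,
      ← Real.exp_add]
    simp
  have hrn : ∀ᵐ z ∂μ, μ.rnDeriv π z = P z * ENNReal.ofReal (Real.exp (W z)) := by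
    refine hac.ae_le ?_
    have := Measure.rnDeriv_withDensity π hQ
    rwa [← hμπ] at this
  have hllr : ∀ᵐ p ∂cube k, llr μ π (starMap a b p) =
      W (starMap a b p) - Real.log (starJac a' b' p) := by
    have h1 : ∀ᵐ p ∂cube k, μ.rnDeriv π (starMap a b p) =
        P (starMap a b p) * ENNReal.ofReal (Real.exp (W (starMap a b p))) := by
      refine ae_of_ae_map (p := fun z => μ.rnDeriv π z = P z * ENNReal.ofReal (Real.exp (W z)))
        hT.aemeasurable ?_
      rwa [← hmap]
    filter_upwards [h1, hPJ, hD.ae_pos] with p hp1 hp2 hp3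
    have hJ : 0 < starJac a' b' p := mul_pos hp3.1 (Finset.prod_pos fun j _ => hp3.2 j)
    rw [llr, hp1, ENNReal.toReal_mul, hp2, ENNReal.toReal_ofReal (Real.exp_pos _).le,
      Real.log_mul (inv_pos.2 hJ).ne' (Real.exp_pos _).ne', Real.log_inv, Real.log_exp]
    ring
  have hlm : AEStronglyMeasurable (llr μ π) ((cube k).map (starMap a b)) :=
    (measurable_llr μ π).aestronglyMeasurable
  have hint : Integrable (fun p => llr μ π (starMap a b p)) (cube k) := by
    have : Integrable (llr μ π) ((cube k).map (starMap a b)) := hmap ▸ hli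
    exact (integrable_map_measure hlm hT.aemeasurable).1 this
  have heq : ∫ z, llr μ π z ∂μ =
      ∫ p, (W (starMap a b p) - Real.log (starJac a' b' p)) ∂cube k := by
    rw [← integral_congr_ae hllr, ← integral_map hT.aemeasurable hlm, ← hmap]
  refine ⟨a, a', b, b', hD, hmap, hint.congr hllr, ?_, ?_⟩
  · rw [KL_eq_ofReal hac hli, heq]
  · rw [← heq]
    exact integral_llr_nonneg hac hli

lemma StarDiff.map_withDensity_le_gibbs (hW : Measurable W)
    (hπ : π = volume.withDensity fun z => ENNReal.ofReal (Real.exp (-W z)))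
    {a a' : ℝ → ℝ} {b b' : Fin k → ℝ → ℝ → ℝ} (hD : StarDiff a a' b b')
    {h : ℝ × (Fin k → ℝ) → ℝ}
    (hle : ∀ᵐ p ∂cube k, Real.exp (-h p) ≤ starJac a' b' p * Real.exp (-W (starMap a b p))) :
    ((cube k).withDensity fun p => ENNReal.ofReal (Real.exp (-h p))).map (starMap a b) ≤ π := by
  have hT := measurable_starMap hD.meas_root hD.meas_leaf
  have hJ := measurable_starJac hD.meas_root' hD.meas_leaf'
  refine Measure.le_iff.2 fun A hA => ?_
  have hJm : Measurable fun p => ENNReal.ofReal (starJac a' b' p) := hJ.ennreal_ofReal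
  have hEm : Measurable fun z => ENNReal.ofReal (Real.exp (-W z)) := by fun_prop
  have hETm : Measurable fun p => ENNReal.ofReal (Real.exp (-W (starMap a b p))) := hEm.comp hT
  calc ((cube k).withDensity fun p => ENNReal.ofReal (Real.exp (-h p))).map (starMap a b) A
      = ∫⁻ p in starMap a b ⁻¹' A, ENNReal.ofReal (Real.exp (-h p)) ∂cube k := by
        rw [Measure.map_apply hT hA, withDensity_apply _ (hT hA)]
    _ ≤ ∫⁻ p in starMap a b ⁻¹' A, ENNReal.ofReal (starJac a' b' p) *
          ENNReal.ofReal (Real.exp (-W (starMap a b p))) ∂cube k := by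
        refine lintegral_mono_ae (ae_restrict_of_ae ?_)
        filter_upwards [hle] with p hp
        rw [← ENNReal.ofReal_mul' (Real.exp_pos _).le]
        exact ENNReal.ofReal_le_ofReal hp
    _ = ∫⁻ p in starMap a b ⁻¹' A, ENNReal.ofReal (Real.exp (-W (starMap a b p)))
          ∂((cube k).withDensity fun p => ENNReal.ofReal (starJac a' b' p)) := by
        rw [setLIntegral_withDensity_eq_setLIntegral_mul _ hJm hETm (hT hA)]
        rfl
    _ = ∫⁻ z in A, ENNReal.ofReal (Real.exp (-W z))
          ∂((cube k).withDensity fun p => ENNReal.ofReal (starJac a' b' p)).map (starMap a b) :=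
        (setLIntegral_map hA hEm hT).symm
    _ ≤ ∫⁻ z in A, ENNReal.ofReal (Real.exp (-W z)) :=
        lintegral_mono' (Measure.restrict_mono le_rfl hD.map_withDensity_le) le_rfl
    _ = π A := by rw [hπ, withDensity_apply _ hA]

lemma StarDiff.midpoint {a₀ a₀' a₁ a₁' : ℝ → ℝ} {b₀ b₀' b₁ b₁' : Fin k → ℝ → ℝ → ℝ}
    (h₀ : StarDiff a₀ a₀' b₀ b₀') (h₁ : StarDiff a₁ a₁' b₁ b₁') :
    StarDiff (fun u => (a₀ u + a₁ u) / 2) (fun u => (a₀' u + a₁' u) / 2)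
      (fun j u w => (b₀ j u w + b₁ j u w) / 2) (fun j u w => (b₀' j u w + b₁' j u w) / 2) where
  meas_root := (h₀.meas_root.add h₁.meas_root).div_const 2
  meas_root' := (h₀.meas_root'.add h₁.meas_root').div_const 2
  meas_leaf j := ((h₀.meas_leaf j).add (h₁.meas_leaf j)).div_const 2
  meas_leaf' j := ((h₀.meas_leaf' j).add (h₁.meas_leaf' j)).div_const 2
  strictMono_root u hu w hw huw := by
    have := h₀.strictMono_root hu hw huw
    have := h₁.strictMono_root hu hw huw
    dsimp only
    linarith
  mono_leaf j u w hw x hx hwx := by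
    have := h₀.mono_leaf j u hw hx hwx
    have := h₁.mono_leaf j u hw hx hwx
    dsimp only
    linarith
  deriv_root := by
    filter_upwards [h₀.deriv_root, h₁.deriv_root] with u hu₀ hu₁
    exact ⟨(hu₀.1.add hu₁.1).div_const 2, by linarith [hu₀.2, hu₁.2]⟩
  deriv_leaf j := by
    filter_upwards [h₀.deriv_leaf j, h₁.deriv_leaf j] with u hu₀ hu₁
    filter_upwards [hu₀, hu₁] with w hw₀ hw₁
    exact ⟨(hw₀.1.add hw₁.1).div_const 2, by linarith [hw₀.2, hw₁.2]⟩

lemma half_log_add_log_le_log_starJac {a₀' a₁' : ℝ → ℝ} {b₀' b₁' : Fin k → ℝ → ℝ → ℝ}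
    {p : ℝ × (Fin k → ℝ)} (h₀ : 0 < a₀' p.1 ∧ ∀ j, 0 < b₀' j p.1 (p.2 j))
    (h₁ : 0 < a₁' p.1 ∧ ∀ j, 0 < b₁' j p.1 (p.2 j)) :
    (Real.log (starJac a₀' b₀' p) + Real.log (starJac a₁' b₁' p)) / 2 ≤
      Real.log (starJac (fun u => (a₀' u + a₁' u) / 2)
        (fun j u w => (b₀' j u w + b₁' j u w) / 2) p) := by
  have key : ∀ x y : ℝ, x * y ≤ ((x + y) / 2) ^ 2 := fun x y => by nlinarith [sq_nonneg (x - y)]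
  have hP₀ := Finset.prod_pos fun j (_ : j ∈ Finset.univ) => h₀.2 j
  have hP₁ := Finset.prod_pos fun j (_ : j ∈ Finset.univ) => h₁.2 j
  have hJ₀ : 0 < starJac a₀' b₀' p := mul_pos h₀.1 hP₀
  have hJ₁ : 0 < starJac a₁' b₁' p := mul_pos h₁.1 hP₁
  rw [← Real.log_mul hJ₀.ne' hJ₁.ne', div_le_iff₀ two_pos, mul_comm _ (2 : ℝ)]
  rw [show (2 : ℝ) = ((2 : ℕ) : ℝ) by norm_num, ← Real.log_pow]
  refine Real.log_le_log (mul_pos hJ₀ hJ₁) ?_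
  simp only [starJac, Nat.cast_ofNat]
  rw [mul_mul_mul_comm, mul_pow, ← Finset.prod_mul_distrib, ← Finset.prod_pow]
  exact mul_le_mul (key _ _) (Finset.prod_le_prod (fun j _ => (mul_pos (h₀.2 j) (h₁.2 j)).le)
    fun j _ => key _ _) (Finset.prod_nonneg fun j _ => (mul_pos (h₀.2 j) (h₁.2 j)).le)
    (sq_nonneg _)

/-- Strong convexity of the divergence along displacement interpolations of star-shaped maps. -/
lemma StarDiff.integral_sqNorm_sub_le (hW : Measurable W)
    (hπ : π = volume.withDensity fun z => ENNReal.ofReal (Real.exp (-W z)))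
    [IsProbabilityMeasure π] {c : ℝ} (hc : 0 < c)
    (hconv : ∀ x y, W ((1 / 2 : ℝ) • (x + y)) ≤ (W x + W y) / 2 - c / 8 * sqNorm (x - y))
    {a₀ a₀' a₁ a₁' : ℝ → ℝ} {b₀ b₀' b₁ b₁' : Fin k → ℝ → ℝ → ℝ}
    (h₀ : StarDiff a₀ a₀' b₀ b₀') (h₁ : StarDiff a₁ a₁' b₁ b₁')
    (hi₀ : Integrable (fun p => W (starMap a₀ b₀ p) - Real.log (starJac a₀' b₀' p)) (cube k))
    (hi₁ : Integrable (fun p => W (starMap a₁ b₁ p) - Real.log (starJac a₁' b₁' p)) (cube k)) :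
    Integrable (fun p => sqNorm (starMap a₀ b₀ p - starMap a₁ b₁ p)) (cube k) ∧
    ∀ m : ℝ, (∀ ν : Measure (ℝ × (Fin k → ℝ)), IsStar ν → ENNReal.ofReal m ≤ KL ν π) →
      c / 8 * ∫ p, sqNorm (starMap a₀ b₀ p - starMap a₁ b₁ p) ∂cube k ≤
        ((∫ p, (W (starMap a₀ b₀ p) - Real.log (starJac a₀' b₀' p)) ∂cube k) +
          ∫ p, (W (starMap a₁ b₁ p) - Real.log (starJac a₁' b₁' p)) ∂cube k) / 2 - m := by
  set T₀ := starMap a₀ b₀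
  set T₁ := starMap a₁ b₁
  set g₀ := fun p => W (T₀ p) - Real.log (starJac a₀' b₀' p) with hg₀
  set g₁ := fun p => W (T₁ p) - Real.log (starJac a₁' b₁' p) with hg₁
  have hT₀ : Measurable T₀ := measurable_starMap h₀.meas_root h₀.meas_leaf
  have hT₁ : Measurable T₁ := measurable_starMap h₁.meas_root h₁.meas_leaf
  have hg₀m : Measurable g₀ := (hW.comp hT₀).sub
    (Real.measurable_log.comp (measurable_starJac h₀.meas_root' h₀.meas_leaf'))
  have hg₁m : Measurable g₁ := (hW.comp hT₁).sub
    (Real.measurable_log.comp (measurable_starJac h₁.meas_root' h₁.meas_leaf'))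
  set S := fun p => sqNorm (T₀ p - T₁ p) with hS
  have hSm : Measurable S := measurable_sqNorm.comp (hT₀.sub hT₁)
  set h := fun p => (g₀ p + g₁ p) / 2 - c / 8 * S p with hh
  have hhm : Measurable h := ((hg₀m.add hg₁m).div_const 2).sub (hSm.const_mul _)
  have hD := h₀.midpoint h₁
  set a := fun u => (a₀ u + a₁ u) / 2
  set b := fun j u w => (b₀ j u w + b₁ j u w) / 2
  have hT : Measurable (starMap a b) := measurable_starMap hD.meas_root hD.meas_leaf
  have hmid : ∀ p, starMap a b p = (1 / 2 : ℝ) • (T₀ p + T₁ p) := fun p => by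
    ext i <;> simp [starMap, a, b, T₀, T₁] <;> ring
  have hle : ((cube k).withDensity fun p => ENNReal.ofReal (Real.exp (-h p))).map
      (starMap a b) ≤ π := by
    refine hD.map_withDensity_le_gibbs hW hπ ?_
    filter_upwards [h₀.ae_pos, h₁.ae_pos, hD.ae_pos] with p hp₀ hp₁ hp
    have hJ : 0 < starJac (fun u => (a₀' u + a₁' u) / 2)
        (fun j u w => (b₀' j u w + b₁' j u w) / 2) p :=
      mul_pos hp.1 (Finset.prod_pos fun j _ => hp.2 j)
    have hlog := half_log_add_log_le_log_starJac hp₀ hp₁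
    have hcv := hconv (T₀ p) (T₁ p)
    rw [← hmid p] at hcv
    rw [← Real.exp_log hJ, ← Real.exp_add]
    refine Real.exp_le_exp.2 ?_
    simp only [hh, hg₀, hg₁, hS]
    linarith
  have hexp1 : ∫⁻ p, ENNReal.ofReal (Real.exp (-h p)) ∂cube k ≤ 1 := by
    have := hle univ
    rwa [Measure.map_apply hT .univ, preimage_univ, withDensity_apply _ .univ, setLIntegral_univ,
      measure_univ] at this
  have hei : Integrable (fun p => Real.exp (-h p)) (cube k) := by
    refine ⟨(Real.measurable_exp.comp hhm.neg).aestronglyMeasurable, ?_⟩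
    rw [hasFiniteIntegral_iff_ofReal (ae_of_all _ fun p => (Real.exp_pos _).le)]
    exact hexp1.trans_lt ENNReal.one_lt_top
  have hgi : Integrable (fun p => (g₀ p + g₁ p) / 2) (cube k) := (hi₀.add hi₁).div_const 2
  have hSnn : ∀ p, 0 ≤ S p := fun p => sqNorm_nonneg _
  have hcS : Integrable (fun p => c / 8 * S p) (cube k) := by
    refine (hgi.abs.add hei).mono' (hSm.const_mul _).aestronglyMeasurable
      (ae_of_all _ fun p => ?_)
    rw [Real.norm_eq_abs, abs_of_nonneg (mul_nonneg (by positivity) (hSnn p))]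
    have h1 := Real.add_one_le_exp (-h p)
    have h2 := le_abs_self ((g₀ p + g₁ p) / 2)
    have h3 : h p = (g₀ p + g₁ p) / 2 - c / 8 * S p := rfl
    simp only [Pi.add_apply]
    linarith
  have hSi : Integrable S (cube k) := by
    refine (hcS.const_mul (c / 8)⁻¹).congr (ae_of_all _ fun p => ?_)
    field_simp
  have hhi : Integrable h (cube k) := hgi.sub hcS
  refine ⟨hSi, fun m hm => ?_⟩
  have hint : ∫ p, h p ∂cube k =
      ((∫ p, g₀ p ∂cube k) + ∫ p, g₁ p ∂cube k) / 2 - c / 8 * ∫ p, S p ∂cube k := by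
    rw [← integral_add hi₀ hi₁, ← integral_div, ← integral_const_mul]
    exact integral_sub hgi hcS
  have hnn : 0 ≤ ∫ p, h p ∂cube k := by
    have h1 : ∫ p, Real.exp (-h p) ∂cube k ≤ 1 := by
      rw [integral_eq_lintegral_of_nonneg_ae (ae_of_all _ fun p => (Real.exp_pos _).le)
        hei.aestronglyMeasurable]
      exact ENNReal.toReal_le_of_le_ofReal zero_le_one (by simpa using hexp1)
    have h2 : ∫ p, (1 - h p) ∂cube k ≤ ∫ p, Real.exp (-h p) ∂cube k :=
      integral_mono ((integrable_const 1).sub hhi) hei fun p => by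
        have := Real.add_one_le_exp (-h p)
        dsimp only
        linarith
    rw [integral_sub (integrable_const 1) hhi] at h2
    simp at h2
    linarith
  have hfin := (hm _ hD.isStar).trans (KL_map_le hT hhm hhi hle)
  rw [ENNReal.ofReal_le_ofReal_iff hnn, hint] at hfin
  linarith

lemma exists_isStar_KL_ne_top (hW : Continuous W)
    (hπ : π = volume.withDensity fun z => ENNReal.ofReal (Real.exp (-W z)))
    [IsProbabilityMeasure π] : ∃ μ : Measure (ℝ × (Fin k → ℝ)), IsStar μ ∧ KL μ π ≠ ⊤ := by
  have hD : StarDiff (k := k) id (fun _ => 1) (fun _ _ w => w) (fun _ _ _ => 1) :=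
    { meas_root := measurable_id
      meas_root' := measurable_const
      meas_leaf := fun _ => measurable_snd
      meas_leaf' := fun _ => measurable_const
      strictMono_root := strictMono_id.strictMonoOn _
      mono_leaf := fun _ _ => monotone_id.monotoneOn _
      deriv_root := ae_of_all _ fun u => ⟨hasDerivAt_id u, one_pos⟩
      deriv_leaf := fun _ => ae_of_all _ fun _ => ae_of_all _ fun w => ⟨hasDerivAt_id w, one_pos⟩ }
  have hT := measurable_starMap hD.meas_root hD.meas_leaf
  obtain ⟨C, hC⟩ := (isCompact_Icc (a := (0 : ℝ × (Fin k → ℝ))) (b := 1)).exists_bound_of_continuousOn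
    hW.continuousOn
  have hmem : ∀ᵐ p ∂cube k, p ∈ Icc (0 : ℝ × (Fin k → ℝ)) 1 := by
    have h1 : ∀ j, ∀ᵐ p ∂cube k, p.2 j ∈ Ioo (0 : ℝ) 1 := fun j =>
      ae_cube_leaf (P := fun _ w => w ∈ Ioo (0 : ℝ) 1) (ae_of_all _ fun _ => ae_unif_mem)
        (measurable_snd measurableSet_Ioo)
    filter_upwards [ae_cube_root ae_unif_mem, ae_all_iff.2 h1] with p hp hp'
    exact ⟨⟨hp.1.le, fun j => (hp' j).1.le⟩, ⟨hp.2.le, fun j => (hp' j).2.le⟩⟩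
  have hWi : Integrable W (cube k) :=
    Integrable.of_bound hW.measurable.aestronglyMeasurable C (hmem.mono fun p hp => hC p hp)
  refine ⟨_, hD.isStar, ne_top_of_le_ne_top ENNReal.ofReal_ne_top
    (KL_map_le hT hW.measurable hWi (hD.map_withDensity_le_gibbs hW.measurable hπ ?_))⟩
  refine ae_of_all _ fun p => ?_
  simp [starJac, starMap]

end convexity

section minimizer

variable {k : ℕ} {W : ℝ × (Fin k → ℝ) → ℝ} {π : Measure (ℝ × (Fin k → ℝ))}

lemma norm_sq_le_sqNorm (v : ℝ × (Fin k → ℝ)) : ‖v‖ ^ 2 ≤ sqNorm v := by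
  have h : ‖v‖ ≤ √(sqNorm v) := by
    refine norm_prod_le_iff.2 ⟨?_, (pi_norm_le_iff_of_nonneg (Real.sqrt_nonneg _)).2 fun j => ?_⟩
    · exact Real.abs_le_sqrt (le_add_of_nonneg_right (Finset.sum_nonneg fun _ _ => sq_nonneg _))
    · refine Real.abs_le_sqrt (le_add_of_nonneg_of_le (sq_nonneg _) ?_)
      exact Finset.single_le_sum (f := fun i => v.2 i ^ 2) (fun _ _ => sq_nonneg _)
        (Finset.mem_univ j)
  exact (Real.le_sqrt (norm_nonneg _) (sqNorm_nonneg v)).1 h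

lemma ae_exists_bound_of_integral_le_geometric {Ω : Type*} [MeasurableSpace Ω] {ρ : Measure Ω}
    {f : ℕ → Ω → ℝ} (hm : ∀ n, Measurable (f n)) (h0 : ∀ n x, 0 ≤ f n x)
    (hi : ∀ n, Integrable (f n) ρ) {C r : ℝ} (hr0 : 0 ≤ r) (hr : r < 1)
    (h : ∀ n, ∫ x, f n x ∂ρ ≤ C * r ^ n) : ∀ᵐ x ∂ρ, ∃ B, ∀ n, f n x ≤ B := by
  have hlt : ∫⁻ x, ∑' n, ENNReal.ofReal (f n x) ∂ρ ≠ ⊤ := by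
    rw [lintegral_tsum fun n => (hm n).ennreal_ofReal.aemeasurable]
    have hle : ∑' n, ∫⁻ x, ENNReal.ofReal (f n x) ∂ρ ≤ ∑' n, ENNReal.ofReal (C * r ^ n) :=
      ENNReal.tsum_le_tsum fun n => by
        rw [← ofReal_integral_eq_lintegral_ofReal (hi n) (ae_of_all _ (h0 n))]
        exact ENNReal.ofReal_le_ofReal (h n)
    refine ne_top_of_le_ne_top ?_ hle
    exact ((summable_geometric_of_lt_one hr0 hr).mul_left C).tsum_ofReal_ne_top
  filter_upwards [ae_lt_top (Measurable.tsum fun n => (hm n).ennreal_ofReal) hlt] with x hx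
  refine ⟨(∑' n, ENNReal.ofReal (f n x)).toReal, fun n => ?_⟩
  rw [← ENNReal.ofReal_le_iff_le_toReal hx.ne]
  exact ENNReal.le_tsum n

/-- A star-structured minimizer exists when the potential is strongly convex. -/
lemma exists_isStar_forall_KL_le (hW : Continuous W)
    (hπ : π = volume.withDensity fun z => ENNReal.ofReal (Real.exp (-W z)))
    [IsProbabilityMeasure π] {c : ℝ} (hc : 0 < c)
    (hconv : ∀ x y, W ((1 / 2 : ℝ) • (x + y)) ≤ (W x + W y) / 2 - c / 8 * sqNorm (x - y)) :
    ∃ μ : Measure (ℝ × (Fin k → ℝ)), IsStar μ ∧ ∀ ν, IsStar ν → KL μ π ≤ KL ν π := by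
  set I : ℝ≥0∞ := ⨅ (ν : Measure (ℝ × (Fin k → ℝ))) (_ : IsStar ν), KL ν π with hI
  have hIle : ∀ ν : Measure (ℝ × (Fin k → ℝ)), IsStar ν → I ≤ KL ν π := fun ν hν => iInf₂_le ν hν
  have hItop : I ≠ ⊤ := by
    obtain ⟨μ, hμ, hμ'⟩ := exists_isStar_KL_ne_top hW hπ
    exact ne_top_of_le_ne_top hμ' (hIle μ hμ)
  set m := I.toReal with hm
  have hm0 : 0 ≤ m := ENNReal.toReal_nonneg
  have hIm : ENNReal.ofReal m = I := ENNReal.ofReal_toReal hItop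
  have hseq : ∀ n : ℕ, ∃ (a a' : ℝ → ℝ) (b b' : Fin k → ℝ → ℝ → ℝ), StarDiff a a' b b' ∧
      Integrable (fun p => W (starMap a b p) - Real.log (starJac a' b' p)) (cube k) ∧
      (∫ p, (W (starMap a b p) - Real.log (starJac a' b' p)) ∂cube k) ≤ m + (1 / 8) ^ n ∧
      KL ((cube k).map (starMap a b)) π ≤ ENNReal.ofReal (m + (1 / 8) ^ n) := fun n => by
    have hlt : I < ENNReal.ofReal (m + (1 / 8) ^ n) := by
      rw [← hIm, ENNReal.ofReal_lt_ofReal_iff (by positivity)]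
      exact lt_add_of_pos_right _ (by positivity)
    obtain ⟨μ, hμ⟩ := iInf_lt_iff.1 hlt
    obtain ⟨hμ, hlt⟩ := iInf_lt_iff.1 hμ
    obtain ⟨a, a', b, b', hD, hmap, hi, hKL, -⟩ :=
      hμ.exists_starDiff_KL hW.measurable hπ hlt.ne_top
    refine ⟨a, a', b, b', hD, hi, ?_, hmap ▸ hlt.le⟩
    rw [hKL] at hlt
    exact ((ENNReal.ofReal_lt_ofReal_iff (by positivity)).1 hlt).le
  choose a a' b b' hD hi hle hKL using hseq
  set T : ℕ → ℝ × (Fin k → ℝ) → ℝ × (Fin k → ℝ) := fun n => starMap (a n) (b n) with hT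
  have hTm : ∀ n, Measurable (T n) := fun n =>
    measurable_starMap (hD n).meas_root (hD n).meas_leaf
  have hbound : ∀ᵐ p ∂cube k, ∃ B, ∀ n : ℕ, 4 ^ n * sqNorm (T n p - T (n + 1) p) ≤ B := by
    have hs := fun n => (hD n).integral_sqNorm_sub_le hW.measurable hπ hc hconv (hD (n + 1))
      (hi n) (hi (n + 1))
    refine ae_exists_bound_of_integral_le_geometric (C := 8 / c) (r := 1 / 2)
      (fun n => (measurable_sqNorm.comp ((hTm n).sub (hTm (n + 1)))).const_mul _)
      (fun n p => mul_nonneg (by positivity) (sqNorm_nonneg _))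
      (fun n => (hs n).1.const_mul _) (by norm_num) (by norm_num) fun n => ?_
    have h1 := (hs n).2 m fun ν hν => hIm.trans_le (hIle ν hν)
    have h2 : c / 8 * ∫ p, sqNorm (T n p - T (n + 1) p) ∂cube k ≤ (1 / 8) ^ n := by
      have h3 := hle n
      have h4 := hle (n + 1)
      have h5 : (1 / 8 : ℝ) ^ (n + 1) ≤ (1 / 8) ^ n :=
        pow_le_pow_of_le_one (by norm_num) (by norm_num) n.le_succ
      refine h1.trans ?_
      linarith
    rw [integral_const_mul]
    have h6 : (1 / 2 : ℝ) ^ n = 4 ^ n * (1 / 8) ^ n := by rw [← mul_pow]; norm_num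
    rw [h6, mul_left_comm]
    refine mul_le_mul_of_nonneg_left ?_ (by positivity)
    rw [div_mul_eq_mul_div, le_div_iff₀ hc]
    linarith
  set A : ℝ → ℝ := fun u => limsup (fun n => a n u) atTop with hA
  set B : Fin k → ℝ → ℝ → ℝ := fun j u w => limsup (fun n => b n j u w) atTop with hB
  have hAm : Measurable A := Measurable.limsup fun n => (hD n).meas_root
  have hBm : ∀ j, Measurable (Function.uncurry (B j)) := fun j =>
    Measurable.limsup fun n => (hD n).meas_leaf j
  have hSm := measurable_starMap hAm hBm
  have hlim : ∀ᵐ p ∂cube k, Tendsto (fun n => T n p) atTop (𝓝 (starMap A B p)) := by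
    filter_upwards [hbound] with p ⟨N, hN⟩
    have hcau : CauchySeq fun n => T n p := by
      refine cauchySeq_of_le_geometric (1 / 2) (√N) (by norm_num) fun n => ?_
      have h1 : (2 ^ n * dist (T n p) (T (n + 1) p)) ^ 2 ≤ N := by
        refine le_trans ?_ (hN n)
        rw [mul_pow, dist_eq_norm, ← pow_mul, mul_comm n 2, pow_mul]
        norm_num only
        exact mul_le_mul_of_nonneg_left (norm_sq_le_sqNorm _) (by positivity)
      have h2 := (le_abs_self _).trans (Real.abs_le_sqrt h1)
      rw [one_div, inv_pow, ← div_eq_mul_inv, le_div_iff₀ (by positivity)]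
      linarith
    obtain ⟨x, hx⟩ := cauchySeq_tendsto_of_complete hcau
    have hx1 : Tendsto (fun n => a n p.1) atTop (𝓝 x.1) := (continuous_fst.tendsto x).comp hx
    have hx2 : ∀ j, Tendsto (fun n => b n j p.1 (p.2 j)) atTop (𝓝 (x.2 j)) := fun j =>
      (((continuous_apply j).comp continuous_snd).tendsto x).comp hx
    have : starMap A B p = x := by
      ext j
      · exact hx1.limsup_eq
      · exact (hx2 j).limsup_eq
    rwa [this]
  have hKLlim : KL ((cube k).map (starMap A B)) π ≤ ENNReal.ofReal m := by
    refine KL_map_le_of_tendsto hTm hSm hlim (c := fun n => m + (1 / 8) ^ n)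
      (fun n => by positivity) ?_ hKL
    simpa using (tendsto_pow_atTop_nhds_zero_of_lt_one (by norm_num : (0 : ℝ) ≤ 1 / 8)
      (by norm_num)).const_add m
  have hac : (cube k).map (starMap A B) ≪ volume :=
    (KL_ne_top_iff.1 (ne_top_of_le_ne_top ENNReal.ofReal_ne_top hKLlim)).1.trans
      (hπ ▸ withDensity_absolutelyContinuous _ _)
  refine ⟨(cube k).map (starMap A B), ?_, fun ν hν => hKLlim.trans (hIm.trans_le (hIle ν hν))⟩
  have hroot : ∀ᵐ u ∂unif, Tendsto (fun n => a n u) atTop (𝓝 (A u)) := by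
    have h1 : ∀ᵐ p ∂cube k, Tendsto (fun n => a n p.1) atTop (𝓝 (A p.1)) :=
      hlim.mono fun p hp => (continuous_fst.tendsto _).comp hp
    filter_upwards [Measure.ae_ae_of_ae_prod h1] with u hu
    obtain ⟨w, hw⟩ := hu.exists
    exact hw
  refine isStar_map_starMap hAm hBm (s := {u | u ∈ Ioo (0 : ℝ) 1 ∧
      Tendsto (fun n => a n u) atTop (𝓝 (A u))}) (ae_unif_mem.and hroot) ?_ ⟨fun x => ?_⟩
  · exact fun u hu w hw huw => le_of_tendsto_of_tendsto' hu.2 hw.2 fun n =>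
      (hD n).strictMono_root.monotoneOn hu.1 hw.1 huw
  · have hx : MeasurableSet (Prod.fst ⁻¹' {x} : Set (ℝ × (Fin k → ℝ))) :=
      measurable_fst (measurableSet_singleton x)
    have h0 : (volume : Measure (ℝ × (Fin k → ℝ))) (Prod.fst ⁻¹' {x}) = 0 := by
      rw [← prod_univ, Measure.volume_eq_prod, Measure.prod_prod]
      simp
    have h1 := hac h0
    rw [Measure.map_apply hSm hx] at h1
    have h2 : (cube k) (Prod.fst ⁻¹' (A ⁻¹' {x})) = unif (A ⁻¹' {x}) := by
      rw [← prod_univ, cube, Measure.prod_prod]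
      simp
    rw [Measure.map_apply hAm (measurableSet_singleton x), ← h2]
    exact h1

/-- Strong convexity of the potential forces star-structured minimizers to coincide. -/
lemma IsStar.eq_of_forall_KL_le (hW : Continuous W)
    (hπ : π = volume.withDensity fun z => ENNReal.ofReal (Real.exp (-W z)))
    [IsProbabilityMeasure π] {c : ℝ} (hc : 0 < c)
    (hconv : ∀ x y, W ((1 / 2 : ℝ) • (x + y)) ≤ (W x + W y) / 2 - c / 8 * sqNorm (x - y))
    {μ₀ μ₁ : Measure (ℝ × (Fin k → ℝ))} (h₀ : IsStar μ₀) (h₁ : IsStar μ₁)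
    (hmin₀ : ∀ ν, IsStar ν → KL μ₀ π ≤ KL ν π) (hmin₁ : ∀ ν, IsStar ν → KL μ₁ π ≤ KL ν π) :
    μ₀ = μ₁ := by
  obtain ⟨ν, hν, hνtop⟩ := exists_isStar_KL_ne_top hW hπ
  obtain ⟨a₀, a₀', b₀, b₀', hD₀, hmap₀, hi₀, hKL₀, hnn₀⟩ :=
    h₀.exists_starDiff_KL hW.measurable hπ (ne_top_of_le_ne_top hνtop (hmin₀ ν hν))
  obtain ⟨a₁, a₁', b₁, b₁', hD₁, hmap₁, hi₁, hKL₁, hnn₁⟩ :=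
    h₁.exists_starDiff_KL hW.measurable hπ (ne_top_of_le_ne_top hνtop (hmin₁ ν hν))
  obtain ⟨hSi, hS⟩ := hD₀.integral_sqNorm_sub_le hW.measurable hπ hc hconv hD₁ hi₀ hi₁
  have h2 := hS _ fun ν hν => hKL₀ ▸ hmin₀ ν hν
  have h3 := hmin₁ μ₀ h₀
  rw [hKL₀, hKL₁, ENNReal.ofReal_le_ofReal_iff hnn₀] at h3
  have hzero : ∫ p, sqNorm (starMap a₀ b₀ p - starMap a₁ b₁ p) ∂cube k = 0 := by
    refine le_antisymm ?_ (integral_nonneg fun p => sqNorm_nonneg _)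
    refine nonpos_of_mul_nonpos_right (a := c / 8) ?_ (by positivity)
    linarith
  rw [hmap₀, hmap₁]
  refine Measure.map_congr ?_
  filter_upwards [(integral_eq_zero_iff_of_nonneg (fun p => sqNorm_nonneg _) hSi).1 hzero] with p hp
  have h4 := norm_sq_le_sqNorm (starMap a₀ b₀ p - starMap a₁ b₁ p)
  have hp' : sqNorm (starMap a₀ b₀ p - starMap a₁ b₁ p) = 0 := hp
  rw [hp'] at h4
  exact sub_eq_zero.1 (norm_eq_zero.1 (pow_eq_zero_iff two_ne_zero |>.1
    (le_antisymm h4 (sq_nonneg _))))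

end minimizer

end

/-- **Uniqueness of the star-structured minimizer** under (P1) and (RD)
(d = k + 1 ≥ 2): there is a unique star-structured minimizer of `KL(· ‖ π)`. -/
theorem stmt4 {k : ℕ} (hk : 1 ≤ k)
    (V : ℝ × (Fin k → ℝ) → ℝ) (hV : ContDiff ℝ 2 V) (hgr : GrowthCond V)
    (ℓV ℓV' : ℝ) (hℓV : 0 < ℓV) (hℓV' : 0 < ℓV')
    -- (P1)
    (hP1 : ∀ z, ∀ b : Fin k → ℝ,
      ℓV * ∑ i, b i ^ 2 ≤ hess V z ((0:ℝ), b) ((0:ℝ), b))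
    -- (RD)
    (hRD : ∃ M : ℝ, (∀ z, (∑ j, hess V z e0 (eL j) ^ 2) ≤ M) ∧
      ∀ z, ℓV' ≤ hess V z e0 e0 - M / ℓV)
    (π : Measure (ℝ × (Fin k → ℝ))) [IsProbabilityMeasure π] (hπ : π = gibbs V) :
    ∃! μ : Measure (ℝ × (Fin k → ℝ)),
      IsStar μ ∧ ∀ ν, IsStar ν → KL μ π ≤ KL ν π := by
  obtain ⟨M, hM, hroot⟩ := hRD
  obtain ⟨c, hc, hcV⟩ := exists_hess_lower_bound hV hℓV hℓV' hP1 hM hroot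
  have : IsProbabilityMeasure (gibbs V) := hπ ▸ ‹IsProbabilityMeasure π›
  obtain ⟨r, hr⟩ := exists_gibbs_eq_withDensity hV.continuous.measurable
  rw [← hπ] at hr
  have hW : Continuous fun z => V z + r := hV.continuous.add continuous_const
  have hconv : ∀ x y, V ((1 / 2 : ℝ) • (x + y)) + r ≤
      ((V x + r) + (V y + r)) / 2 - c / 8 * sqNorm (x - y) := fun x y => by
    linarith [midpoint_le_of_hess hV hcV x y]
  obtain ⟨μ, hμ, hmin⟩ := exists_isStar_forall_KL_le hW hr hc hconv
  exact ⟨μ, ⟨hμ, hmin⟩, fun ν hν => hν.1.eq_of_forall_KL_le hW hr hc hconv hμ hν.2 hmin⟩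
end

section
/- Let π = N(m, Σ) be a nondegenerate Gaussian on ℝ^d (d ≥ 2), with m ∈ ℝ^d, Σ ≻ 0 with entries σ_{ij}, and write σ^{ij} for the (i,j)-entry of Σ^{−1}. Then the minimization of KL(μ ‖ π) over μ ∈ C_star admits a unique minimizer π⋆(dz) = p⋆(dz₁) q⋆(dz_{−1} ∣ z₁), where p⋆ = N(m₁, σ₁₁) and q⋆(· ∣ z₁) = N(m⋆_{z₁}, Σ⋆_{|1}) with m⋆_{z₁,i} = m_i + σ₁₁^{−1} σ_{1i} (z₁ − m₁) for i ≥ 2 and Σ⋆_{|1} = diag((σ^{22})^{−1}, …, (σ^{dd})^{−1}). Equivalently, π⋆ = N(m, Σ⋆) where σ⋆_{1i} = σ_{1i} for all i ∈ [d], σ⋆_{ii} = (σ^{ii})^{−1} + σ_{1i}²/σ₁₁ for i ∈ {2, …, d}, and σ⋆_{ij} = σ_{1i} σ_{1j} / σ₁₁ for distinct i, j ∈ {2, …, d}. -/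
open MeasureTheory ProbabilityTheory
open scoped ENNReal ProbabilityTheory

/-- The star-structured measure on `ℝ^d` with root coordinate `0`:
`μ₁(dz₁) ∏_{j ≠ 0} κ_j(dz_j ∣ z₁)`. -/
noncomputable def starMeasurePi {d : ℕ} [NeZero d]
    (μ₁ : Measure ℝ) (κ : Fin d → Kernel ℝ ℝ) : Measure (Fin d → ℝ) :=
  μ₁.bind fun z₁ => Measure.pi fun j => if j = 0 then Measure.dirac z₁ else κ j z₁

/-- `μ ∈ C_star` on `ℝ^d` (root coordinate `0`). -/
def IsStarPi {d : ℕ} [NeZero d] (μ : Measure (Fin d → ℝ)) : Prop :=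
  IsProbabilityMeasure μ ∧
    ∃ (μ₁ : Measure ℝ) (κ : Fin d → Kernel ℝ ℝ),
      IsProbabilityMeasure μ₁ ∧ (∀ j, IsMarkovKernel (κ j)) ∧ μ = starMeasurePi μ₁ κ

/-- Density of the multivariate Gaussian `N(m, S)` on `ℝ^d` (for `S ≻ 0`). -/
noncomputable def gaussDensity {d : ℕ} (m : Fin d → ℝ) (S : Matrix (Fin d) (Fin d) ℝ)
    (z : Fin d → ℝ) : ℝ :=
  (Real.sqrt ((2 * Real.pi) ^ d * S.det))⁻¹ *
    Real.exp (-(∑ i, ∑ j, (z i - m i) * S⁻¹ i j * (z j - m j)) / 2)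

/-- The multivariate Gaussian `N(m, S)` on `ℝ^d` (for `S ≻ 0`). -/
noncomputable def gaussPi {d : ℕ} (m : Fin d → ℝ) (S : Matrix (Fin d) (Fin d) ℝ) :
    Measure (Fin d → ℝ) :=
  volume.withDensity fun z => ENNReal.ofReal (gaussDensity m S z)

open InformationTheory in
theorem KL_eq_klDiv {E : Type*} [MeasurableSpace E] (μ π : Measure E)
    [IsProbabilityMeasure μ] [IsProbabilityMeasure π] : KL μ π = klDiv μ π := by
  simp only [KL, klDiv_def, llr_def, probReal_univ, add_sub_cancel_right]
  congr

open InformationTheory in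
/-- Change of reference measure in the Kullback–Leibler divergence. -/
theorem klDiv_tilted_ne_top {E : Type*} [MeasurableSpace E] {μ π : Measure E}
    [IsProbabilityMeasure μ] [IsProbabilityMeasure π] (h : klDiv μ π ≠ ∞) {g : E → ℝ}
    (hg : Integrable g μ) (hexp : Integrable (fun z => Real.exp (g z)) π) :
    klDiv μ (π.tilted g) ≠ ∞ := by
  obtain ⟨hac, hint⟩ := klDiv_ne_top_iff.1 h
  exact klDiv_ne_top (hac.trans (absolutelyContinuous_tilted hexp))
    (integrable_llr_tilted_right hac hg hint hexp)

open InformationTheory in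
theorem toReal_klDiv_eq_tilted_add {E : Type*} [MeasurableSpace E] {μ π : Measure E}
    [IsProbabilityMeasure μ] [IsProbabilityMeasure π] (h : klDiv μ π ≠ ∞) {g : E → ℝ}
    (hg : Integrable g μ) (hexp : Integrable (fun z => Real.exp (g z)) π)
    (hone : ∫ z, Real.exp (g z) ∂π = 1) :
    (klDiv μ π).toReal = (klDiv μ (π.tilted g)).toReal + ∫ z, g z ∂μ := by
  obtain ⟨hac, hint⟩ := klDiv_ne_top_iff.1 h
  have := isProbabilityMeasure_tilted hexp
  rw [toReal_klDiv_of_measure_eq hac (by simp),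
    toReal_klDiv_of_measure_eq (hac.trans (absolutelyContinuous_tilted hexp)) (by simp),
    integral_llr_tilted_right hac hg hexp hint, hone, Real.log_one]
  ring

open InformationTheory in
theorem klDiv_tilted_self_ne_top {E : Type*} [MeasurableSpace E] {π : Measure E}
    [IsProbabilityMeasure π] {g : E → ℝ} (hg : Integrable g (π.tilted g))
    (hexp : Integrable (fun z => Real.exp (g z)) π) :
    klDiv (π.tilted g) π ≠ ∞ := by
  have := isProbabilityMeasure_tilted hexp
  refine klDiv_ne_top (tilted_absolutelyContinuous π g) ?_
  have h : llr (π.tilted g) π =ᵐ[π.tilted g] fun z => g z - Real.log (∫ x, Real.exp (g x) ∂π) :=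
    (tilted_absolutelyContinuous π g).ae_le
      (log_rnDeriv_tilted_left_self hexp)
  exact (hg.sub (integrable_const _)).congr h.symm

theorem mul_le_mul_log_add_exp {x y : ℝ} (hx : 0 ≤ x) :
    x * y ≤ x * Real.log x + Real.exp y := by
  rcases hx.eq_or_lt with rfl | hx
  · simpa using (Real.exp_pos y).le
  · have h := Real.add_one_le_exp (y - Real.log x)
    rw [Real.exp_sub, Real.exp_log hx, le_div_iff₀ hx] at h
    nlinarith

open InformationTheory in
/-- Entropy inequality: exponential integrability transfers to integrability under any measure
of finite divergence. -/
theorem integrable_of_klDiv_ne_top {E : Type*} [MeasurableSpace E] {μ π : Measure E}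
    [IsProbabilityMeasure μ] [IsProbabilityMeasure π] (h : klDiv μ π ≠ ∞) {q : E → ℝ}
    (hq : Measurable q) (hq0 : ∀ z, 0 ≤ q z)
    (hexp : Integrable (fun z => Real.exp (q z)) π) : Integrable q μ := by
  obtain ⟨hac, hint⟩ := klDiv_ne_top_iff.1 h
  rw [← integrable_rnDeriv_smul_iff hac] at hint ⊢
  refine (hint.add hexp).mono'
    ((Measure.measurable_rnDeriv μ π).ennreal_toReal.aestronglyMeasurable.smul
      hq.aestronglyMeasurable) (ae_of_all _ fun z => ?_)
  have h0 : 0 ≤ (μ.rnDeriv π z).toReal := ENNReal.toReal_nonneg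
  simp only [smul_eq_mul, Pi.add_apply, llr_def]
  rw [Real.norm_of_nonneg (mul_nonneg h0 (hq0 z))]
  exact mul_le_mul_log_add_exp h0

theorem pi_gaussianReal_eq_withDensity {ι : Type*} [Fintype ι] (c : ι → ℝ) (v : ι → NNReal)
    (hv : ∀ i, v i ≠ 0) :
    Measure.pi (fun i => gaussianReal (c i) (v i)) =
      volume.withDensity fun w => ENNReal.ofReal (∏ i, gaussianPDFReal (c i) (v i) (w i)) := by
  refine Measure.pi_eq fun s hs => ?_
  have hmeas : MeasurableSet (Set.univ.pi s) := MeasurableSet.univ_pi hs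
  have hind : ∀ w : ι → ℝ, (Set.univ.pi s).indicator
      (fun w => ENNReal.ofReal (∏ i, gaussianPDFReal (c i) (v i) (w i))) w =
      ENNReal.ofReal (∏ i, (s i).indicator (gaussianPDFReal (c i) (v i)) (w i)) := by
    intro w
    by_cases hw : w ∈ Set.univ.pi s
    · rw [Set.indicator_of_mem hw]
      congr 1
      exact Finset.prod_congr rfl fun i _ => (Set.indicator_of_mem (hw i trivial) _).symm
    · rw [Set.indicator_of_notMem hw]
      simp only [Set.mem_univ_pi, not_forall] at hw
      obtain ⟨i, hi⟩ := hw
      rw [Finset.prod_eq_zero (Finset.mem_univ i) (Set.indicator_of_notMem hi _),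
        ENNReal.ofReal_zero]
  have hint : ∀ i, Integrable ((s i).indicator (gaussianPDFReal (c i) (v i))) volume :=
    fun i => (integrable_gaussianPDFReal _ _).indicator (hs i)
  have hnn : ∀ i x, 0 ≤ (s i).indicator (gaussianPDFReal (c i) (v i)) x :=
    fun i => Set.indicator_nonneg fun x _ => gaussianPDFReal_nonneg _ _ x
  rw [withDensity_apply _ hmeas, ← lintegral_indicator hmeas, lintegral_congr hind, volume_pi,
    ← ofReal_integral_eq_lintegral_ofReal (Integrable.fintype_prod hint)
      (ae_of_all _ fun w => Finset.prod_nonneg fun i _ => hnn i _), ← volume_pi,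
    integral_fintype_prod_volume_eq_prod, ENNReal.ofReal_prod_of_nonneg
      fun i _ => integral_nonneg (hnn i)]
  refine Finset.prod_congr rfl fun i _ => ?_
  rw [gaussianReal_apply_eq_integral _ (hv i), integral_indicator (hs i)]

theorem integrable_exp_of_lintegral_eq_one {E : Type*} [MeasurableSpace E] {μ : Measure E}
    {g : E → ℝ} (hg : Measurable g) (h : ∫⁻ z, ENNReal.ofReal (Real.exp (g z)) ∂μ = 1) :
    Integrable (fun z => Real.exp (g z)) μ ∧ ∫ z, Real.exp (g z) ∂μ = 1 := by
  have hpos : 0 ≤ᵐ[μ] fun z => Real.exp (g z) := ae_of_all _ fun _ => (Real.exp_pos _).le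
  refine ⟨⟨hg.exp.aestronglyMeasurable, ?_⟩, ?_⟩
  · rw [hasFiniteIntegral_iff_ofReal hpos, h]
    exact ENNReal.one_lt_top
  · rw [integral_eq_lintegral_of_nonneg_ae hpos hg.exp.aestronglyMeasurable, h,
      ENNReal.toReal_one]

open Matrix in
theorem gaussDensity_eq {d : ℕ} (m : Fin d → ℝ) (S : Matrix (Fin d) (Fin d) ℝ)
    (z : Fin d → ℝ) :
    gaussDensity m S z = (Real.sqrt ((2 * Real.pi) ^ d * S.det))⁻¹ *
      Real.exp (-((z - m) ⬝ᵥ (S⁻¹ *ᵥ (z - m))) / 2) := by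
  simp only [gaussDensity, dotProduct, mulVec, Pi.sub_apply, Finset.mul_sum, mul_assoc]

theorem measurable_gaussDensity {d : ℕ} (m : Fin d → ℝ) (S : Matrix (Fin d) (Fin d) ℝ) :
    Measurable (gaussDensity m S) := by
  unfold gaussDensity
  fun_prop

theorem gaussDensity_nonneg {d : ℕ} (m : Fin d → ℝ) (S : Matrix (Fin d) (Fin d) ℝ)
    (z : Fin d → ℝ) : 0 ≤ gaussDensity m S z := by
  unfold gaussDensity
  positivity

open Matrix in
theorem dotProduct_inv_mulVec_of_factor {n : Type*} [Fintype n] [DecidableEq n]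
    {A : Matrix n n ℝ} (hA : A.det ≠ 0) {v : n → ℝ} (hv : ∀ i, v i ≠ 0) (w : n → ℝ) :
    (A *ᵥ w) ⬝ᵥ ((A * diagonal v * Aᵀ)⁻¹ *ᵥ (A *ᵥ w)) = ∑ i, (v i)⁻¹ * w i ^ 2 := by
  have hAu : IsUnit A.det := hA.isUnit
  have hAt : IsUnit Aᵀ.det := by rwa [det_transpose]
  have hdinv : (diagonal v)⁻¹ = diagonal fun i => (v i)⁻¹ := by
    refine inv_eq_right_inv ?_
    rw [diagonal_mul_diagonal, ← diagonal_one]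
    congr 1
    funext i
    exact mul_inv_cancel₀ (hv i)
  have hinv : Aᵀ * ((A * diagonal v * Aᵀ)⁻¹ * A) = diagonal fun i => (v i)⁻¹ := by
    rw [Matrix.mul_inv_rev, Matrix.mul_inv_rev, hdinv, mul_assoc, mul_assoc,
      nonsing_inv_mul _ hAu, mul_one, ← mul_assoc, mul_nonsing_inv _ hAt, one_mul]
  rw [mulVec_mulVec, ← vecMul_transpose A w, ← dotProduct_mulVec, mulVec_mulVec, hinv]
  simp only [dotProduct, mulVec_diagonal]
  exact Finset.sum_congr rfl fun i _ => by ring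

open Matrix in
theorem abs_det_mul_gaussDensity {d : ℕ} (m : Fin d → ℝ) (A : Matrix (Fin d) (Fin d) ℝ)
    (hA : A.det ≠ 0) (v : Fin d → NNReal) (hv : ∀ i, v i ≠ 0) (w : Fin d → ℝ) :
    |A.det| * gaussDensity m (A * diagonal (fun i => (v i : ℝ)) * Aᵀ) (m + A *ᵥ w) =
      ∏ i, gaussianPDFReal 0 (v i) (w i) := by
  have hv' : ∀ i, (v i : ℝ) ≠ 0 := fun i => by simpa using hv i
  have hquad := dotProduct_inv_mulVec_of_factor hA hv' w
  have hdet : Real.sqrt ((2 * Real.pi) ^ d * (A * diagonal (fun i => (v i : ℝ)) * Aᵀ).det) =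
      |A.det| * ∏ i, Real.sqrt (2 * Real.pi * v i) := by
    rw [det_mul, det_mul, det_diagonal, det_transpose, ← Real.sqrt_prod _ fun i _ => by positivity,
      ← Real.sqrt_sq_eq_abs, ← Real.sqrt_mul (sq_nonneg _), Finset.prod_mul_distrib]
    congr 1
    simp
    ring
  rw [gaussDensity_eq, add_sub_cancel_left, hquad, hdet]
  simp only [gaussianPDFReal, Finset.prod_mul_distrib, ← Real.exp_sum, Finset.prod_inv_distrib,
    sub_zero, mul_inv]
  rw [← mul_assoc, ← mul_assoc, mul_inv_cancel₀ (abs_ne_zero.2 hA), one_mul]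
  congr 2
  rw [neg_div, Finset.sum_div, ← Finset.sum_neg_distrib]
  refine Finset.sum_congr rfl fun i _ => ?_
  field_simp

open Matrix in
theorem map_affine_pi_gaussianReal {d : ℕ} (m : Fin d → ℝ) (A : Matrix (Fin d) (Fin d) ℝ)
    (hA : A.det ≠ 0) (v : Fin d → NNReal) (hv : ∀ i, v i ≠ 0) :
    (Measure.pi fun i => gaussianReal 0 (v i)).map (fun w => m + A *ᵥ w) =
      gaussPi m (A * diagonal (fun i => (v i : ℝ)) * Aᵀ) := by
  have hT : Measurable fun w : Fin d → ℝ => m + A *ᵥ w := by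
    refine measurable_const.add ?_
    exact (toLin' A).continuous_of_finiteDimensional.measurable
  have hvol : (volume : Measure (Fin d → ℝ)).map (fun w => m + A *ᵥ w) =
      ENNReal.ofReal |A.det|⁻¹ • volume := by
    have h1 := Real.map_matrix_volume_pi_eq_smul_volume_pi hA
    have h2 : (volume : Measure (Fin d → ℝ)).map (fun w => m + A *ᵥ w) =
        (volume.map (toLin' A)).map (m + ·) := by
      rw [Measure.map_map (by fun_prop) (toLin' A).continuous_of_finiteDimensional.measurable]
      rfl
    rw [h2, h1, Measure.map_smul, map_add_left_eq_self, abs_inv]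
  rw [pi_gaussianReal_eq_withDensity _ _ hv]
  ext s hs
  have hρ : Measurable fun z => ENNReal.ofReal
      (gaussDensity m (A * diagonal (fun i => (v i : ℝ)) * Aᵀ) z) :=
    (measurable_gaussDensity _ _).ennreal_ofReal
  have hdetpos : 0 < |A.det| := abs_pos.2 hA
  have hvol' : (volume : Measure (Fin d → ℝ)) =
      ENNReal.ofReal |A.det| • volume.map (fun w => m + A *ᵥ w) := by
    rw [hvol, smul_smul, ← ENNReal.ofReal_mul hdetpos.le, mul_inv_cancel₀ hdetpos.ne',
      ENNReal.ofReal_one, one_smul]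
  rw [Measure.map_apply hT hs, withDensity_apply _ (hT hs), gaussPi, withDensity_apply _ hs]
  conv_rhs => rw [hvol']
  rw [Measure.restrict_smul, lintegral_smul_measure, setLIntegral_map hs hρ hT, smul_eq_mul]
  refine Eq.trans ?_ (lintegral_const_mul _ (hρ.comp hT))
  refine lintegral_congr fun w => ?_
  rw [← ENNReal.ofReal_mul hdetpos.le, abs_det_mul_gaussDensity m A hA v hv]

open Matrix MatrixOrder in
theorem isProbabilityMeasure_gaussPi {d : ℕ} (m : Fin d → ℝ) {S : Matrix (Fin d) (Fin d) ℝ}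
    (hS : S.PosDef) : IsProbabilityMeasure (gaussPi m S) := by
  obtain ⟨B, hB⟩ := CStarAlgebra.nonneg_iff_eq_star_mul_self.mp hS.posSemidef.nonneg
  have hBS : S = Bᵀ * diagonal (fun _ => ((1 : NNReal) : ℝ)) * Bᵀᵀ := by
    rw [hB]; simp [star_eq_conjTranspose]
  have hdet : Bᵀ.det ≠ 0 := by
    intro h
    apply hS.det_pos.ne'
    rw [hBS, det_mul, det_mul, h]
    simp
  rw [hBS, ← map_affine_pi_gaussianReal m Bᵀ hdet (fun _ => 1) (fun _ => one_ne_zero)]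
  exact Measure.isProbabilityMeasure_map (by
    refine (measurable_const.add ?_).aemeasurable
    exact (toLin' Bᵀ).continuous_of_finiteDimensional.measurable)

open Matrix in
/-- Completing the square in coordinate `j`. -/
theorem dotProduct_inv_mulVec_eq_add {n : Type*} [Fintype n] [DecidableEq n]
    {S : Matrix n n ℝ} (hS : S.PosDef) (j : n) (w : n → ℝ) :
    w ⬝ᵥ (S⁻¹ *ᵥ w) = w j ^ 2 / S j j +
      (w - (w j / S j j) • S.col j) ⬝ᵥ (S⁻¹ *ᵥ (w - (w j / S j j) • S.col j)) := by
  have hjj : S j j ≠ 0 := (hS.diag_pos (i := j)).ne'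
  have hcol : S⁻¹ *ᵥ S.col j = Pi.single j 1 := by
    rw [← mulVec_single_one, mulVec_mulVec, nonsing_inv_mul _ hS.det_pos.ne'.isUnit, one_mulVec]
  have hsymm : (S⁻¹)ᵀ = S⁻¹ := by
    simpa [IsHermitian] using hS.inv.isHermitian
  have hcross : S.col j ⬝ᵥ (S⁻¹ *ᵥ w) = w j := by
    rw [dotProduct_mulVec, ← mulVec_transpose, hsymm, hcol, single_one_dotProduct]
  simp only [mulVec_sub, mulVec_smul, hcol, sub_dotProduct, dotProduct_sub, smul_dotProduct,
    dotProduct_smul, hcross, dotProduct_single_one, smul_eq_mul, Pi.sub_apply, Pi.smul_apply, col_apply]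
  field_simp
  ring

open Matrix in
theorem sq_le_mul_dotProduct_inv_mulVec {n : Type*} [Fintype n] [DecidableEq n]
    {S : Matrix n n ℝ} (hS : S.PosDef) (j : n) (w : n → ℝ) :
    w j ^ 2 ≤ S j j * (w ⬝ᵥ (S⁻¹ *ᵥ w)) := by
  have hjj : 0 < S j j := hS.diag_pos
  have h := hS.inv.posSemidef.dotProduct_mulVec_nonneg (w - (w j / S j j) • S.col j)
  rw [star_trivial] at h
  rw [dotProduct_inv_mulVec_eq_add hS j w, mul_add, mul_div_cancel₀ _ hjj.ne']
  nlinarith [mul_nonneg hjj.le h]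

open Matrix in
theorem integrable_exp_quadratic_gaussPi {d : ℕ} (m : Fin d → ℝ)
    {S : Matrix (Fin d) (Fin d) ℝ} (hS : S.PosDef) :
    Integrable (fun z => Real.exp ((z - m) ⬝ᵥ (S⁻¹ *ᵥ (z - m)) / 4)) (gaussPi m S) := by
  have h2 : ((2 : ℝ) • S).PosDef := hS.smul two_pos
  have hinv : ((2 : ℝ) • S)⁻¹ = (2 : ℝ)⁻¹ • S⁻¹ := by
    have : Invertible (2 : ℝ) := invertibleOfNonzero two_ne_zero
    rw [inv_smul S (2 : ℝ) hS.det_pos.ne'.isUnit, invOf_eq_inv]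
  have hfin := isProbabilityMeasure_gaussPi m h2
  have hint : Integrable (gaussDensity m ((2 : ℝ) • S)) volume := by
    refine ⟨(measurable_gaussDensity _ _).aestronglyMeasurable, ?_⟩
    rw [hasFiniteIntegral_iff_ofReal (ae_of_all _ (gaussDensity_nonneg _ _))]
    have := hfin.measure_univ
    rw [gaussPi, withDensity_apply _ MeasurableSet.univ, Measure.restrict_univ] at this
    rw [this]
    exact ENNReal.one_lt_top
  rw [gaussPi, integrable_withDensity_iff_integrable_smul₀'
    (measurable_gaussDensity _ _).ennreal_ofReal.aemeasurable
    (ae_of_all _ fun _ => ENNReal.ofReal_lt_top)]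
  have hpos : 0 < Real.sqrt ((2 * Real.pi) ^ d * ((2 : ℝ) • S).det) :=
    Real.sqrt_pos.2 (mul_pos (by positivity) h2.det_pos)
  refine (hint.const_mul ((Real.sqrt ((2 * Real.pi) ^ d * S.det))⁻¹ *
    Real.sqrt ((2 * Real.pi) ^ d * ((2 : ℝ) • S).det))).congr (ae_of_all _ fun z => ?_)
  simp only [smul_eq_mul]
  rw [ENNReal.toReal_ofReal (gaussDensity_nonneg _ _ _), gaussDensity_eq, gaussDensity_eq, hinv,
    smul_mulVec, dotProduct_smul, smul_eq_mul, mul_assoc, mul_inv_cancel_left₀ hpos.ne', mul_assoc,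
    ← Real.exp_add]
  congr 2
  ring

open Matrix InformationTheory in
theorem memLp_two_of_klDiv_gaussPi_ne_top {d : ℕ} {m : Fin d → ℝ}
    {S : Matrix (Fin d) (Fin d) ℝ} (hS : S.PosDef) {μ : Measure (Fin d → ℝ)}
    [IsProbabilityMeasure μ] (h : klDiv μ (gaussPi m S) ≠ ∞) (j : Fin d) :
    MemLp (fun z => z j - m j) 2 μ := by
  have := isProbabilityMeasure_gaussPi m hS
  have hmeas : Measurable fun z : Fin d → ℝ => (z - m) ⬝ᵥ (S⁻¹ *ᵥ (z - m)) := by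
    unfold dotProduct mulVec dotProduct
    simp only [Pi.sub_apply]
    fun_prop
  have hq := integrable_of_klDiv_ne_top h (hmeas.div_const 4) (fun z => by
      have := hS.inv.posSemidef.dotProduct_mulVec_nonneg (z - m)
      rw [star_trivial] at this
      positivity) (integrable_exp_quadratic_gaussPi m hS)
  have hm : Measurable fun z : Fin d → ℝ => z j - m j := by fun_prop
  rw [memLp_two_iff_integrable_sq hm.aestronglyMeasurable]
  refine (hq.const_mul (4 * S j j)).mono' (hm.pow_const 2).aestronglyMeasurable
    (ae_of_all _ fun z => ?_)
  have := sq_le_mul_dotProduct_inv_mulVec hS j (z - m)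
  rw [Pi.sub_apply] at this
  rw [Real.norm_of_nonneg (sq_nonneg _)]
  linarith

/-- The covariance `Σ⋆` of the star-structured minimizer. -/
noncomputable def starCov {d : ℕ} [NeZero d] (S : Matrix (Fin d) (Fin d) ℝ) :
    Matrix (Fin d) (Fin d) ℝ :=
  Matrix.of fun i j =>
    if i = 0 then S 0 j
    else if j = 0 then S i 0
    else if i = j then (S⁻¹ i i)⁻¹ + S 0 i ^ 2 / S 0 0
    else S 0 i * S 0 j / S 0 0

/-- The root variance and the leaf conditional variances of the minimizer. -/
noncomputable def starVar {d : ℕ} [NeZero d] (S : Matrix (Fin d) (Fin d) ℝ) (i : Fin d) : ℝ :=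
  if i = 0 then S 0 0 else (S⁻¹ i i)⁻¹

/-- The conditional mean of coordinate `i` given that the root equals `x`. -/
noncomputable def leafMean {d : ℕ} [NeZero d] (m : Fin d → ℝ) (S : Matrix (Fin d) (Fin d) ℝ)
    (i : Fin d) (x : ℝ) : ℝ :=
  m i + (S 0 0)⁻¹ * S 0 i * (x - m 0)

/-- The unitriangular factor of `starCov S`. -/
noncomputable def starFactor {d : ℕ} [NeZero d] (S : Matrix (Fin d) (Fin d) ℝ) :
    Matrix (Fin d) (Fin d) ℝ :=
  Matrix.of fun i j => (if i = j then 1 else 0) +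
    (if i = 0 then 0 else (S 0 0)⁻¹ * S 0 i) * (if j = 0 then 1 else 0)

theorem measurable_leafMean {d : ℕ} [NeZero d] (m : Fin d → ℝ) (S : Matrix (Fin d) (Fin d) ℝ)
    (i : Fin d) : Measurable (leafMean m S i) := by
  unfold leafMean
  fun_prop

theorem leafMean_zero {d : ℕ} [NeZero d] (m : Fin d → ℝ) {S : Matrix (Fin d) (Fin d) ℝ}
    (hS : S.PosDef) (x : ℝ) : leafMean m S 0 x = x := by
  have : S 0 0 ≠ 0 := (hS.diag_pos (i := 0)).ne'
  rw [leafMean, inv_mul_cancel₀ this]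
  ring

theorem starVar_pos {d : ℕ} [NeZero d] {S : Matrix (Fin d) (Fin d) ℝ} (hS : S.PosDef)
    (i : Fin d) : 0 < starVar S i := by
  unfold starVar
  split_ifs
  · exact hS.diag_pos
  · exact inv_pos.2 hS.inv.diag_pos

open Matrix in
theorem starFactor_mulVec {d : ℕ} [NeZero d] (S : Matrix (Fin d) (Fin d) ℝ) (w : Fin d → ℝ)
    (i : Fin d) :
    (starFactor S *ᵥ w) i = w i + (if i = 0 then 0 else (S 0 0)⁻¹ * S 0 i) * w 0 := by
  simp [starFactor, mulVec, dotProduct, add_mul, Finset.sum_add_distrib]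

theorem det_starFactor {d : ℕ} [NeZero d] (S : Matrix (Fin d) (Fin d) ℝ) :
    (starFactor S).det = 1 := by
  rw [Matrix.det_of_isLowerTriangular]
  · refine Finset.prod_eq_one fun i _ => ?_
    by_cases hi : i = 0 <;> simp [starFactor, hi]
  · intro i j hij
    have hij' : i < j := hij
    have hj : j ≠ 0 := (lt_of_le_of_lt (Fin.zero_le _) hij').ne'
    simp [starFactor, hij'.ne, hj]

open Matrix in
theorem starCov_eq_factor {d : ℕ} [NeZero d] {S : Matrix (Fin d) (Fin d) ℝ} (hS : S.PosDef) :
    starCov S = starFactor S * diagonal (starVar S) * (starFactor S)ᵀ := by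
  have h00 : S 0 0 ≠ 0 := (hS.diag_pos (i := 0)).ne'
  have hsymm : ∀ i, S i 0 = S 0 i := fun i => by simpa using hS.isHermitian.apply 0 i
  ext i j
  rw [mul_assoc, mul_apply]
  simp only [diagonal_mul, transpose_apply, starFactor, starCov, starVar, of_apply, add_mul,
    mul_add, Finset.sum_add_distrib]
  by_cases hi : i = 0 <;> by_cases hj : j = 0 <;> by_cases hij : i = j <;>
    simp_all <;> field_simp

open Matrix in
theorem posDef_starCov {d : ℕ} [NeZero d] {S : Matrix (Fin d) (Fin d) ℝ} (hS : S.PosDef) :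
    (starCov S).PosDef := by
  rw [starCov_eq_factor hS]
  have h := (PosDef.diagonal (starVar_pos hS)).mul_mul_conjTranspose_same (B := starFactor S)
    (vecMul_injective_of_isUnit
      ((isUnit_iff_isUnit_det _).2 (by rw [det_starFactor]; exact isUnit_one)))
  simpa using h

/-- The residual of coordinate `i` after regression on the root coordinate. -/
noncomputable def resid {d : ℕ} [NeZero d] (m : Fin d → ℝ) (S : Matrix (Fin d) (Fin d) ℝ)
    (i : Fin d) (z : Fin d → ℝ) : ℝ :=
  z i - leafMean m S i (z 0)

theorem measurable_resid {d : ℕ} [NeZero d] (m : Fin d → ℝ) (S : Matrix (Fin d) (Fin d) ℝ)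
    (i : Fin d) : Measurable (resid m S i) :=
  (measurable_pi_apply i).sub ((measurable_leafMean m S i).comp (measurable_pi_apply 0))

theorem resid_zero {d : ℕ} [NeZero d] (m : Fin d → ℝ) {S : Matrix (Fin d) (Fin d) ℝ}
    (hS : S.PosDef) (z : Fin d → ℝ) : resid m S 0 z = 0 := by
  rw [resid, leafMean_zero m hS, sub_self]

open InformationTheory in
theorem memLp_two_resid {d : ℕ} [NeZero d] {m : Fin d → ℝ} {S T : Matrix (Fin d) (Fin d) ℝ}
    (hT : T.PosDef) {μ : Measure (Fin d → ℝ)} [IsProbabilityMeasure μ]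
    (h : klDiv μ (gaussPi m T) ≠ ∞) (i : Fin d) : MemLp (resid m S i) 2 μ := by
  have h1 := (memLp_two_of_klDiv_gaussPi_ne_top hT h i).sub
    ((memLp_two_of_klDiv_gaussPi_ne_top hT h 0).const_mul ((S 0 0)⁻¹ * S 0 i))
  refine h1.congr_norm (measurable_resid m S i).aestronglyMeasurable (ae_of_all _ fun z => ?_)
  simp only [Pi.sub_apply, resid, leafMean]
  congr 1
  ring

/-- The off-diagonal part of the precision matrix. -/
noncomputable def offDiagPrec {n : Type*} [Fintype n] [DecidableEq n] (S : Matrix n n ℝ)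
    (i j : n) : ℝ :=
  if i = j then 0 else S⁻¹ i j

open Matrix in
theorem sum_offDiagPrec_mul {n : Type*} [Fintype n] [DecidableEq n] (S : Matrix n n ℝ)
    (u : n → ℝ) :
    ∑ i, ∑ j, offDiagPrec S i j * (u i * u j) =
      u ⬝ᵥ (S⁻¹ *ᵥ u) - ∑ i, S⁻¹ i i * u i ^ 2 := by
  simp only [dotProduct, mulVec, Finset.mul_sum]
  rw [← Finset.sum_sub_distrib]
  refine Finset.sum_congr rfl fun i _ => ?_
  rw [← Finset.add_sum_erase _ (fun j => offDiagPrec S i j * (u i * u j)) (Finset.mem_univ i),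
    ← Finset.add_sum_erase _ (fun j => u i * (S⁻¹ i j * u j)) (Finset.mem_univ i)]
  simp only [offDiagPrec, if_true, zero_mul, zero_add]
  rw [show u i * (S⁻¹ i i * u i) = S⁻¹ i i * u i ^ 2 by ring, add_sub_cancel_left]
  refine Finset.sum_congr rfl fun j hj => ?_
  rw [if_neg (Finset.ne_of_mem_erase hj).symm]
  ring

/-- The minimal value of the divergence. -/
noncomputable def starLogConst {d : ℕ} [NeZero d] (S : Matrix (Fin d) (Fin d) ℝ) : ℝ :=
  Real.log (Real.sqrt ((2 * Real.pi) ^ d * S.det) /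
    Real.sqrt ((2 * Real.pi) ^ d * (starCov S).det))

/-- The log-density of the minimizer with respect to the target. -/
noncomputable def starLogDensity {d : ℕ} [NeZero d] (m : Fin d → ℝ)
    (S : Matrix (Fin d) (Fin d) ℝ) (z : Fin d → ℝ) : ℝ :=
  starLogConst S + (∑ i, ∑ j, offDiagPrec S i j * (resid m S i z * resid m S j z)) / 2

theorem measurable_starLogDensity {d : ℕ} [NeZero d] (m : Fin d → ℝ)
    (S : Matrix (Fin d) (Fin d) ℝ) : Measurable (starLogDensity m S) := by
  have := measurable_resid m S
  unfold starLogDensity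
  fun_prop

open Matrix in
theorem quadratic_eq_resid {d : ℕ} [NeZero d] (m : Fin d → ℝ)
    {S : Matrix (Fin d) (Fin d) ℝ} (hS : S.PosDef) (z : Fin d → ℝ) :
    (z - m) ⬝ᵥ (S⁻¹ *ᵥ (z - m)) = (z 0 - m 0) ^ 2 / S 0 0 +
      (fun i => resid m S i z) ⬝ᵥ (S⁻¹ *ᵥ fun i => resid m S i z) := by
  have hsymm : ∀ i, S i 0 = S 0 i := fun i => by simpa using hS.isHermitian.apply 0 i
  have hu : z - m - ((z - m) 0 / S 0 0) • S.col 0 = fun i => resid m S i z := by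
    funext i
    simp only [Pi.sub_apply, Pi.smul_apply, col_apply, smul_eq_mul, resid, leafMean, hsymm]
    ring
  rw [dotProduct_inv_mulVec_eq_add hS 0, hu]
  rfl

open Matrix in
theorem quadratic_starCov_eq_resid {d : ℕ} [NeZero d] (m : Fin d → ℝ)
    {S : Matrix (Fin d) (Fin d) ℝ} (hS : S.PosDef) (z : Fin d → ℝ) :
    (z - m) ⬝ᵥ ((starCov S)⁻¹ *ᵥ (z - m)) = (z 0 - m 0) ^ 2 / S 0 0 +
      ∑ i, S⁻¹ i i * resid m S i z ^ 2 := by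
  have hx : z - m = starFactor S *ᵥ fun i => if i = 0 then z 0 - m 0 else resid m S i z := by
    funext i
    rw [starFactor_mulVec]
    by_cases hi : i = 0
    · simp [hi]
    · simp only [hi, if_false, if_true, resid, leafMean, Pi.sub_apply]
      ring
  rw [hx, starCov_eq_factor hS, dotProduct_inv_mulVec_of_factor
    (by rw [det_starFactor]; exact one_ne_zero) (fun i => (starVar_pos hS i).ne'),
    ← Finset.add_sum_erase _ _ (Finset.mem_univ (0 : Fin d)),
    ← Finset.add_sum_erase (a := (0 : Fin d)) (s := Finset.univ)
      (f := fun i => S⁻¹ i i * resid m S i z ^ 2) (Finset.mem_univ 0)]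
  rw [resid_zero m hS]
  simp only [starVar, if_true]
  rw [Finset.sum_congr rfl fun i hi => by
    rw [if_neg (Finset.ne_of_mem_erase hi), if_neg (Finset.ne_of_mem_erase hi), inv_inv]]
  ring

theorem gaussDensity_starCov {d : ℕ} [NeZero d] (m : Fin d → ℝ)
    {S : Matrix (Fin d) (Fin d) ℝ} (hS : S.PosDef) (z : Fin d → ℝ) :
    gaussDensity m (starCov S) z = gaussDensity m S z * Real.exp (starLogDensity m S z) := by
  have h1 : 0 < Real.sqrt ((2 * Real.pi) ^ d * S.det) :=
    Real.sqrt_pos.2 (mul_pos (by positivity) hS.det_pos)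
  have h2 : 0 < Real.sqrt ((2 * Real.pi) ^ d * (starCov S).det) :=
    Real.sqrt_pos.2 (mul_pos (by positivity) (posDef_starCov hS).det_pos)
  rw [gaussDensity_eq, gaussDensity_eq, starLogDensity, starLogConst, sum_offDiagPrec_mul, Real.exp_add,
    Real.exp_log (div_pos h1 h2), quadratic_eq_resid m hS, quadratic_starCov_eq_resid m hS]
  rw [mul_mul_mul_comm, ← Real.exp_add]
  congr 1
  · field_simp
  · congr 1
    ring

theorem integrable_exp_starLogDensity {d : ℕ} [NeZero d] (m : Fin d → ℝ)
    {S : Matrix (Fin d) (Fin d) ℝ} (hS : S.PosDef) :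
    Integrable (fun z => Real.exp (starLogDensity m S z)) (gaussPi m S) ∧
      ∫ z, Real.exp (starLogDensity m S z) ∂(gaussPi m S) = 1 := by
  have hprob := isProbabilityMeasure_gaussPi m (posDef_starCov hS)
  have hmeas := (measurable_starLogDensity m S).exp
  have hl : ∫⁻ z, ENNReal.ofReal (Real.exp (starLogDensity m S z)) ∂(gaussPi m S) = 1 := by
    rw [gaussPi, lintegral_withDensity_eq_lintegral_mul _
      (measurable_gaussDensity _ _).ennreal_ofReal hmeas.ennreal_ofReal]
    have := hprob.measure_univ
    rw [gaussPi, withDensity_apply _ MeasurableSet.univ, Measure.restrict_univ] at this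
    rw [← this]
    refine lintegral_congr fun z => ?_
    rw [Pi.mul_apply, ← ENNReal.ofReal_mul (gaussDensity_nonneg _ _ _), gaussDensity_starCov m hS]
  exact integrable_exp_of_lintegral_eq_one (measurable_starLogDensity m S) hl

theorem gaussPi_starCov_eq_tilted {d : ℕ} [NeZero d] (m : Fin d → ℝ)
    {S : Matrix (Fin d) (Fin d) ℝ} (hS : S.PosDef) :
    gaussPi m (starCov S) = (gaussPi m S).tilted (starLogDensity m S) := by
  rw [Measure.tilted, (integrable_exp_starLogDensity m hS).2]
  simp only [div_one]
  rw [gaussPi, gaussPi, ← withDensity_mul _ (measurable_gaussDensity _ _).ennreal_ofReal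
    (measurable_starLogDensity m S).exp.ennreal_ofReal]
  congr 1
  funext z
  rw [Pi.mul_apply, ← ENNReal.ofReal_mul (gaussDensity_nonneg _ _ _), gaussDensity_starCov m hS]

/-- The coordinate kernels of a star-structured measure: the root coordinate is copied. -/
noncomputable def starCoord {d : ℕ} [NeZero d] (κ : Fin d → Kernel ℝ ℝ) (j : Fin d) :
    Kernel ℝ ℝ :=
  if j = 0 then Kernel.id else κ j

theorem starCoord_apply {d : ℕ} [NeZero d] (κ : Fin d → Kernel ℝ ℝ) (j : Fin d) (x : ℝ) :
    starCoord κ j x = if j = 0 then Measure.dirac x else κ j x := by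
  unfold starCoord
  split_ifs
  · exact Kernel.id_apply x
  · rfl

instance {d : ℕ} [NeZero d] (κ : Fin d → Kernel ℝ ℝ) [∀ j, IsMarkovKernel (κ j)] (j : Fin d) :
    IsMarkovKernel (starCoord κ j) := by
  unfold starCoord
  split_ifs <;> infer_instance

theorem measurable_pi_kernel {ι α : Type*} [Fintype ι] [MeasurableSpace α] {β : ι → Type*}
    [∀ i, MeasurableSpace (β i)] (κ : ∀ i, Kernel α (β i)) [∀ i, IsMarkovKernel (κ i)] :
    Measurable fun x => Measure.pi fun i => κ i x := by
  refine Measurable.measure_of_isPiSystem_of_isProbabilityMeasure generateFrom_pi.symm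
    isPiSystem_pi ?_
  rintro _ ⟨s, hs, rfl⟩
  simp only [Measure.pi_pi]
  exact Finset.measurable_prod _ fun i _ => (κ i).measurable_coe (hs i (Set.mem_univ i))

/-- The conditional law of all coordinates given the root. -/
noncomputable def starKernel {d : ℕ} [NeZero d] (κ : Fin d → Kernel ℝ ℝ)
    [∀ j, IsMarkovKernel (κ j)] : Kernel ℝ (Fin d → ℝ) where
  toFun x := Measure.pi fun j => starCoord κ j x
  measurable' := measurable_pi_kernel _

theorem starKernel_apply {d : ℕ} [NeZero d] (κ : Fin d → Kernel ℝ ℝ)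
    [∀ j, IsMarkovKernel (κ j)] (x : ℝ) :
    starKernel κ x = Measure.pi fun j => starCoord κ j x :=
  rfl

instance {d : ℕ} [NeZero d] (κ : Fin d → Kernel ℝ ℝ) [∀ j, IsMarkovKernel (κ j)] :
    IsMarkovKernel (starKernel κ) :=
  ⟨fun x => by rw [starKernel_apply]; infer_instance⟩

theorem starMeasurePi_eq_comp {d : ℕ} [NeZero d] (p : Measure ℝ) (κ : Fin d → Kernel ℝ ℝ)
    [∀ j, IsMarkovKernel (κ j)] : starMeasurePi p κ = starKernel κ ∘ₘ p := by
  unfold starMeasurePi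
  congr 1
  funext x
  simp only [starKernel_apply, starCoord_apply]

theorem starKernel_map_eval {d : ℕ} [NeZero d] (κ : Fin d → Kernel ℝ ℝ)
    [∀ j, IsMarkovKernel (κ j)] (x : ℝ) (j : Fin d) :
    (starKernel κ x).map (fun z => z j) = starCoord κ j x := by
  have := Measure.pi_map_eval (μ := fun j => starCoord κ j x) j
  rw [starKernel_apply]
  simpa only [measure_univ, Finset.prod_const_one, one_smul] using this

theorem starKernel_root {d : ℕ} [NeZero d] (κ : Fin d → Kernel ℝ ℝ)
    [∀ j, IsMarkovKernel (κ j)] (x : ℝ) : ∀ᵐ z ∂(starKernel κ x), z 0 = x := by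
  have h : ∀ᵐ y ∂((starKernel κ x).map fun z => z 0), y = x := by
    rw [starKernel_map_eval, starCoord_apply, if_pos rfl]
    simp [ae_dirac_eq]
  exact ae_of_ae_map (measurable_pi_apply 0).aemeasurable h

theorem iIndepFun_starKernel {d : ℕ} [NeZero d] (κ : Fin d → Kernel ℝ ℝ)
    [∀ j, IsMarkovKernel (κ j)] {β : Type*} [MeasurableSpace β] (x : ℝ)
    {f : Fin d → ℝ → β} (hf : ∀ j, Measurable (f j)) :
    iIndepFun (fun j (z : Fin d → ℝ) => f j (z j)) (starKernel κ x) := by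
  rw [starKernel_apply]
  exact iIndepFun_pi fun j => (hf j).aemeasurable

theorem starKernel_comp_map_root {d : ℕ} [NeZero d] (p : Measure ℝ)
    (κ : Fin d → Kernel ℝ ℝ) [∀ j, IsMarkovKernel (κ j)] :
    (starKernel κ ∘ₘ p).map (fun z => z 0) = p := by
  ext s hs
  have h0 : Measurable fun z : Fin d → ℝ => z 0 := measurable_pi_apply 0
  rw [Measure.map_apply h0 hs, Measure.bind_apply (h0 hs) (Kernel.aemeasurable _)]
  simp_rw [← Measure.map_apply h0 hs, starKernel_map_eval, starCoord_apply, if_true,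
    Measure.dirac_apply' _ hs]
  rw [lintegral_indicator_one hs]

/-- Integration against a star-structured measure, conditionally on the root. -/
theorem integral_starKernel_comp {d : ℕ} [NeZero d] {p : Measure ℝ} [IsProbabilityMeasure p]
    {κ : Fin d → Kernel ℝ ℝ} [∀ j, IsMarkovKernel (κ j)] {f : (Fin d → ℝ) → ℝ} {g : ℝ → ℝ}
    (hf : Integrable f (starKernel κ ∘ₘ p))
    (hfg : ∀ᵐ x ∂p, ∫ z, f z ∂(starKernel κ x) = g x) :
    Integrable g p ∧ ∫ z, f z ∂(starKernel κ ∘ₘ p) = ∫ x, g x ∂p := by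
  rw [Measure.comp_eq_comp_const_apply] at hf ⊢
  refine ⟨?_, ?_⟩
  · have := hf.integral_comp
    rw [Kernel.const_apply] at this
    exact this.congr hfg
  · rw [Kernel.integral_comp hf, Kernel.const_apply]
    exact integral_congr_ae hfg

/-- The conditional mean of `u` given the root. -/
noncomputable def condMean {d : ℕ} [NeZero d] (κ : Fin d → Kernel ℝ ℝ)
    [∀ j, IsMarkovKernel (κ j)] (u : (Fin d → ℝ) → ℝ) (x : ℝ) : ℝ :=
  ∫ z, u z ∂(starKernel κ x)

theorem measurable_condMean {d : ℕ} [NeZero d] (κ : Fin d → Kernel ℝ ℝ)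
    [∀ j, IsMarkovKernel (κ j)] {u : (Fin d → ℝ) → ℝ} (hu : Measurable u) :
    Measurable (condMean κ u) :=
  (hu.stronglyMeasurable.integral_kernel (κ := starKernel κ)).measurable

theorem ae_memLp_two_starKernel {d : ℕ} [NeZero d] {p : Measure ℝ} [IsProbabilityMeasure p]
    {κ : Fin d → Kernel ℝ ℝ} [∀ j, IsMarkovKernel (κ j)] {u : (Fin d → ℝ) → ℝ}
    (hu : Measurable u) (h : MemLp u 2 (starKernel κ ∘ₘ p)) :
    ∀ᵐ x ∂p, MemLp u 2 (starKernel κ x) := by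
  filter_upwards [Measure.ae_integrable_of_integrable_comp h.integrable_sq] with x hx
  exact (memLp_two_iff_integrable_sq hu.aestronglyMeasurable).2 hx

theorem memLp_two_condMean {d : ℕ} [NeZero d] {p : Measure ℝ} [IsProbabilityMeasure p]
    {κ : Fin d → Kernel ℝ ℝ} [∀ j, IsMarkovKernel (κ j)] {u : (Fin d → ℝ) → ℝ}
    (hu : Measurable u) (h : MemLp u 2 (starKernel κ ∘ₘ p)) :
    MemLp (condMean κ u) 2 p := by
  have hm := measurable_condMean κ hu
  rw [memLp_two_iff_integrable_sq hm.aestronglyMeasurable]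
  refine (integral_starKernel_comp h.integrable_sq (ae_of_all _ fun x => rfl)).1.mono'
    (hm.pow_const 2).aestronglyMeasurable ?_
  filter_upwards [ae_memLp_two_starKernel hu h] with x hx
  rw [Real.norm_of_nonneg (sq_nonneg _)]
  have h1 := variance_nonneg u (starKernel κ x)
  rw [variance_eq_sub hx] at h1
  simpa [condMean] using h1

theorem memLp_two_comp_root {d : ℕ} [NeZero d] {p : Measure ℝ} {κ : Fin d → Kernel ℝ ℝ}
    [∀ j, IsMarkovKernel (κ j)] {g : ℝ → ℝ} (hg : MemLp g 2 p) :
    MemLp (fun z => g (z 0)) 2 (starKernel κ ∘ₘ p) :=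
  MemLp.comp_of_map (by rwa [starKernel_comp_map_root]) (measurable_pi_apply 0).aemeasurable

theorem integral_comp_root {d : ℕ} [NeZero d] {p : Measure ℝ} {κ : Fin d → Kernel ℝ ℝ}
    [∀ j, IsMarkovKernel (κ j)] {g : ℝ → ℝ} (hg : Measurable g) :
    ∫ z, g (z 0) ∂(starKernel κ ∘ₘ p) = ∫ x, g x ∂p := by
  conv_rhs => rw [← starKernel_comp_map_root p κ]
  rw [integral_map (measurable_pi_apply 0).aemeasurable hg.aestronglyMeasurable]

/-- Distinct leaf residuals are conditionally uncorrelated given the root. -/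
theorem integral_resid_mul_resid {d : ℕ} [NeZero d] (m : Fin d → ℝ)
    (S : Matrix (Fin d) (Fin d) ℝ) {p : Measure ℝ} [IsProbabilityMeasure p]
    {κ : Fin d → Kernel ℝ ℝ} [∀ j, IsMarkovKernel (κ j)]
    (h : ∀ i, MemLp (resid m S i) 2 (starKernel κ ∘ₘ p)) {i j : Fin d} (hij : i ≠ j) :
    ∫ z, resid m S i z * resid m S j z ∂(starKernel κ ∘ₘ p) =
      ∫ x, condMean κ (resid m S i) x * condMean κ (resid m S j) x ∂p := by
  refine (integral_starKernel_comp ((h i).integrable_mul (h j)) (ae_of_all _ fun x => ?_)).2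
  have hr : ∀ k, resid m S k =ᵐ[starKernel κ x] fun z => z k - leafMean m S k x := fun k => by
    filter_upwards [starKernel_root κ x] with z hz
    rw [resid, hz]
  have hm : ∀ k, AEStronglyMeasurable (fun z => z k - leafMean m S k x) (starKernel κ x) :=
    fun k => ((measurable_pi_apply k).sub_const _).aestronglyMeasurable
  have hind := (iIndepFun_starKernel κ x (f := fun k y => y - leafMean m S k x)
    (fun k => by fun_prop)).indepFun hij
  rw [condMean, condMean, integral_congr_ae (hr i), integral_congr_ae (hr j),
    ← hind.integral_fun_mul_eq_mul_integral (hm i) (hm j)]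
  refine integral_congr_ae ?_
  filter_upwards [hr i, hr j] with z hi hj
  rw [Pi.mul_apply, hi, hj]

theorem integral_condMean_mul_self {d : ℕ} [NeZero d] {p : Measure ℝ} [IsProbabilityMeasure p]
    {κ : Fin d → Kernel ℝ ℝ} [∀ j, IsMarkovKernel (κ j)] {u : (Fin d → ℝ) → ℝ}
    (hu : Measurable u) (h : MemLp u 2 (starKernel κ ∘ₘ p)) :
    ∫ z, condMean κ u (z 0) * u z ∂(starKernel κ ∘ₘ p) = ∫ x, condMean κ u x ^ 2 ∂p := by
  refine (integral_starKernel_comp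
    ((memLp_two_comp_root (memLp_two_condMean hu h)).integrable_mul h)
    (ae_of_all _ fun x => ?_)).2
  have : (fun z => condMean κ u (z 0) * u z) =ᵐ[starKernel κ x] fun z => condMean κ u x * u z := by
    filter_upwards [starKernel_root κ x] with z hz
    rw [hz]
  rw [sq]
  exact (integral_congr_ae this).trans (integral_const_mul _ _)

theorem pi_eq_starKernel_comp {d : ℕ} [NeZero d] (ν : Fin d → Measure ℝ)
    [∀ i, IsProbabilityMeasure (ν i)] :
    Measure.pi ν = starKernel (fun j => Kernel.const ℝ (ν j)) ∘ₘ ν 0 := by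
  refine Measure.pi_eq fun s hs => ?_
  rw [Measure.bind_apply (MeasurableSet.univ_pi hs) (Kernel.aemeasurable _)]
  simp_rw [starKernel_apply, Measure.pi_pi, starCoord_apply, Kernel.const_apply]
  have h : ∀ x, ∏ i, (if i = 0 then Measure.dirac x else ν i) (s i) =
      (s 0).indicator 1 x * ∏ i ∈ Finset.univ.erase 0, ν i (s i) := fun x => by
    rw [← Finset.mul_prod_erase _ _ (Finset.mem_univ 0), if_pos rfl,
      Measure.dirac_apply' _ (hs 0)]
    congr 1
    exact Finset.prod_congr rfl fun i hi => by rw [if_neg (Finset.ne_of_mem_erase hi)]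
  simp_rw [h]
  rw [lintegral_mul_const _ (measurable_one.indicator (hs 0)), lintegral_indicator_one (hs 0),
    Finset.mul_prod_erase _ (fun i => ν i (s i)) (Finset.mem_univ 0)]

/-- The root marginal of the minimizer. -/
noncomputable def gaussRoot {d : ℕ} [NeZero d] (m : Fin d → ℝ)
    (S : Matrix (Fin d) (Fin d) ℝ) : Measure ℝ :=
  gaussianReal (m 0) (Real.toNNReal (S 0 0))

/-- The conditional leaf laws of the minimizer. -/
noncomputable def gaussLeaf {d : ℕ} [NeZero d] (m : Fin d → ℝ)
    (S : Matrix (Fin d) (Fin d) ℝ) (j : Fin d) : Kernel ℝ ℝ where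
  toFun x := gaussianReal (leafMean m S j x) (Real.toNNReal ((S⁻¹ j j)⁻¹))
  measurable' := measurable_gaussianReal.comp
    ((measurable_leafMean m S j).prodMk measurable_const)

theorem gaussLeaf_apply {d : ℕ} [NeZero d] (m : Fin d → ℝ) (S : Matrix (Fin d) (Fin d) ℝ)
    (j : Fin d) (x : ℝ) :
    gaussLeaf m S j x = gaussianReal (leafMean m S j x) (Real.toNNReal ((S⁻¹ j j)⁻¹)) :=
  rfl

instance {d : ℕ} [NeZero d] (m : Fin d → ℝ) (S : Matrix (Fin d) (Fin d) ℝ) :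
    IsProbabilityMeasure (gaussRoot m S) := by
  unfold gaussRoot
  infer_instance

instance {d : ℕ} [NeZero d] (m : Fin d → ℝ) (S : Matrix (Fin d) (Fin d) ℝ) (j : Fin d) :
    IsMarkovKernel (gaussLeaf m S j) :=
  ⟨fun x => by rw [gaussLeaf_apply]; infer_instance⟩

open Matrix in
theorem starKernel_const_map {d : ℕ} [NeZero d] (m : Fin d → ℝ)
    (S : Matrix (Fin d) (Fin d) ℝ) (y : ℝ) :
    (starKernel (fun j => Kernel.const ℝ (gaussianReal 0 (Real.toNNReal (starVar S j)))) y).map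
      (fun w => m + starFactor S *ᵥ w) = starKernel (gaussLeaf m S) (m 0 + y) := by
  set b : Fin d → ℝ := fun i => (if i = 0 then 0 else (S 0 0)⁻¹ * S 0 i) * y + m i
  have h : (fun w => m + starFactor S *ᵥ w) =ᵐ[starKernel
      (fun j => Kernel.const ℝ (gaussianReal 0 (Real.toNNReal (starVar S j)))) y]
      fun w i => w i + b i := by
    filter_upwards [starKernel_root _ y] with w hw
    funext i
    rw [Pi.add_apply, starFactor_mulVec, hw]
    ring
  have hmap := Measure.pi_map_pi (μ := fun j => starCoord
    (fun j => Kernel.const ℝ (gaussianReal 0 (Real.toNNReal (starVar S j)))) j y)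
    (f := fun i t => t + b i) (fun i => by fun_prop)
  rw [Measure.map_congr h, starKernel_apply, hmap, starKernel_apply]
  congr 1
  funext i
  rw [starCoord_apply, starCoord_apply]
  split_ifs with hi
  · rw [Measure.map_dirac' (measurable_add_const (b i)) y]
    simp [b, hi, add_comm]
  · rw [Kernel.const_apply, gaussianReal_map_add_const, gaussLeaf_apply]
    simp only [b, leafMean, starVar, hi, if_false]
    congr 1
    ring

open Matrix in
theorem starKernel_gaussLeaf_comp {d : ℕ} [NeZero d] (m : Fin d → ℝ)
    {S : Matrix (Fin d) (Fin d) ℝ} (hS : S.PosDef) :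
    starKernel (gaussLeaf m S) ∘ₘ gaussRoot m S = gaussPi m (starCov S) := by
  have hv : ∀ i, ((Real.toNNReal (starVar S i) : NNReal) : ℝ) = starVar S i := fun i =>
    Real.coe_toNNReal _ (starVar_pos hS i).le
  have h := map_affine_pi_gaussianReal m (starFactor S)
    (by rw [det_starFactor]; exact one_ne_zero) (fun i => Real.toNNReal (starVar S i))
    (fun i => (Real.toNNReal_pos.2 (starVar_pos hS i)).ne')
  simp_rw [hv] at h
  rw [starCov_eq_factor hS]
  refine Eq.trans ?_ h
  have hT : Measurable fun w : Fin d → ℝ => m + starFactor S *ᵥ w := by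
    unfold mulVec dotProduct
    fun_prop
  have hroot : gaussRoot m S =
      (gaussianReal 0 (Real.toNNReal (starVar S 0))).map (fun y => m 0 + y) := by
    rw [gaussianReal_map_const_add, gaussRoot, zero_add]
    simp [starVar]
  rw [pi_eq_starKernel_comp, hroot]
  ext s hs
  rw [Measure.map_apply hT hs, Measure.bind_apply (hT hs) (Kernel.aemeasurable _),
    Measure.bind_apply hs (Kernel.aemeasurable _),
    lintegral_map (Kernel.measurable_coe _ hs) (by fun_prop)]
  refine lintegral_congr fun y => ?_
  rw [← starKernel_const_map, Measure.map_apply hT hs]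

theorem lintegral_exp_gaussianReal (c a : ℝ) {l : ℝ} (hl : 0 < l) :
    ∫⁻ y, ENNReal.ofReal (Real.exp (l * (a * (y - c) - a ^ 2 / 2)))
      ∂(gaussianReal c (Real.toNNReal l⁻¹)) = 1 := by
  have h : ∀ y, Real.exp (l * (a * (y - c) - a ^ 2 / 2)) =
      Real.exp (-(l * a * c) - l * a ^ 2 / 2) * Real.exp (l * a * y) := fun y => by
    rw [← Real.exp_add]
    congr 1
    ring
  have hmgf := congrFun (mgf_fun_id_gaussianReal (μ := c) (v := Real.toNNReal l⁻¹)) (l * a)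
  rw [mgf, Real.coe_toNNReal _ (inv_pos.2 hl).le] at hmgf
  simp_rw [h]
  rw [← ofReal_integral_eq_lintegral_ofReal ((integrable_exp_mul_gaussianReal (l * a)).const_mul _)
    (ae_of_all _ fun y => by positivity), integral_const_mul, hmgf, ← Real.exp_add,
    ← ENNReal.ofReal_one, ← Real.exp_zero]
  congr 2
  field_simp
  ring

/-- The log-density that shifts the conditional leaf means of the minimizer by `a`. -/
noncomputable def shiftLogDensity {d : ℕ} [NeZero d] (m : Fin d → ℝ)
    (S : Matrix (Fin d) (Fin d) ℝ) (a : Fin d → ℝ → ℝ) (z : Fin d → ℝ) : ℝ :=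
  ∑ j, S⁻¹ j j * (a j (z 0) * resid m S j z - a j (z 0) ^ 2 / 2)

theorem measurable_shiftLogDensity {d : ℕ} [NeZero d] (m : Fin d → ℝ)
    (S : Matrix (Fin d) (Fin d) ℝ) {a : Fin d → ℝ → ℝ} (ha : ∀ j, Measurable (a j)) :
    Measurable (shiftLogDensity m S a) := by
  have h1 := measurable_resid m S
  have h2 : ∀ j, Measurable fun z : Fin d → ℝ => a j (z 0) := fun j =>
    (ha j).comp (measurable_pi_apply 0)
  unfold shiftLogDensity
  fun_prop

theorem integrable_exp_shiftLogDensity {d : ℕ} [NeZero d] (m : Fin d → ℝ)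
    {S : Matrix (Fin d) (Fin d) ℝ} (hS : S.PosDef) {a : Fin d → ℝ → ℝ}
    (ha : ∀ j, Measurable (a j)) (ha0 : a 0 = 0) :
    Integrable (fun z => Real.exp (shiftLogDensity m S a z)) (gaussPi m (starCov S)) ∧
      ∫ z, Real.exp (shiftLogDensity m S a z) ∂(gaussPi m (starCov S)) = 1 := by
  have hmeas := (measurable_shiftLogDensity m S ha).exp
  have hl : ∫⁻ z, ENNReal.ofReal (Real.exp (shiftLogDensity m S a z))
      ∂(gaussPi m (starCov S)) = 1 := by
    rw [← starKernel_gaussLeaf_comp m hS, Measure.lintegral_bind (Kernel.aemeasurable _)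
      hmeas.ennreal_ofReal.aemeasurable]
    rw [← measure_univ (μ := gaussRoot m S), ← lintegral_one]
    refine lintegral_congr fun x => ?_
    let φ : Fin d → ℝ → ℝ≥0∞ := fun j y => ENNReal.ofReal
      (Real.exp (S⁻¹ j j * (a j x * (y - leafMean m S j x) - a j x ^ 2 / 2)))
    have hφ : ∀ j, Measurable (φ j) := fun j => by fun_prop
    have hind : iIndepFun (fun j (z : Fin d → ℝ) => φ j (z j)) (starKernel (gaussLeaf m S) x) :=
      iIndepFun_starKernel _ x hφ
    have hprod : (fun z => ENNReal.ofReal (Real.exp (shiftLogDensity m S a z)))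
        =ᵐ[starKernel (gaussLeaf m S) x] fun z => ∏ j, φ j (z j) := by
      filter_upwards [starKernel_root _ x] with z hz
      simp only [φ]
      rw [shiftLogDensity, Real.exp_sum, ENNReal.ofReal_prod_of_nonneg
        fun _ _ => (Real.exp_pos _).le]
      simp only [resid, hz]
    rw [lintegral_congr_ae hprod, lintegral_prod_eq_prod_lintegral_of_indepFun _ _ hind
      fun j => (hφ j).comp (measurable_pi_apply j)]
    refine Finset.prod_eq_one fun j _ => ?_
    rw [← lintegral_map (hφ j) (measurable_pi_apply j), starKernel_map_eval, starCoord_apply]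
    split_ifs with hj
    · simp [φ, hj, ha0]
    · exact lintegral_exp_gaussianReal _ _ hS.inv.diag_pos
  exact integrable_exp_of_lintegral_eq_one (measurable_shiftLogDensity m S ha) hl

theorem integrable_starLogDensity {d : ℕ} [NeZero d] (m : Fin d → ℝ)
    (S : Matrix (Fin d) (Fin d) ℝ) {μ : Measure (Fin d → ℝ)} [IsProbabilityMeasure μ]
    (h : ∀ i, MemLp (resid m S i) 2 μ) : Integrable (starLogDensity m S) μ := by
  refine (integrable_const _).add (Integrable.div_const ?_ _)
  exact integrable_finsetSum _ fun i _ => integrable_finsetSum _ fun j _ =>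
    ((h i).integrable_mul (h j)).const_mul _

/-- The conditional means of the residuals given the root. -/
noncomputable def residMean {d : ℕ} [NeZero d] (m : Fin d → ℝ) (S : Matrix (Fin d) (Fin d) ℝ)
    (κ : Fin d → Kernel ℝ ℝ) [∀ j, IsMarkovKernel (κ j)] (j : Fin d) : ℝ → ℝ :=
  condMean κ (resid m S j)

theorem measurable_residMean {d : ℕ} [NeZero d] (m : Fin d → ℝ) (S : Matrix (Fin d) (Fin d) ℝ)
    (κ : Fin d → Kernel ℝ ℝ) [∀ j, IsMarkovKernel (κ j)] (j : Fin d) :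
    Measurable (residMean m S κ j) :=
  measurable_condMean κ (measurable_resid m S j)

theorem residMean_zero {d : ℕ} [NeZero d] (m : Fin d → ℝ) {S : Matrix (Fin d) (Fin d) ℝ}
    (hS : S.PosDef) (κ : Fin d → Kernel ℝ ℝ) [∀ j, IsMarkovKernel (κ j)] :
    residMean m S κ 0 = 0 := by
  funext x
  simp [residMean, condMean, resid_zero m hS]

theorem residMean_gaussLeaf {d : ℕ} [NeZero d] (m : Fin d → ℝ) {S : Matrix (Fin d) (Fin d) ℝ}
    (hS : S.PosDef) (j : Fin d) (x : ℝ) : residMean m S (gaussLeaf m S) j x = 0 := by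
  by_cases hj : j = 0
  · rw [hj, residMean_zero m hS, Pi.zero_apply]
  have h : resid m S j =ᵐ[starKernel (gaussLeaf m S) x] fun z => z j - leafMean m S j x := by
    filter_upwards [starKernel_root _ x] with z hz
    rw [resid, hz]
  have hint : Integrable (fun y : ℝ => y)
      (gaussianReal (leafMean m S j x) (Real.toNNReal ((S⁻¹ j j)⁻¹))) :=
    (memLp_id_gaussianReal 1).integrable le_rfl
  rw [residMean, condMean, integral_congr_ae h,
    ← integral_map (φ := fun z : Fin d → ℝ => z j) (f := fun y => y - leafMean m S j x)
      (measurable_pi_apply j).aemeasurable (by fun_prop), starKernel_map_eval, starCoord_apply, if_neg hj, gaussLeaf_apply,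
    integral_sub hint (integrable_const _), integral_id_gaussianReal]
  simp

section StarMeasure

variable {d : ℕ} [NeZero d] {m : Fin d → ℝ} {S : Matrix (Fin d) (Fin d) ℝ} {p : Measure ℝ}
  [IsProbabilityMeasure p] {κ : Fin d → Kernel ℝ ℝ} [∀ j, IsMarkovKernel (κ j)]

theorem integral_starLogDensity (h : ∀ i, MemLp (resid m S i) 2 (starKernel κ ∘ₘ p)) :
    ∫ z, starLogDensity m S z ∂(starKernel κ ∘ₘ p) = starLogConst S +
      (∑ i, ∑ j, offDiagPrec S i j *
        ∫ x, residMean m S κ i x * residMean m S κ j x ∂p) / 2 := by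
  have hij : ∀ i j, Integrable (fun z => offDiagPrec S i j * (resid m S i z * resid m S j z))
      (starKernel κ ∘ₘ p) := fun i j => ((h i).integrable_mul (h j)).const_mul _
  have hi := fun i => integrable_finsetSum Finset.univ fun j _ => hij i j
  unfold starLogDensity
  rw [integral_add (integrable_const _) ((integrable_finsetSum _ fun i _ => hi i).div_const _),
    integral_const, integral_div, integral_finsetSum _ fun i _ => hi i]
  simp only [probReal_univ, one_smul]
  congr 2
  refine Finset.sum_congr rfl fun i _ => ?_
  rw [integral_finsetSum _ fun j _ => hij i j]
  refine Finset.sum_congr rfl fun j _ => ?_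
  rw [integral_const_mul]
  by_cases hne : i = j
  · simp [offDiagPrec, hne]
  · rw [integral_resid_mul_resid m S h hne]
    rfl

theorem memLp_two_residMean (h : ∀ i, MemLp (resid m S i) 2 (starKernel κ ∘ₘ p)) (i : Fin d) :
    MemLp (residMean m S κ i) 2 p :=
  memLp_two_condMean (measurable_resid m S i) (h i)

theorem integral_shiftLogDensity (h : ∀ i, MemLp (resid m S i) 2 (starKernel κ ∘ₘ p)) :
    Integrable (shiftLogDensity m S (residMean m S κ)) (starKernel κ ∘ₘ p) ∧
      ∫ z, shiftLogDensity m S (residMean m S κ) z ∂(starKernel κ ∘ₘ p) =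
        (∑ i, S⁻¹ i i * ∫ x, residMean m S κ i x ^ 2 ∂p) / 2 := by
  have ha := fun i => memLp_two_comp_root (κ := κ) (memLp_two_residMean h i)
  have h1 : ∀ i, Integrable (fun z => residMean m S κ i (z 0) * resid m S i z)
      (starKernel κ ∘ₘ p) := fun i => (ha i).integrable_mul (h i)
  have h2 := fun i => (ha i).integrable_sq.div_const 2
  have h3 : ∀ i, Integrable (fun z => S⁻¹ i i *
      (residMean m S κ i (z 0) * resid m S i z - residMean m S κ i (z 0) ^ 2 / 2))
      (starKernel κ ∘ₘ p) := fun i => ((h1 i).sub (h2 i)).const_mul _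
  refine ⟨integrable_finsetSum _ fun i _ => h3 i, ?_⟩
  unfold shiftLogDensity
  rw [integral_finsetSum _ fun i _ => h3 i, Finset.sum_div]
  refine Finset.sum_congr rfl fun i _ => ?_
  rw [integral_const_mul, integral_sub (h1 i) (h2 i), integral_div,
    integral_comp_root (g := fun x => residMean m S κ i x ^ 2)
      ((measurable_residMean m S κ i).pow_const 2)]
  simp only [residMean]
  rw [integral_condMean_mul_self (measurable_resid m S i) (h i)]
  ring

open Matrix in
/-- The precision-weighted quadratic form of the conditional residual means. -/
noncomputable def meanEnergy (m : Fin d → ℝ) (S : Matrix (Fin d) (Fin d) ℝ)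
    (κ : Fin d → Kernel ℝ ℝ) [∀ j, IsMarkovKernel (κ j)] (x : ℝ) : ℝ :=
  (fun i => residMean m S κ i x) ⬝ᵥ (S⁻¹ *ᵥ fun i => residMean m S κ i x)

theorem integral_meanEnergy (h : ∀ i, MemLp (resid m S i) 2 (starKernel κ ∘ₘ p)) :
    Integrable (meanEnergy m S κ) p ∧ ∫ x, meanEnergy m S κ x ∂p =
      ∑ i, ∑ j, offDiagPrec S i j * ∫ x, residMean m S κ i x * residMean m S κ j x ∂p +
        ∑ i, S⁻¹ i i * ∫ x, residMean m S κ i x ^ 2 ∂p := by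
  have ha := memLp_two_residMean h
  have hE : meanEnergy m S κ = fun x =>
      ∑ i, ∑ j, offDiagPrec S i j * (residMean m S κ i x * residMean m S κ j x) +
        ∑ i, S⁻¹ i i * residMean m S κ i x ^ 2 := by
    funext x
    rw [sum_offDiagPrec_mul S fun i => residMean m S κ i x, sub_add_cancel, meanEnergy]
  have h1 : ∀ i j, Integrable
      (fun x => offDiagPrec S i j * (residMean m S κ i x * residMean m S κ j x)) p :=
    fun i j => ((ha i).integrable_mul (ha j)).const_mul _
  have h2 := fun i => integrable_finsetSum Finset.univ fun j _ => h1 i j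
  have h3 := fun i => (ha i).integrable_sq.const_mul (S⁻¹ i i)
  have h4 := integrable_finsetSum Finset.univ fun i _ => h2 i
  have h5 := integrable_finsetSum Finset.univ fun i _ => h3 i
  rw [hE]
  refine ⟨h4.add h5, ?_⟩
  rw [integral_add h4 h5, integral_finsetSum _ fun i _ => h2 i,
    integral_finsetSum _ fun i _ => h3 i]
  simp_rw [integral_finsetSum _ fun j _ => h1 _ j, integral_const_mul]

theorem meanEnergy_nonneg (hS : S.PosDef) (x : ℝ) : 0 ≤ meanEnergy m S κ x := by
  simpa [meanEnergy] using hS.inv.posSemidef.dotProduct_mulVec_nonneg fun i => residMean m S κ i x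

open InformationTheory in
theorem starLogConst_add_le_klDiv (hS : S.PosDef)
    (hkl : klDiv (starKernel κ ∘ₘ p) (gaussPi m S) ≠ ∞) :
    starLogConst S + (∫ x, meanEnergy m S κ x ∂p) / 2 ≤
      (klDiv (starKernel κ ∘ₘ p) (gaussPi m S)).toReal := by
  have := isProbabilityMeasure_gaussPi m hS
  have := isProbabilityMeasure_gaussPi m (posDef_starCov hS)
  have hL := memLp_two_resid (S := S) hS hkl
  obtain ⟨hexp, hone⟩ := integrable_exp_starLogDensity m hS
  have hf := integrable_starLogDensity m S hL
  obtain ⟨hh, hhint⟩ := integral_shiftLogDensity hL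
  obtain ⟨hexp', hone'⟩ := integrable_exp_shiftLogDensity m hS
    (measurable_residMean m S κ) (residMean_zero m hS κ)
  have hne := klDiv_tilted_ne_top hkl hf hexp
  have h1 := toReal_klDiv_eq_tilted_add hkl hf hexp hone
  rw [← gaussPi_starCov_eq_tilted m hS] at hne h1
  have h2 := toReal_klDiv_eq_tilted_add hne hh hexp' hone'
  rw [h1, h2, hhint, integral_starLogDensity hL, (integral_meanEnergy hL).2]
  have h3 : 0 ≤ (klDiv (starKernel κ ∘ₘ p)
      ((gaussPi m (starCov S)).tilted (shiftLogDensity m S (residMean m S κ)))).toReal :=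
    ENNReal.toReal_nonneg
  linarith

open InformationTheory in
theorem klDiv_gaussLeaf (hS : S.PosDef) :
    klDiv (gaussPi m (starCov S)) (gaussPi m S) ≠ ∞ ∧
      (klDiv (gaussPi m (starCov S)) (gaussPi m S)).toReal = starLogConst S := by
  have := isProbabilityMeasure_gaussPi m hS
  have := isProbabilityMeasure_gaussPi m (posDef_starCov hS)
  have hL : ∀ i, MemLp (resid m S i) 2 (gaussPi m (starCov S)) :=
    memLp_two_resid (posDef_starCov hS) (by simp)
  obtain ⟨hexp, hone⟩ := integrable_exp_starLogDensity m hS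
  have hf := integrable_starLogDensity m S hL
  have hne : klDiv (gaussPi m (starCov S)) (gaussPi m S) ≠ ∞ := by
    rw [gaussPi_starCov_eq_tilted m hS] at hf ⊢
    exact klDiv_tilted_self_ne_top hf hexp
  refine ⟨hne, ?_⟩
  rw [toReal_klDiv_eq_tilted_add hne hf hexp hone, ← gaussPi_starCov_eq_tilted m hS, klDiv_self]
  rw [← starKernel_gaussLeaf_comp m hS] at hL ⊢
  rw [integral_starLogDensity hL]
  simp [residMean_gaussLeaf m hS]

open InformationTheory in
theorem eq_gaussPi_of_klDiv_le (hS : S.PosDef)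
    (hkl : klDiv (starKernel κ ∘ₘ p) (gaussPi m S) ≠ ∞)
    (hle : (klDiv (starKernel κ ∘ₘ p) (gaussPi m S)).toReal ≤ starLogConst S) :
    starKernel κ ∘ₘ p = gaussPi m (starCov S) := by
  have := isProbabilityMeasure_gaussPi m hS
  have := isProbabilityMeasure_gaussPi m (posDef_starCov hS)
  have hL := memLp_two_resid (S := S) hS hkl
  have hf := integrable_starLogDensity m S hL
  obtain ⟨hexp, hone⟩ := integrable_exp_starLogDensity m hS
  have hnn : 0 ≤ meanEnergy m S κ := fun x => meanEnergy_nonneg hS x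
  have hzero : ∫ x, meanEnergy m S κ x ∂p = 0 := by
    have h1 := starLogConst_add_le_klDiv hS hkl
    have h2 : 0 ≤ ∫ x, meanEnergy m S κ x ∂p := integral_nonneg hnn
    linarith
  rw [integral_eq_zero_iff_of_nonneg hnn (integral_meanEnergy hL).1] at hzero
  have ha : ∀ i, residMean m S κ i =ᵐ[p] 0 := fun i => by
    filter_upwards [hzero] with x hx
    have h := sq_le_mul_dotProduct_inv_mulVec hS i fun i => residMean m S κ i x
    change _ ≤ S i i * meanEnergy m S κ x at h
    rw [hx, Pi.zero_apply, mul_zero] at h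
    exact pow_eq_zero_iff two_ne_zero |>.1 (le_antisymm h (sq_nonneg _))
  have hint : ∀ i j, ∫ x, residMean m S κ i x * residMean m S κ j x ∂p = 0 := fun i j =>
    integral_eq_zero_of_ae <| by
      filter_upwards [ha i] with x hx
      rw [hx, Pi.zero_apply, zero_mul]
  have hne := klDiv_tilted_ne_top hkl hf hexp
  have h1 := toReal_klDiv_eq_tilted_add hkl hf hexp hone
  rw [← gaussPi_starCov_eq_tilted m hS] at hne h1
  rw [integral_starLogDensity hL] at h1
  simp only [hint, mul_zero, Finset.sum_const_zero, zero_div, add_zero] at h1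
  have h2 : (klDiv (starKernel κ ∘ₘ p) (gaussPi m (starCov S))).toReal = 0 :=
    le_antisymm (by linarith) ENNReal.toReal_nonneg
  exact klDiv_eq_zero_iff.1 ((ENNReal.toReal_eq_zero_iff _).1 h2 |>.resolve_right hne)

end StarMeasure

/-- **The SSVI minimizer of a Gaussian target is Gaussian** with the stated root marginal,
conditional leaf laws and covariance. -/
theorem stmt7 {d : ℕ} [NeZero d] (hd : 2 ≤ d)
    (m : Fin d → ℝ) (S : Matrix (Fin d) (Fin d) ℝ) (hS : S.PosDef)
    (π : Measure (Fin d → ℝ)) (hπ : π = gaussPi m S) :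
    ∃ (p : Measure ℝ) (κ : Fin d → Kernel ℝ ℝ),
      IsProbabilityMeasure p ∧ (∀ j, IsMarkovKernel (κ j)) ∧
      IsStarPi (starMeasurePi p κ) ∧
      -- π⋆ = starMeasurePi p κ is the unique minimizer of KL(· ‖ π) over C_star
      (∀ μ, IsStarPi μ → KL (starMeasurePi p κ) π ≤ KL μ π) ∧
      (∀ μ, IsStarPi μ → (∀ ν, IsStarPi ν → KL μ π ≤ KL ν π) → μ = starMeasurePi p κ) ∧
      -- p⋆ = N(m₁, σ₁₁)
      p = gaussianReal (m 0) (Real.toNNReal (S 0 0)) ∧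
      -- q⋆_i(· ∣ z₁) = N(m_i + σ₁₁⁻¹ σ_{1i} (z₁ - m₁), (σ^{ii})⁻¹)
      (∀ j : Fin d, j ≠ 0 → ∀ z₁ : ℝ,
        κ j z₁ = gaussianReal (m j + (S 0 0)⁻¹ * S 0 j * (z₁ - m 0))
          (Real.toNNReal ((S⁻¹ j j)⁻¹))) ∧
      -- equivalently, π⋆ = N(m, Σ⋆) with the stated covariance Σ⋆
      starMeasurePi p κ = gaussPi m (Matrix.of fun i j =>
        if i = 0 then S 0 j
        else if j = 0 then S i 0
        else if i = j then (S⁻¹ i i)⁻¹ + S 0 i ^ 2 / S 0 0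
        else S 0 i * S 0 j / S 0 0) := by
  subst hπ
  have hπprob := isProbabilityMeasure_gaussPi m hS
  obtain ⟨hne, hval⟩ := klDiv_gaussLeaf (m := m) hS
  have hstar : starMeasurePi (gaussRoot m S) (gaussLeaf m S) = gaussPi m (starCov S) := by
    rw [starMeasurePi_eq_comp, starKernel_gaussLeaf_comp m hS]
  have hprob := isProbabilityMeasure_gaussPi m (posDef_starCov hS)
  have hmem : IsStarPi (starMeasurePi (gaussRoot m S) (gaussLeaf m S)) :=
    ⟨hstar ▸ hprob, _, _, inferInstance, fun _ => inferInstance, rfl⟩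
  have hKL : KL (starMeasurePi (gaussRoot m S) (gaussLeaf m S)) (gaussPi m S) =
      ENNReal.ofReal (starLogConst S) := by
    rw [hstar, KL_eq_klDiv, ← hval, ENNReal.ofReal_toReal hne]
  refine ⟨gaussRoot m S, gaussLeaf m S, inferInstance, fun _ => inferInstance, hmem, ?_, ?_, rfl,
    fun _ _ _ => rfl, hstar⟩
  · rintro _ ⟨hμ, p, κ, hp, hκ, rfl⟩
    rw [hKL, KL_eq_klDiv]
    rw [starMeasurePi_eq_comp] at hμ ⊢
    by_cases hkl : InformationTheory.klDiv (starKernel κ ∘ₘ p) (gaussPi m S) = ∞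
    · rw [hkl]
      exact le_top
    · refine ENNReal.ofReal_le_of_le_toReal (le_trans ?_ (starLogConst_add_le_klDiv hS hkl))
      have : 0 ≤ ∫ x, meanEnergy m S κ x ∂p := integral_nonneg fun x => meanEnergy_nonneg hS x
      linarith
  · rintro _ ⟨hμ, p, κ, hp, hκ, rfl⟩ hmin
    have hle := hmin _ hmem
    rw [hKL, KL_eq_klDiv] at hle
    rw [hstar]
    rw [starMeasurePi_eq_comp] at hμ hle ⊢
    have hkl := ne_top_of_le_ne_top ENNReal.ofReal_ne_top hle
    refine eq_gaussPi_of_klDiv_le hS hkl (ENNReal.toReal_le_of_le_ofReal ?_ hle)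
    exact hval ▸ ENNReal.toReal_nonneg
end
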